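/- Let ℓ be an odd prime and let 𝔣 : ℕ → ℤ be a multiplicative arithmetic function (𝔣(1) = 1 and 𝔣(mn) = 𝔣(m)𝔣(n) whenever gcd(m,n) = 1). Suppose there exist real numbers ρ > 0 and 0 < δ < 1 such that #{q ≤ x : q prime and ℓ ∣ 𝔣(q)} = δ·π(x) + O(x/(log x)^{2+ρ}) as x → ∞. Then, with h₁ = 1/δ, there exist a constant C > 0 and a real number γ such that #{n ≤ x : ℓ ∤ 𝔣(n)} = (C·x/(log x)^{1/h₁})·(1 + (1−γ)/(h₁·log x) + o(1/log x)) as x → ∞. -/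

import Mathlib

open Filter Asymptotics

open scoped Classical in
noncomputable def countBelow (P : ℕ → Prop) (x : ℝ) : ℕ :=
  ((Finset.Icc 1 ⌊x⌋₊).filter P).card

namespace LandauCount

/-- The entire function `(s - 1) ζ(s)`. -/
noncomputable def zetaOne (s : ℂ) : ℂ := Function.update (fun s => (s - 1) * riemannZeta s) 1 1 s

lemma zetaOne_of_ne {s : ℂ} (hs : s ≠ 1) : zetaOne s = (s - 1) * riemannZeta s := by
  simp [zetaOne, hs]

lemma zetaOne_one : zetaOne 1 = 1 := by simp [zetaOne]

lemma differentiable_zetaOne : Differentiable ℂ zetaOne := by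
  have h := DirichletCharacter.differentiable_LFunctionTrivChar₁ 1
  convert h using 1
  funext s
  simp [zetaOne, DirichletCharacter.LFunctionTrivChar₁, DirichletCharacter.LFunctionTrivChar]

lemma zetaOne_ne_zero {s : ℂ} (hs : 1 ≤ s.re) : zetaOne s ≠ 0 := by
  rcases eq_or_ne s 1 with rfl | h
  · simp [zetaOne_one]
  · rw [zetaOne_of_ne h]
    exact mul_ne_zero (sub_ne_zero.mpr h) (riemannZeta_ne_zero_of_one_le_re hs)

/-- The Euler–Maclaurin correction terms for `(s - 1) ζ(s)`. -/
noncomputable def zetaCorr (n : ℕ) (s : ℂ) : ℂ :=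
  (s - 1) * (n : ℂ) ^ (-s) - (n : ℂ) ^ (1 - s) + ((n + 1 : ℕ) : ℂ) ^ (1 - s)

lemma norm_cpow_sub_cpow_le {n : ℕ} (hn : 0 < n) {s : ℂ} (hs : 0 < s.re) {x : ℝ}
    (hx : x ∈ Set.Icc (n : ℝ) (n + 1)) :
    ‖(x : ℂ) ^ (-s) - (n : ℂ) ^ (-s)‖ ≤ ‖s‖ * (n : ℝ) ^ (-s.re - 1) := by
  have hn0 : (0 : ℝ) < n := by exact_mod_cast hn
  have key := (convex_Icc (n : ℝ) (n + 1)).norm_image_sub_le_of_norm_hasDerivWithin_le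
    (f := fun y : ℝ => (y : ℂ) ^ (-s)) (f' := fun y : ℝ => -s * (y : ℂ) ^ (-s - 1))
    (C := ‖s‖ * (n : ℝ) ^ (-s.re - 1)) (x := (n : ℝ)) (y := x) ?_ ?_ (by simp) hx
  · refine (by simpa using key : _ ≤ _).trans ?_
    have h1 : |x - n| ≤ 1 := by rw [abs_le]; constructor <;> linarith [hx.1, hx.2]
    have h2 : 0 ≤ ‖s‖ * (n : ℝ) ^ (-s.re - 1) := by positivity
    nlinarith
  · intro y hy
    have hy0 : 0 < y := hn0.trans_le hy.1
    exact (hasDerivAt_ofReal_cpow_const hy0.ne' (by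
      intro h
      have := congrArg Complex.re h
      simp at this
      linarith)).hasDerivWithinAt
  · intro y hy
    have hy0 : 0 < y := hn0.trans_le hy.1
    rw [norm_mul, norm_neg, Complex.norm_cpow_eq_rpow_re_of_pos hy0]
    gcongr
    simp only [Complex.sub_re, Complex.neg_re, Complex.one_re]
    exact Real.rpow_le_rpow_of_nonpos hn0 hy.1 (by linarith)

lemma norm_zetaCorr_le {n : ℕ} (hn : 0 < n) {s : ℂ} (hs : 0 < s.re) :
    ‖zetaCorr n s‖ ≤ ‖s - 1‖ * (‖s‖ * (n : ℝ) ^ (-s.re - 1)) := by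
  rcases eq_or_ne s 1 with rfl | hs1
  · simp [zetaCorr]
  have hn0 : (0 : ℝ) < n := by exact_mod_cast hn
  have key := (convex_Icc (n : ℝ) (n + 1)).norm_image_sub_le_of_norm_hasDerivWithin_le
    (f := fun y : ℝ => (y : ℂ) ^ (1 - s) + (s - 1) * (n : ℂ) ^ (-s) * y)
    (f' := fun y : ℝ => -((s - 1) * ((y : ℂ) ^ (-s) - (n : ℂ) ^ (-s))))
    (C := ‖s - 1‖ * (‖s‖ * (n : ℝ) ^ (-s.re - 1))) (x := (n : ℝ)) (y := n + 1) ?_ ?_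
    (by simp) (by simp)
  · refine le_trans (le_of_eq ?_) (key.trans (by simp))
    congr 1
    simp only [zetaCorr]
    push_cast
    ring
  · intro y hy
    have hy0 : 0 < y := hn0.trans_le hy.1
    have h3 := hasDerivAt_ofReal_cpow_const hy0.ne' (sub_ne_zero.mpr hs1.symm)
    have h4 :
        HasDerivAt (fun y : ℝ => (s - 1) * (n : ℂ) ^ (-s) * y) ((s - 1) * (n : ℂ) ^ (-s)) y := by
      simpa using (Complex.ofRealCLM.hasDerivAt (x := y)).const_mul ((s - 1) * (n : ℂ) ^ (-s))
    refine ((h3.fun_add h4).congr_deriv ?_).hasDerivWithinAt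
    rw [show 1 - s - 1 = -s by ring]
    ring
  · intro y hy
    rw [norm_neg, norm_mul]
    gcongr
    exact norm_cpow_sub_cpow_le hn hs hy

lemma summable_add_one_rpow {a : ℝ} (ha : 1 < a) (N : ℕ) :
    Summable fun n : ℕ => ((n + (N + 1) : ℕ) : ℝ) ^ (-a) :=
  (summable_nat_add_iff (f := fun n : ℕ => (n : ℝ) ^ (-a)) (N + 1)).mpr
    (Real.summable_nat_rpow.mpr (by linarith))

lemma summable_zetaCorr (N : ℕ) {s : ℂ} (hs : 0 < s.re) :
    Summable fun n : ℕ => zetaCorr (n + (N + 1)) s := by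
  refine Summable.of_norm_bounded (g := fun n : ℕ =>
    ‖s - 1‖ * (‖s‖ * ((n + (N + 1) : ℕ) : ℝ) ^ (-(s.re + 1)))) ?_ fun n => ?_
  · exact ((summable_add_one_rpow (by linarith) N).mul_left _).mul_left _
  · rw [neg_add']
    exact norm_zetaCorr_le (by omega) hs

lemma differentiable_zetaCorr {n : ℕ} (hn : 0 < n) : Differentiable ℂ (zetaCorr n) := by
  have h1 : (n : ℂ) ≠ 0 := by exact_mod_cast hn.ne'
  have h2 : ((n + 1 : ℕ) : ℂ) ≠ 0 := by exact_mod_cast n.succ_ne_zero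
  unfold zetaCorr
  intro s
  refine DifferentiableAt.add (DifferentiableAt.sub (DifferentiableAt.mul (by fun_prop) ?_) ?_) ?_
  · exact (differentiableAt_id.neg).const_cpow (Or.inl h1)
  · exact (differentiableAt_id.const_sub 1).const_cpow (Or.inl h1)
  · exact (differentiableAt_id.const_sub 1).const_cpow (Or.inl h2)

lemma differentiableOn_tsum_zetaCorr (N : ℕ) :
    DifferentiableOn ℂ (fun s => ∑' n : ℕ, zetaCorr (n + (N + 1)) s) {s | 0 < s.re} := by
  intro s hs
  have hs' : 0 < s.re := hs
  set U : Set ℂ := {w | s.re / 2 < w.re} ∩ Metric.ball 0 (‖s‖ + 1) with hU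
  have hUo : IsOpen U := (isOpen_lt continuous_const Complex.continuous_re).inter Metric.isOpen_ball
  have hsU : s ∈ U := ⟨by simp only [Set.mem_ofPred_eq]; linarith, by simp⟩
  have h := Complex.differentiableOn_tsum_of_summable_norm (U := U)
    (F := fun (n : ℕ) (w : ℂ) => zetaCorr (n + (N + 1)) w)
    (u := fun n : ℕ => (‖s‖ + 2) * ((‖s‖ + 1) * ((n + (N + 1) : ℕ) : ℝ) ^ (-(s.re / 2 + 1))))
    (((summable_add_one_rpow (by linarith) N).mul_left _).mul_left _)
    (fun n => (differentiable_zetaCorr (by omega)).differentiableOn) hUo ?_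
  · exact ((h s hsU).differentiableAt (hUo.mem_nhds hsU)).differentiableWithinAt
  · rintro n w ⟨hw1, hw2⟩
    have hw1' : s.re / 2 < w.re := hw1
    have hw2' : ‖w‖ < ‖s‖ + 1 := by simpa using hw2
    refine (norm_zetaCorr_le (by omega) (by linarith)).trans ?_
    have : ‖w - 1‖ ≤ ‖s‖ + 2 := (norm_sub_le _ _).trans (by simp; linarith)
    gcongr
    · exact_mod_cast (by omega : 1 ≤ n + (N + 1))
    · linarith

lemma sum_zetaCorr (N M : ℕ) (s : ℂ) :
    (s - 1) * ∑ n ∈ Finset.range N, ((n + 1 : ℕ) : ℂ) ^ (-s) + ((N + 1 : ℕ) : ℂ) ^ (1 - s)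
      + ∑ n ∈ Finset.range M, zetaCorr (n + (N + 1)) s
    = (s - 1) * ∑ n ∈ Finset.range (N + M), ((n + 1 : ℕ) : ℂ) ^ (-s)
      + ((N + M + 1 : ℕ) : ℂ) ^ (1 - s) := by
  induction M with
  | zero => simp
  | succ M ih =>
    rw [Finset.sum_range_succ, ← add_assoc, ih, ← add_assoc N M 1, Finset.sum_range_succ, zetaCorr,
      show M + (N + 1) = N + M + 1 by ring]
    ring

lemma zetaOne_eq_of_one_lt (N : ℕ) {s : ℂ} (hs : 1 < s.re) :
    zetaOne s = (s - 1) * ∑ n ∈ Finset.range N, ((n + 1 : ℕ) : ℂ) ^ (-s)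
      + ((N + 1 : ℕ) : ℂ) ^ (1 - s) + ∑' n : ℕ, zetaCorr (n + (N + 1)) s := by
  have hs1 : s ≠ 1 := by rintro rfl; simp at hs
  have hsum : HasSum (fun n : ℕ => ((n + 1 : ℕ) : ℂ) ^ (-s)) (riemannZeta s) := by
    rw [zeta_eq_tsum_one_div_nat_add_one_cpow hs]
    have : (fun n : ℕ => ((n + 1 : ℕ) : ℂ) ^ (-s)) = fun n : ℕ => 1 / ((n : ℂ) + 1) ^ s := by
      funext n
      rw [Complex.cpow_neg]
      push_cast
      simp
    rw [this]
    refine Summable.hasSum ?_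
    have h := (summable_nat_add_iff 1).mpr (Complex.summable_one_div_nat_cpow.mpr hs)
    simpa using h
  have h1 : Tendsto (fun M : ℕ => (s - 1) * ∑ n ∈ Finset.range N, ((n + 1 : ℕ) : ℂ) ^ (-s)
      + ((N + 1 : ℕ) : ℂ) ^ (1 - s) + ∑ n ∈ Finset.range M, zetaCorr (n + (N + 1)) s) atTop
      (nhds ((s - 1) * ∑ n ∈ Finset.range N, ((n + 1 : ℕ) : ℂ) ^ (-s)
      + ((N + 1 : ℕ) : ℂ) ^ (1 - s) + ∑' n : ℕ, zetaCorr (n + (N + 1)) s)) :=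
    (summable_zetaCorr N (by linarith)).hasSum.tendsto_sum_nat.const_add _
  have h2 : Tendsto (fun M : ℕ => (s - 1) * ∑ n ∈ Finset.range (N + M), ((n + 1 : ℕ) : ℂ) ^ (-s)
      + ((N + M + 1 : ℕ) : ℂ) ^ (1 - s)) atTop (nhds ((s - 1) * riemannZeta s + 0)) := by
    have hA : Tendsto (fun M : ℕ => N + M) atTop atTop :=
      tendsto_atTop_mono (fun M => Nat.le_add_left M N) tendsto_id
    refine ((hsum.tendsto_sum_nat.comp hA).const_mul (s - 1)).add ?_
    rw [tendsto_zero_iff_norm_tendsto_zero]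
    have : (fun M : ℕ => ‖((N + M + 1 : ℕ) : ℂ) ^ (1 - s)‖)
        = fun M : ℕ => ((N + M + 1 : ℕ) : ℝ) ^ (-(s.re - 1)) := by
      funext M
      rw [Complex.norm_natCast_cpow_of_pos (by omega)]
      congr 1
      simp
    rw [this]
    exact (tendsto_rpow_neg_atTop (by linarith)).comp (tendsto_natCast_atTop_atTop.comp
      ((tendsto_add_atTop_nat 1).comp hA))
  rw [zetaOne_of_ne hs1]
  simp only [sum_zetaCorr] at h1
  simpa using tendsto_nhds_unique h2 h1

lemma zetaOne_eq (N : ℕ) {s : ℂ} (hs : 0 < s.re) :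
    zetaOne s = (s - 1) * ∑ n ∈ Finset.range N, ((n + 1 : ℕ) : ℂ) ^ (-s)
      + ((N + 1 : ℕ) : ℂ) ^ (1 - s) + ∑' n : ℕ, zetaCorr (n + (N + 1)) s := by
  have hUo : IsOpen {s : ℂ | 0 < s.re} := isOpen_lt continuous_const Complex.continuous_re
  have hconv : Convex ℝ {s : ℂ | 0 < s.re} := convex_halfSpace_re_gt 0
  have hd : DifferentiableOn ℂ (fun s => (s - 1) * ∑ n ∈ Finset.range N, ((n + 1 : ℕ) : ℂ) ^ (-s)
      + ((N + 1 : ℕ) : ℂ) ^ (1 - s) + ∑' n : ℕ, zetaCorr (n + (N + 1)) s) {s : ℂ | 0 < s.re} := by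
    refine DifferentiableOn.add (Differentiable.differentiableOn ?_)
      (differentiableOn_tsum_zetaCorr N)
    intro s
    refine ((differentiableAt_id.sub_const 1).mul (DifferentiableAt.fun_sum fun n _ => ?_)).add ?_
    · exact (differentiableAt_id.neg).const_cpow (Or.inl (by exact_mod_cast n.succ_ne_zero))
    · exact (differentiableAt_id.const_sub 1).const_cpow
        (Or.inl (by exact_mod_cast N.succ_ne_zero))
  refine
    (differentiable_zetaOne.differentiableOn.analyticOnNhd hUo).eqOn_of_preconnected_of_eventuallyEq
    (hd.analyticOnNhd hUo) hconv.isPreconnected (z₀ := 2) (by simp) ?_ hs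
  have : {s : ℂ | 1 < s.re} ∈ nhds (2 : ℂ) :=
    (isOpen_lt continuous_const Complex.continuous_re).mem_nhds (by simp)
  filter_upwards [this] with w hw
  exact zetaOne_eq_of_one_lt N hw

lemma exists_norm_riemannZeta_le {κ : ℝ} (hκ : 0 < κ) (hκ' : κ ≤ 1 / 4) :
    ∃ C : ℝ, 0 < C ∧ ∀ s : ℂ, 1 - κ ≤ s.re → s.re ≤ 3 → 1 ≤ |s.im| →
      ‖riemannZeta s‖ ≤ C * |s.im| ^ (2 * κ) := by
  have hsm : Summable fun n : ℕ => ((n + 1 : ℕ) : ℝ) ^ (-(1 + κ)) := by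
    simpa using summable_add_one_rpow (a := 1 + κ) (by linarith) 0
  set Z := ∑' n : ℕ, ((n + 1 : ℕ) : ℝ) ^ (-(1 + κ)) with hZ
  have hZ0 : 0 ≤ Z := tsum_nonneg fun n => by positivity
  refine ⟨Z + 2 + 4 * Z, by positivity, fun s h1 h3 ht => ?_⟩
  set t := |s.im| with htdef
  have ht0 : 0 < t := by linarith
  have hs0 : 0 < s.re := by linarith
  have hs1 : s ≠ 1 := by rintro rfl; simp at htdef; linarith
  have hn1 : t ≤ ‖s - 1‖ := by simpa using Complex.abs_im_le_norm (s - 1)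
  have hn0 : 0 < ‖s - 1‖ := by linarith
  have hns : ‖s‖ ≤ 4 * t := by
    refine (Complex.norm_le_abs_re_add_abs_im s).trans ?_
    rw [abs_of_pos hs0]; linarith
  set N := ⌊t⌋₊ with hN
  have hNt : (N : ℝ) ≤ t := Nat.floor_le ht0.le
  have htN : t < N + 1 := Nat.lt_floor_add_one t
  have hpart : ‖∑ n ∈ Finset.range N, ((n + 1 : ℕ) : ℂ) ^ (-s)‖ ≤ Z * t ^ (2 * κ) := by
    refine (norm_sum_le _ _).trans ?_
    have : ∀ n ∈ Finset.range N, ‖((n + 1 : ℕ) : ℂ) ^ (-s)‖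
        ≤ ((n + 1 : ℕ) : ℝ) ^ (-(1 + κ)) * t ^ (2 * κ) := by
      intro n hn
      have hnt : ((n + 1 : ℕ) : ℝ) ≤ t := by
        refine le_trans ?_ hNt
        exact_mod_cast Finset.mem_range.mp hn
      have hn1 : (1 : ℝ) ≤ ((n + 1 : ℕ) : ℝ) := by exact_mod_cast Nat.succ_le_succ n.zero_le
      rw [Complex.norm_natCast_cpow_of_pos (by omega)]
      calc ((n + 1 : ℕ) : ℝ) ^ (-s).re ≤ ((n + 1 : ℕ) : ℝ) ^ (-(1 + κ) + 2 * κ) :=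
            Real.rpow_le_rpow_of_exponent_le hn1 (by simp; linarith)
        _ = ((n + 1 : ℕ) : ℝ) ^ (-(1 + κ)) * ((n + 1 : ℕ) : ℝ) ^ (2 * κ) :=
            Real.rpow_add (by linarith) _ _
        _ ≤ _ := by gcongr
    refine (Finset.sum_le_sum this).trans ?_
    rw [← Finset.sum_mul]
    gcongr
    exact hsm.sum_le_tsum _ fun n _ => by positivity
  have hmid : ‖((N + 1 : ℕ) : ℂ) ^ (1 - s)‖ ≤ ‖s - 1‖ * (2 * t ^ (2 * κ)) := by
    rw [Complex.norm_natCast_cpow_of_pos (by omega)]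
    have hN1 : (1 : ℝ) ≤ ((N + 1 : ℕ) : ℝ) := by push_cast; linarith
    calc ((N + 1 : ℕ) : ℝ) ^ (1 - s).re ≤ ((N + 1 : ℕ) : ℝ) ^ (1 : ℝ) :=
          Real.rpow_le_rpow_of_exponent_le hN1 (by simp; linarith)
      _ = N + 1 := by simp
      _ ≤ t * (2 * 1) := by linarith
      _ ≤ ‖s - 1‖ * (2 * t ^ (2 * κ)) := by
          gcongr
          exact Real.one_le_rpow ht (by linarith)
  have htail : ‖∑' n : ℕ, zetaCorr (n + (N + 1)) s‖ ≤ ‖s - 1‖ * (4 * Z * t ^ (2 * κ)) := by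
    have hsm' := summable_add_one_rpow (a := 1 + κ) (by linarith) N
    have hle : ∑' n : ℕ, ((n + (N + 1) : ℕ) : ℝ) ^ (-(1 + κ)) ≤ Z := by
      have := hsm.sum_add_tsum_nat_add N
      rw [← hZ] at this
      have h0 : 0 ≤ ∑ i ∈ Finset.range N, ((i + 1 : ℕ) : ℝ) ^ (-(1 + κ)) :=
        Finset.sum_nonneg fun n _ => by positivity
      have h2 : ∑' n : ℕ, ((n + (N + 1) : ℕ) : ℝ) ^ (-(1 + κ))
          = ∑' n : ℕ, ((n + N + 1 : ℕ) : ℝ) ^ (-(1 + κ)) := by simp only [add_assoc]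
      linarith
    have hb : ∀ n : ℕ, ‖zetaCorr (n + (N + 1)) s‖ ≤ ‖s - 1‖ * (4 * t ^ (2 * κ)) *
        ((n + (N + 1) : ℕ) : ℝ) ^ (-(1 + κ)) := by
      intro n
      have hn1 : (1 : ℝ) ≤ ((n + (N + 1) : ℕ) : ℝ) := by
        exact_mod_cast (by omega : 1 ≤ n + (N + 1))
      have hnt : t ≤ ((n + (N + 1) : ℕ) : ℝ) := by
        push_cast
        have : (0 : ℝ) ≤ n := n.cast_nonneg
        linarith
      refine (norm_zetaCorr_le (by omega) hs0).trans ?_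
      rw [mul_assoc]
      refine mul_le_mul_of_nonneg_left ?_ hn0.le
      calc ‖s‖ * ((n + (N + 1) : ℕ) : ℝ) ^ (-s.re - 1)
          ≤ (4 * t) * (((n + (N + 1) : ℕ) : ℝ) ^ (-(1 - 2 * κ) + -(1 + κ))) := by
            refine mul_le_mul hns (Real.rpow_le_rpow_of_exponent_le hn1 (by linarith))
              (by positivity) (by positivity)
        _ = (4 * t) * (((n + (N + 1) : ℕ) : ℝ) ^ (-(1 - 2 * κ)) *
            ((n + (N + 1) : ℕ) : ℝ) ^ (-(1 + κ))) := by rw [Real.rpow_add (by linarith)]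
        _ ≤ (4 * t) * (t ^ (-(1 - 2 * κ)) * ((n + (N + 1) : ℕ) : ℝ) ^ (-(1 + κ))) := by
            gcongr ?_ * (?_ * ?_)
            exact Real.rpow_le_rpow_of_nonpos ht0 hnt (by linarith)
        _ = 4 * (t ^ (1 : ℝ) * t ^ (-(1 - 2 * κ))) * ((n + (N + 1) : ℕ) : ℝ) ^ (-(1 + κ)) := by
            rw [Real.rpow_one]; ring
        _ = 4 * t ^ (2 * κ) * ((n + (N + 1) : ℕ) : ℝ) ^ (-(1 + κ)) := by
            rw [← Real.rpow_add ht0]; congr 3; ring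
    refine (tsum_of_norm_bounded (hsm'.mul_left _).hasSum hb).trans ?_
    rw [tsum_mul_left]
    calc _ ≤ ‖s - 1‖ * (4 * t ^ (2 * κ)) * Z := by gcongr
      _ = _ := by ring
  have hmain : ‖zetaOne s‖ ≤ ‖s - 1‖ * ((Z + 2 + 4 * Z) * t ^ (2 * κ)) := by
    rw [zetaOne_eq N hs0]
    refine (norm_add_le _ _).trans ((add_le_add_left (norm_add_le _ _) _).trans ?_)
    rw [norm_mul]
    have := mul_le_mul_of_nonneg_left hpart hn0.le
    linarith
  rw [zetaOne_of_ne hs1, norm_mul] at hmain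
  exact le_of_mul_le_mul_left hmain hn0

lemma exists_norm_zeta_and_deriv_le {κ : ℝ} (hκ : 0 < κ) (hκ' : κ ≤ 1 / 4) :
    ∃ A : ℝ, 1 ≤ A ∧ ∀ s : ℂ, 1 - κ / 2 ≤ s.re → s.re ≤ 5 / 2 → 2 ≤ |s.im| →
      ‖riemannZeta s‖ ≤ A * |s.im| ^ (2 * κ) ∧ ‖deriv riemannZeta s‖ ≤ A * |s.im| ^ (2 * κ) := by
  obtain ⟨C, hC, hb⟩ := exists_norm_riemannZeta_le hκ hκ'
  refine ⟨C + C * 2 / (κ / 2) + 1, by linarith [show 0 < C * 2 / (κ / 2) by positivity],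
    fun s h1 h2 ht => ?_⟩
  have h0 : 0 ≤ C * 2 / (κ / 2) := by positivity
  have hq : 0 ≤ |s.im| ^ (2 * κ) := by positivity
  constructor
  · refine (hb s (by linarith) (by linarith) (by linarith)).trans ?_
    gcongr
    linarith
  · have key := Complex.norm_deriv_le_of_forall_mem_sphere_norm_le (f := riemannZeta) (c := s)
      (R := κ / 2) (C := C * (2 * |s.im| ^ (2 * κ))) (by positivity) ?_ ?_
    · refine key.trans ?_
      calc C * (2 * |s.im| ^ (2 * κ)) / (κ / 2) = (C * 2 / (κ / 2)) * |s.im| ^ (2 * κ) := by ring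
        _ ≤ _ := by gcongr; linarith
    · refine DifferentiableOn.diffContOnCl fun w hw => ?_
      have hw' : ‖w - s‖ ≤ κ / 2 := by
        have := Metric.closure_ball_subset_closedBall hw
        simpa [dist_eq_norm] using this
      refine (differentiableAt_riemannZeta ?_).differentiableWithinAt
      rintro rfl
      have := (Complex.abs_im_le_norm (1 - s)).trans hw'
      simp at this
      linarith
    · intro w hw
      have hw' : ‖w - s‖ = κ / 2 := by simpa [dist_eq_norm] using hw
      have hre := (Complex.abs_re_le_norm (w - s)).trans hw'.le
      have him := (Complex.abs_im_le_norm (w - s)).trans hw'.le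
      rw [Complex.sub_re, abs_le] at hre
      rw [Complex.sub_im] at him
      have h3 := abs_sub_abs_le_abs_sub w.im s.im
      have h4 := abs_sub_abs_le_abs_sub s.im w.im
      rw [abs_sub_comm] at h4
      refine (hb w (by linarith) (by linarith) (by linarith)).trans ?_
      gcongr
      calc |w.im| ^ (2 * κ) ≤ (2 * |s.im|) ^ (2 * κ) := by gcongr; linarith
        _ = 2 ^ (2 * κ) * |s.im| ^ (2 * κ) := Real.mul_rpow (by norm_num) (by positivity)
        _ ≤ 2 ^ (1 : ℝ) * |s.im| ^ (2 * κ) := by gcongr <;> linarith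
        _ = _ := by simp

lemma one_le_norm_zeta_product {x : ℝ} (hx : 0 < x) (y : ℝ) :
    1 ≤ ‖riemannZeta (1 + x)‖ ^ 3 * ‖riemannZeta (1 + x + Complex.I * y)‖ ^ 4 *
      ‖riemannZeta (1 + x + 2 * Complex.I * y)‖ := by
  have h := DirichletCharacter.norm_LFunction_product_ge_one (N := 1) 1 hx y
  simpa only [DirichletCharacter.LFunctionTrivChar, DirichletCharacter.LFunction_modOne_eq,
    norm_mul, norm_pow] using h

lemma exists_norm_zeta_one_add_le :
    ∃ M : ℝ, 1 ≤ M ∧ ∀ x : ℝ, 0 < x → x ≤ 1 → ‖riemannZeta (1 + x)‖ ≤ M / x := by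
  have hc : ContinuousOn (fun x : ℝ => zetaOne (1 + x)) (Set.Icc 0 1) := by
    refine (differentiable_zetaOne.continuous.comp ?_).continuousOn
    fun_prop
  obtain ⟨M, hM⟩ := isCompact_Icc.exists_bound_of_continuousOn hc
  refine ⟨max M 1, le_max_right _ _, fun x hx hx1 => ?_⟩
  have h := hM x ⟨hx.le, hx1⟩
  have hne : (1 + x : ℂ) ≠ 1 := by simpa using hx.ne'
  simp only [zetaOne_of_ne hne, add_sub_cancel_left, norm_mul, Complex.norm_real,
    Real.norm_eq_abs, abs_of_pos hx] at h
  rw [le_div_iff₀ hx, mul_comm]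
  exact h.trans (le_max_left _ _)

/-- A lower bound for `ζ` to the right of the line `re s = 1`. -/
lemma exists_le_norm_riemannZeta {κ : ℝ} (hκ : 0 < κ) (hκ' : κ ≤ 1 / 4) :
    ∃ c : ℝ, 0 < c ∧ c ≤ 1 ∧ ∀ s : ℂ, 1 < s.re → s.re ≤ 2 → 2 ≤ |s.im| →
      c / (|s.im| ^ (2 * κ)) ^ 4 ≤ ‖riemannZeta s‖ := by
  obtain ⟨A, hA, hAb⟩ := exists_norm_zeta_and_deriv_le hκ hκ'
  obtain ⟨M, hM, hMb⟩ := exists_norm_zeta_one_add_le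
  set K : ℝ := 2 * A * M ^ 3 with hK
  have hM3 : 1 ≤ M ^ 3 := one_le_pow₀ hM
  have hK1 : 1 ≤ K := by nlinarith
  have hA0 : 0 < A := by linarith
  set b : ℝ := 1 / (2 * A * K) with hb
  have hb0 : 0 < b := by positivity
  have hb1 : b ≤ 1 := by
    rw [hb, div_le_one (by positivity)]
    nlinarith
  have hbA : A * b = 1 / (2 * K) := by rw [hb]; field_simp
  have main : ∀ (x t : ℝ), 0 < x → x ≤ 1 → 2 ≤ |t| → b ^ 4 / (|t| ^ (2 * κ)) ^ 5 ≤ x →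
      b ^ 3 / K / (|t| ^ (2 * κ)) ^ 4 ≤ ‖riemannZeta (1 + x + Complex.I * t)‖ := by
    intro x t hx hx1 ht hle
    set q := |t| ^ (2 * κ) with hq
    have hq1 : 1 ≤ q := Real.one_le_rpow (by linarith) (by linarith)
    have h1 := one_le_norm_zeta_product hx t
    have h2 := hMb x hx hx1
    have h3 := (hAb (1 + x + 2 * Complex.I * t) (by simp; linarith) (by simp; linarith)
      (by simp [abs_mul]; linarith)).1
    have h4 : ‖riemannZeta (1 + x + 2 * Complex.I * t)‖ ≤ 2 * A * q := by
      refine h3.trans ?_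
      have : |(1 + x + 2 * Complex.I * t : ℂ).im| = 2 * |t| := by simp [abs_mul]
      rw [this, Real.mul_rpow (by norm_num) (abs_nonneg _)]
      have h2k : (2 : ℝ) ^ (2 * κ) ≤ 2 ^ (1 : ℝ) := by gcongr <;> linarith
      rw [Real.rpow_one] at h2k
      rw [← hq]
      calc A * (2 ^ (2 * κ) * q) ≤ A * (2 * q) := by gcongr
        _ = _ := by ring
    set Z := ‖riemannZeta (1 + x + Complex.I * t)‖ with hZ
    have h5 : 1 ≤ (M / x) ^ 3 * Z ^ 4 * (2 * A * q) := by
      refine h1.trans ?_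
      gcongr
    have h6 : x ^ 3 ≤ K * q * Z ^ 4 := by
      have : (M / x) ^ 3 * Z ^ 4 * (2 * A * q) = K * q * Z ^ 4 / x ^ 3 := by
        rw [hK]; field_simp
      rw [this, le_div_iff₀ (by positivity)] at h5
      linarith
    have h7 : (b ^ 4 / q ^ 5) ^ 3 ≤ K * q * Z ^ 4 := le_trans (by gcongr) h6
    refine le_of_pow_le_pow_left₀ (n := 4) (by norm_num) (by positivity) ?_
    have h8 : (b ^ 3 / K / q ^ 4) ^ 4 = (b ^ 4 / q ^ 5) ^ 3 / (K ^ 4 * q) := by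
      field_simp
    rw [h8, div_le_iff₀ (by positivity)]
    refine h7.trans ?_
    have : K ≤ K ^ 4 := le_self_pow₀ hK1 (by norm_num)
    have hZ4 : 0 ≤ Z ^ 4 := by positivity
    calc K * q * Z ^ 4 = Z ^ 4 * (K * q) := by ring
      _ ≤ _ := by gcongr
  refine ⟨b ^ 3 / (2 * K), by positivity, ?_, fun s hs1 hs2 ht => ?_⟩
  · rw [div_le_one (by positivity)]
    have : b ^ 3 ≤ 1 := pow_le_one₀ hb0.le hb1
    linarith
  set q := |s.im| ^ (2 * κ) with hq
  have hq1 : 1 ≤ q := Real.one_le_rpow (by linarith) (by linarith)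
  set η := b ^ 4 / q ^ 5 with hη
  have hη0 : 0 < η := by positivity
  have hη1 : η ≤ 1 := by
    rw [hη, div_le_one (by positivity)]
    exact (pow_le_one₀ hb0.le hb1).trans (one_le_pow₀ hq1)
  have hs : s = 1 + ((s.re - 1 : ℝ) : ℂ) + Complex.I * s.im := by
    apply Complex.ext <;> simp
  rcases le_or_gt η (s.re - 1) with h | h
  · have := main (s.re - 1) s.im (by linarith) (by linarith) ht h
    rw [← hs] at this
    refine le_trans ?_ this
    gcongr
    linarith
  · have h1 := main η s.im hη0 hη1 ht le_rfl
    set w : ℂ := 1 + η + Complex.I * s.im with hw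
    have hseg : ∀ z ∈ segment ℝ s w, z.im = s.im ∧ 1 < z.re ∧ z.re ≤ 2 := by
      have hre : w.re = 1 + η := by simp [hw]
      have him : w.im = s.im := by simp [hw]
      rintro z ⟨a, b, ha, hb, hab, rfl⟩
      simp only [Complex.add_im, Complex.real_smul, Complex.re_ofReal_mul, Complex.im_ofReal_mul,
        Complex.add_re, hre, him]
      refine ⟨by rw [← add_mul, hab, one_mul], ?_, ?_⟩ <;> nlinarith
    have h2 : ‖riemannZeta w - riemannZeta s‖ ≤ A * q * ‖w - s‖ := by
      refine (convex_segment s w).norm_image_sub_le_of_norm_deriv_le (𝕜 := ℂ) (fun z hz => ?_)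
        (fun z hz => ?_) (left_mem_segment ℝ s w) (right_mem_segment ℝ s w)
      · obtain ⟨h1, h2, h3⟩ := hseg z hz
        refine differentiableAt_riemannZeta ?_
        rintro rfl
        simp at h2
      · obtain ⟨h1, h2, h3⟩ := hseg z hz
        have := (hAb z (by linarith) (by linarith) (by rwa [h1])).2
        rwa [h1] at this
    have h3 : ‖w - s‖ ≤ η := by
      have : w - s = ((η - (s.re - 1) : ℝ) : ℂ) := by
        rw [hw]; nth_rewrite 2 [hs]; push_cast; ring
      rw [this, Complex.norm_real, Real.norm_eq_abs, abs_of_pos (by linarith)]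
      linarith
    have h4 : A * q * ‖w - s‖ ≤ A * q * η := by gcongr
    have h5 : A * q * η = b ^ 3 / (2 * K) / q ^ 4 := by
      have : A * q * η = (A * b) * b ^ 3 / q ^ 4 := by rw [hη]; field_simp
      rw [this, hbA]; field_simp
    have h6 := norm_sub_norm_le (riemannZeta w) (riemannZeta s)
    have h7 : b ^ 3 / K / q ^ 4 = 2 * (b ^ 3 / (2 * K) / q ^ 4) := by field_simp
    linarith

/-- The Mellin transform of `ψ(x) - x`, up to the sign of the variable. -/
noncomputable def psiKernel (s : ℂ) : ℂ := -(deriv zetaOne s / zetaOne s + 1) / s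

lemma analyticAt_psiKernel {s : ℂ} (h : zetaOne s ≠ 0) (hs : s ≠ 0) : AnalyticAt ℂ psiKernel s := by
  have h1 : AnalyticAt ℂ zetaOne s := differentiable_zetaOne.analyticAt s
  exact (((h1.deriv.div h1 h).add analyticAt_const).neg).div analyticAt_id hs

lemma psiKernel_eq {s : ℂ} (h1 : s ≠ 1) (h0 : s ≠ 0) (hz : riemannZeta s ≠ 0) :
    psiKernel s = -(1 / (s - 1)) - deriv riemannZeta s / (riemannZeta s * s) := by
  have hd : deriv zetaOne s = riemannZeta s + (s - 1) * deriv riemannZeta s := by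
    have he : zetaOne =ᶠ[nhds s] fun s => (s - 1) * riemannZeta s := by
      filter_upwards [isOpen_ne.mem_nhds h1] with w hw using zetaOne_of_ne hw
    rw [he.deriv_eq]
    have := ((hasDerivAt_id s).sub_const 1).mul (differentiableAt_riemannZeta h1).hasDerivAt
    exact this.deriv.trans (by simp)
  have hs1 : s - 1 ≠ 0 := sub_ne_zero.mpr h1
  rw [psiKernel, hd, zetaOne_of_ne h1]
  field_simp
  ring

lemma exists_norm_iteratedDeriv_psiKernel_le :
    ∃ C : ℝ, 0 < C ∧ ∀ s : ℂ, 1 < s.re → s.re ≤ 2 → s.im ≠ 0 →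
      ‖iteratedDeriv 2 psiKernel s‖ ≤ C * |s.im| ^ (-(1 / 2) : ℝ) := by
  obtain ⟨A, hA, hAb⟩ := exists_norm_zeta_and_deriv_le (κ := 1 / 60) (by norm_num) (by norm_num)
  obtain ⟨c, hc, hc1, hcb⟩ := exists_le_norm_riemannZeta (κ := 1 / 60) (by norm_num) (by norm_num)
  have hcpt : IsCompact (Set.Icc (1 : ℝ) 2 ×ℂ Set.Icc (-3 : ℝ) 3) :=
    isCompact_Icc.reProdIm isCompact_Icc
  have hcont :
      ContinuousOn (iteratedDeriv 2 psiKernel) (Set.Icc (1 : ℝ) 2 ×ℂ Set.Icc (-3 : ℝ) 3) := by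
    intro s hs
    have h1 : 1 ≤ s.re := hs.1.1
    have ha := analyticAt_psiKernel (zetaOne_ne_zero h1) (by rintro rfl; norm_num at h1)
    rw [iteratedDeriv_succ, iteratedDeriv_one]
    exact ha.deriv.deriv.continuousAt.continuousWithinAt
  obtain ⟨M, hM⟩ := hcpt.exists_bound_of_continuousOn hcont
  have hA0 : 0 < A := by linarith
  set c1 : ℝ := min (c / (4 * A)) (1 / 120) with hc1def
  have hc10 : 0 < c1 := lt_min (by positivity) (by norm_num)
  have hc11 : c1 ≤ c / (4 * A) := min_le_left _ _
  have hc12 : c1 ≤ 1 / 120 := min_le_right _ _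
  refine ⟨max (2 * (2 + 8 * A / c) / c1 ^ 2) (M * 2), lt_max_of_lt_left (by positivity),
    fun s hs1 hs2 hs0 => ?_⟩
  have ht0 : 0 < |s.im| := abs_pos.mpr hs0
  rcases le_or_gt |s.im| 3 with ht | ht
  · have h1 := hM s ⟨⟨hs1.le, hs2⟩, abs_le.mp ht⟩
    have hM0 : 0 ≤ M := (norm_nonneg _).trans h1
    have h2 : (1 / 2 : ℝ) ≤ |s.im| ^ (-(1 / 2) : ℝ) := by
      calc (1 / 2 : ℝ) = (4 : ℝ) ^ (-(1 / 2) : ℝ) := by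
            rw [show (4 : ℝ) = 2 ^ (2 : ℝ) by norm_num, ← Real.rpow_mul (by norm_num)]
            norm_num [Real.rpow_neg_one]
        _ ≤ _ := Real.rpow_le_rpow_of_nonpos ht0 (by linarith) (by norm_num)
    calc ‖iteratedDeriv 2 psiKernel s‖ ≤ M * 2 * (1 / 2) := by linarith
      _ ≤ max (2 * (2 + 8 * A / c) / c1 ^ 2) (M * 2) * |s.im| ^ (-(1 / 2) : ℝ) := by
        gcongr
        exact le_max_right _ _
  · set t := |s.im| with htdef
    set q := t ^ (2 * (1 / 60) : ℝ) with hq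
    have hq1 : 1 ≤ q := Real.one_le_rpow (by linarith) (by norm_num)
    set r := c1 / q ^ 5 with hr
    have hr0 : 0 < r := by positivity
    have hr1 : r ≤ c1 := div_le_self hc10.le (one_le_pow₀ hq1)
    have hq2 : ∀ w : ℂ, ‖w - s‖ ≤ r → 1 - 1 / 60 / 2 ≤ w.re ∧ w.re ≤ 5 / 2 ∧ 2 ≤ |w.im| ∧
        t / 2 ≤ |w.im| ∧ |w.im| ^ (2 * (1 / 60) : ℝ) ≤ 2 * q := by
      intro w hw
      have hre := (Complex.abs_re_le_norm (w - s)).trans hw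
      have him := (Complex.abs_im_le_norm (w - s)).trans hw
      rw [Complex.sub_re, abs_le] at hre
      rw [Complex.sub_im] at him
      have h3 := abs_sub_abs_le_abs_sub w.im s.im
      have h4 := abs_sub_abs_le_abs_sub s.im w.im
      rw [abs_sub_comm] at h4
      refine ⟨by linarith, by linarith, by linarith, by linarith, ?_⟩
      calc |w.im| ^ (2 * (1 / 60) : ℝ) ≤ (2 * t) ^ (2 * (1 / 60) : ℝ) := by gcongr; linarith
        _ = 2 ^ (2 * (1 / 60) : ℝ) * q := Real.mul_rpow (by norm_num) (by positivity)
        _ ≤ 2 ^ (1 : ℝ) * q := by gcongr <;> norm_num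
        _ = _ := by simp
    have hz : ∀ w : ℂ, ‖w - s‖ ≤ r → c / 2 / q ^ 4 ≤ ‖riemannZeta w‖ := by
      intro w hw
      have hseg : ∀ z ∈ segment ℝ s w, ‖z - s‖ ≤ r := by
        intro z hz
        have := (convex_closedBall s r).segment_subset (Metric.mem_closedBall_self hr0.le)
          (by simpa [dist_eq_norm] using hw) hz
        simpa [dist_eq_norm] using this
      have h2 : ‖riemannZeta w - riemannZeta s‖ ≤ A * (2 * q) * ‖w - s‖ := by
        refine (convex_segment s w).norm_image_sub_le_of_norm_deriv_le (𝕜 := ℂ) (fun z hz => ?_)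
          (fun z hz => ?_) (left_mem_segment ℝ s w) (right_mem_segment ℝ s w)
        · obtain ⟨-, -, h3, -⟩ := hq2 z (hseg z hz)
          refine differentiableAt_riemannZeta ?_
          rintro rfl
          norm_num at h3
        · obtain ⟨h1, h2, h3, -, h5⟩ := hq2 z (hseg z hz)
          exact ((hAb z h1 h2 h3).2).trans (by gcongr)
      have h3 : A * (2 * q) * ‖w - s‖ ≤ c / 2 / q ^ 4 := by
        calc A * (2 * q) * ‖w - s‖ ≤ A * (2 * q) * r := by gcongr
          _ ≤ A * (2 * q) * (c / (4 * A) / q ^ 5) := by rw [hr]; gcongr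
          _ = _ := by field_simp; norm_num
      have h4 := hcb s hs1 hs2 (by linarith)
      have h5 := norm_sub_norm_le (riemannZeta s) (riemannZeta w)
      rw [norm_sub_rev] at h5
      have h6 : c / (t ^ (2 * (1 / 60) : ℝ)) ^ 4 = 2 * (c / 2 / q ^ 4) := by
        rw [← hq]; field_simp
      rw [h6] at h4
      linarith
    have hbound : ∀ w : ℂ, ‖w - s‖ ≤ r → ‖psiKernel w‖ ≤ (2 + 8 * A / c) * q ^ 5 / t := by
      intro w hw
      obtain ⟨h1, h2, h3, h4, h5⟩ := hq2 w hw
      have hw1 : w ≠ 1 := by rintro rfl; norm_num at h3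
      have hw0 : w ≠ 0 := by rintro rfl; norm_num at h3
      have hzw := hz w hw
      have hzp : 0 < c / 2 / q ^ 4 := by positivity
      rw [psiKernel_eq hw1 hw0 (norm_pos_iff.mp (hzp.trans_le hzw))]
      have ht2 : 0 < t / 2 := by linarith
      have e1 : ‖-(1 / (w - 1))‖ ≤ 2 / t := by
        rw [norm_neg, norm_div, norm_one]
        have : t / 2 ≤ ‖w - 1‖ := h4.trans (by simpa using Complex.abs_im_le_norm (w - 1))
        calc 1 / ‖w - 1‖ ≤ 1 / (t / 2) := by gcongr
          _ = _ := by field_simp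
      have e2 : ‖deriv riemannZeta w / (riemannZeta w * w)‖ ≤ 8 * A / c * q ^ 5 / t := by
        rw [norm_div, norm_mul]
        have hwn : t / 2 ≤ ‖w‖ := h4.trans (Complex.abs_im_le_norm w)
        have hd : ‖deriv riemannZeta w‖ ≤ A * (2 * q) :=
          ((hAb w h1 h2 h3).2).trans (by gcongr)
        calc _ ≤ A * (2 * q) / (c / 2 / q ^ 4 * (t / 2)) := by gcongr
          _ = _ := by field_simp; norm_num
      calc _ ≤ 2 / t + 8 * A / c * q ^ 5 / t := (norm_sub_le _ _).trans (add_le_add e1 e2)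
        _ ≤ 2 * q ^ 5 / t + 8 * A / c * q ^ 5 / t := by
          gcongr
          have : 1 ≤ q ^ 5 := one_le_pow₀ hq1
          linarith
        _ = _ := by ring
    have key := Complex.norm_iteratedDeriv_le_of_forall_mem_sphere_norm_le (f := psiKernel)
      (c := s) (R := r) (C := (2 + 8 * A / c) * q ^ 5 / t) 2 hr0 ?_ ?_
    · refine key.trans ?_
      have hq15 : q ^ 15 = t ^ (1 / 2 : ℝ) := by
        rw [hq, ← Real.rpow_natCast, ← Real.rpow_mul ht0.le]; norm_num
      have e : ((2 : ℕ).factorial : ℝ) * ((2 + 8 * A / c) * q ^ 5 / t) / r ^ 2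
          = 2 * (2 + 8 * A / c) / c1 ^ 2 * t ^ (-(1 / 2) : ℝ) := by
        have : t ^ (-(1 / 2) : ℝ) = q ^ 15 / t := by
          rw [hq15, eq_div_iff ht0.ne']
          nth_rewrite 2 [← Real.rpow_one t]
          rw [← Real.rpow_add ht0]; norm_num
        rw [this, hr]
        simp only [Nat.factorial_two, Nat.cast_ofNat]
        field_simp
      rw [e]
      gcongr
      exact le_max_left _ _
    · refine DifferentiableOn.diffContOnCl fun w hw => ?_
      have hw' : ‖w - s‖ ≤ r := by
        have := Metric.closure_ball_subset_closedBall hw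
        simpa [dist_eq_norm] using this
      obtain ⟨h1, h2, h3, h4, h5⟩ := hq2 w hw'
      have hw1 : w ≠ 1 := by rintro rfl; norm_num at h3
      have hw0 : w ≠ 0 := by rintro rfl; norm_num at h3
      have hzp : 0 < c / 2 / q ^ 4 := by positivity
      refine (analyticAt_psiKernel ?_ hw0).differentiableAt.differentiableWithinAt
      rw [zetaOne_of_ne hw1]
      exact mul_ne_zero (sub_ne_zero.mpr hw1) (norm_pos_iff.mp (hzp.trans_le (hz w hw')))
    · intro w hw
      exact hbound w (by simpa [dist_eq_norm] using (le_of_eq hw))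

/-- The error term `ψ(x) - x` cut off at `x = 1`. -/
noncomputable def psiErr (x : ℝ) : ℝ := (Set.Ioi 1).indicator (fun x => Chebyshev.psi x - x) x

lemma psiErr_of_lt {x : ℝ} (hx : 1 < x) : psiErr x = Chebyshev.psi x - x := by
  simp [psiErr, hx]

lemma psiErr_of_le {x : ℝ} (hx : x ≤ 1) : psiErr x = 0 := by
  simp [psiErr, hx]

lemma abs_psiErr_le {x : ℝ} (hx : 0 ≤ x) : |psiErr x| ≤ (Real.log 4 + 5) * x := by
  have h4 : 0 ≤ Real.log 4 := Real.log_nonneg (by norm_num)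
  rcases le_or_gt x 1 with h | h
  · rw [psiErr_of_le h, abs_zero]; positivity
  · rw [psiErr_of_lt h]
    have h1 := Chebyshev.psi_le_const_mul_self hx
    have h2 := Chebyshev.psi_nonneg x
    rw [abs_le]
    constructor <;> nlinarith

lemma measurable_psiErr : Measurable psiErr :=
  (Chebyshev.psi_mono.measurable.sub measurable_id).indicator measurableSet_Ioi

lemma locallyIntegrable_psiErr :
    MeasureTheory.LocallyIntegrable (fun x => (psiErr x : ℂ)) := by
  have h1 : MeasureTheory.LocallyIntegrable (fun x => Chebyshev.psi x - x) :=
    Chebyshev.psi_mono.locallyIntegrable.sub continuous_id.locallyIntegrable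
  have h2 : MeasureTheory.LocallyIntegrable psiErr := h1.indicator measurableSet_Ioi
  intro x
  obtain ⟨U, hU, h⟩ := h2 x
  exact ⟨U, hU, h.ofReal⟩

lemma isBigO_psiErr_atTop :
    (fun x => (psiErr x : ℂ)) =O[atTop] fun x : ℝ => x ^ (-(-1) : ℝ) := by
  refine IsBigO.of_bound (Real.log 4 + 5) ?_
  filter_upwards [eventually_ge_atTop 0] with x hx
  simpa [abs_of_nonneg hx] using abs_psiErr_le hx

lemma isBigO_log_mul {f : ℝ → ℂ} {a a' : ℝ} (h : f =O[atTop] fun x : ℝ => x ^ (-a)) (ha : a' < a) :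
    (fun x : ℝ => Real.log x • f x) =O[atTop] fun x : ℝ => x ^ (-a') := by
  have h1 := (isLittleO_log_rpow_atTop (sub_pos.mpr ha)).isBigO
  refine (h1.smul h).trans_eventuallyEq ?_
  filter_upwards [eventually_gt_atTop 0] with x hx
  rw [smul_eq_mul, ← Real.rpow_add hx]
  ring_nf

lemma isBigO_nhds_zero_of_eq_zero {f : ℝ → ℂ} (h : ∀ x, x ≤ 1 → f x = 0) (b : ℝ) :
    f =O[nhdsWithin 0 (Set.Ioi 0)] fun x : ℝ => x ^ b := by
  refine IsBigO.of_bound 1 ?_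
  have : ∀ᶠ x : ℝ in nhdsWithin 0 (Set.Ioi 0), x < 1 :=
    mem_nhdsWithin_of_mem_nhds (Iio_mem_nhds one_pos)
  filter_upwards [this] with x hx
  simp [h x hx.le]

lemma locallyIntegrableOn_log_smul {f : ℝ → ℂ}
    (h : MeasureTheory.LocallyIntegrableOn f (Set.Ioi 0)) :
    MeasureTheory.LocallyIntegrableOn (fun x => Real.log x • f x) (Set.Ioi 0) :=
  h.continuousOn_smul isOpen_Ioi.isLocallyClosed
    (Real.continuousOn_log.mono fun _ hx => ne_of_gt hx)

open MeasureTheory in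
lemma mellin_psiErr {s : ℂ} (hs : 1 < s.re) :
    mellin (fun x => (psiErr x : ℂ)) (-s) = psiKernel s := by
  have hs1 : s ≠ 1 := by rintro rfl; simp at hs
  have hs0 : s ≠ 0 := by rintro rfl; norm_num at hs
  have hz := riemannZeta_ne_zero_of_one_le_re hs.le
  have hconv : MellinConvergent (fun x => (psiErr x : ℂ)) (-s) :=
    mellinConvergent_of_isBigO_rpow (a := -1) (b := (-s).re - 1)
      (locallyIntegrable_psiErr.locallyIntegrableOn _) isBigO_psiErr_atTop (by simpa using hs)
      (isBigO_nhds_zero_of_eq_zero (fun x hx => by simp [psiErr_of_le hx]) _) (by simp)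
  have hL := LSeries_eq_mul_integral_of_nonneg (fun n => ArithmeticFunction.vonMangoldt n)
    (r := 1) zero_le_one hs (by
      refine IsBigO.of_bound (Real.log 4 + 4) (Eventually.of_forall fun n => ?_)
      have h1 := Chebyshev.psi_le_const_mul_self (x := n) (Nat.cast_nonneg n)
      have h2 : ∑ k ∈ Finset.Icc 1 n, ArithmeticFunction.vonMangoldt k = Chebyshev.psi n := by
        simp [Chebyshev.psi, ← Finset.Icc_add_one_left_eq_Ioc]
      rw [h2, Real.rpow_one, Real.norm_natCast, Real.norm_of_nonneg (Chebyshev.psi_nonneg _)]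
      exact h1) (fun n => ArithmeticFunction.vonMangoldt_nonneg)
  rw [ArithmeticFunction.LSeries_vonMangoldt_eq_deriv_riemannZeta_div hs] at hL
  have hpsi : ∀ t : ℝ, ∑ k ∈ Finset.Icc 1 ⌊t⌋₊, (ArithmeticFunction.vonMangoldt k : ℂ)
      = Chebyshev.psi t := by
    intro t
    simp [Chebyshev.psi, ← Finset.Icc_add_one_left_eq_Ioc]
  simp only [hpsi] at hL
  have hintg : IntegrableOn (fun t : ℝ => (t : ℂ) ^ (-s - 1) • (psiErr t : ℂ)) (Set.Ioi 1) :=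
    hconv.mono_set (Set.Ioi_subset_Ioi zero_le_one)
  have hintg2 : IntegrableOn (fun t : ℝ => (t : ℂ) ^ (-s)) (Set.Ioi 1) :=
    integrableOn_Ioi_cpow_of_lt (by simpa using hs) one_pos
  have e1 : mellin (fun x => (psiErr x : ℂ)) (-s)
      = ∫ t in Set.Ioi (1 : ℝ), (t : ℂ) ^ (-s - 1) • (psiErr t : ℂ) := by
    rw [mellin]
    refine (setIntegral_eq_of_subset_of_forall_sdiff_eq_zero measurableSet_Ioi
      (Set.Ioi_subset_Ioi zero_le_one) fun x hx => ?_)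
    simp [psiErr_of_le (not_lt.mp hx.2)]
  have e2 : ∫ t in Set.Ioi (1 : ℝ), (Chebyshev.psi t : ℂ) * (t : ℂ) ^ (-(s + 1))
      = (∫ t in Set.Ioi (1 : ℝ), (t : ℂ) ^ (-s - 1) • (psiErr t : ℂ)) +
        ∫ t in Set.Ioi (1 : ℝ), (t : ℂ) ^ (-s) := by
    rw [← integral_add hintg hintg2]
    refine setIntegral_congr_fun measurableSet_Ioi fun t ht => ?_
    have ht1 : (1 : ℝ) < t := ht
    have ht0 : (t : ℂ) ≠ 0 := by
      rw [Complex.ofReal_ne_zero]; linarith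
    simp only [psiErr_of_lt ht1, smul_eq_mul]
    rw [show (-s : ℂ) = (-s - 1) + 1 by ring, Complex.cpow_add _ _ ht0, Complex.cpow_one]
    push_cast
    ring_nf
  rw [integral_Ioi_cpow_of_lt (by simpa using hs) one_pos] at e2
  rw [e2] at hL
  rw [e1, psiKernel_eq hs1 hs0 hz]
  have hs2 : -s + 1 ≠ 0 := by
    intro h; apply hs1; linear_combination -h
  have hs3 : s - 1 ≠ 0 := sub_ne_zero.mpr hs1
  simp only [Complex.ofReal_one, Complex.one_cpow] at hL
  rw [show -s + 1 = -(s - 1) by ring] at hL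
  have key : deriv riemannZeta s / (riemannZeta s * s) =
      -((- deriv riemannZeta s / riemannZeta s) / s) := by field_simp
  rw [key, hL, mul_div_cancel_left₀ _ hs0]
  field_simp
  ring

/-- The second derivative of the transform, as a Mellin transform. -/
lemma iteratedDeriv_two_psiKernel {s : ℂ} (hs : 1 < s.re) :
    MellinConvergent (fun x => Real.log x • Real.log x • (psiErr x : ℂ)) (-s) ∧
    iteratedDeriv 2 psiKernel s =
      mellin (fun x => Real.log x • Real.log x • (psiErr x : ℂ)) (-s) := by
  have hloc : MeasureTheory.LocallyIntegrableOn (fun x => (psiErr x : ℂ)) (Set.Ioi 0) :=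
    locallyIntegrable_psiErr.locallyIntegrableOn _
  have h1 : ∀ w : ℂ, 1 < w.re → HasDerivAt (mellin fun x => (psiErr x : ℂ))
      (mellin (fun x => Real.log x • (psiErr x : ℂ)) (-w)) (-w) := fun w hw =>
    (mellin_hasDerivAt_of_isBigO_rpow (a := -1) (b := (-w).re - 1) hloc isBigO_psiErr_atTop
      (by simpa using hw)
      (isBigO_nhds_zero_of_eq_zero (fun x hx => by simp [psiErr_of_le hx]) _) (by simp)).2
  have h2 : ∀ w : ℂ, 1 < w.re →
      MellinConvergent (fun x => Real.log x • Real.log x • (psiErr x : ℂ)) (-w) ∧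
      HasDerivAt (mellin fun x => Real.log x • (psiErr x : ℂ))
      (mellin (fun x => Real.log x • Real.log x • (psiErr x : ℂ)) (-w)) (-w) := fun w hw =>
    mellin_hasDerivAt_of_isBigO_rpow (a := -((1 + w.re) / 2)) (b := (-w).re - 1)
      (locallyIntegrableOn_log_smul hloc) (isBigO_log_mul isBigO_psiErr_atTop (by linarith))
      (by simp; linarith)
      (isBigO_nhds_zero_of_eq_zero (fun x hx => by simp [psiErr_of_le hx]) _) (by simp)
  refine ⟨(h2 s hs).1, ?_⟩
  have hopen : IsOpen {w : ℂ | 1 < w.re} := isOpen_lt continuous_const Complex.continuous_re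
  have h3 : ∀ w : ℂ, 1 < w.re → HasDerivAt psiKernel
      (-mellin (fun x => Real.log x • (psiErr x : ℂ)) (-w)) w := by
    intro w hw
    have := (h1 w hw).scomp w (hasDerivAt_neg w)
    refine (this.congr_of_eventuallyEq ?_).congr_deriv (by simp)
    filter_upwards [hopen.mem_nhds hw] with v hv using (mellin_psiErr hv).symm
  rw [iteratedDeriv_succ, iteratedDeriv_one]
  have h4 : deriv psiKernel =ᶠ[nhds s]
      fun w => -mellin (fun x => Real.log x • (psiErr x : ℂ)) (-w) := by
    filter_upwards [hopen.mem_nhds hs] with v hv using (h3 v hv).deriv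
  rw [h4.deriv_eq]
  have := ((h2 s hs).2.scomp s (hasDerivAt_neg s)).neg
  exact this.deriv.trans (by simp)

open MeasureTheory in
lemma mellin_neg_eq_integral_exp (f : ℝ → ℂ) (s : ℂ) :
    (MellinConvergent f (-s) ↔
      Integrable fun v : ℝ => Complex.exp (-s * v) * f (Real.exp v)) ∧
    mellin f (-s) = ∫ v : ℝ, Complex.exp (-s * v) * f (Real.exp v) := by
  have himg : Real.exp '' Set.univ = Set.Ioi 0 := by rw [Set.image_univ, Real.range_exp]
  have hd : ∀ x ∈ Set.univ, HasDerivWithinAt Real.exp (Real.exp x) Set.univ x :=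
    fun x _ => (Real.hasDerivAt_exp x).hasDerivWithinAt
  have hc : ∀ x : ℝ, |Real.exp x| • ((Real.exp x : ℂ) ^ (-s - 1) • f (Real.exp x))
      = Complex.exp (-s * x) * f (Real.exp x) := by
    intro x
    rw [abs_of_pos (Real.exp_pos x), Complex.real_smul, smul_eq_mul, ← mul_assoc]
    congr 1
    have : ((Real.exp x : ℝ) : ℂ) ≠ 0 := Complex.ofReal_ne_zero.mpr (Real.exp_pos x).ne'
    rw [Complex.cpow_sub _ _ this, Complex.cpow_one, mul_div_cancel₀ _ this,
      Complex.cpow_def_of_ne_zero this, ← Complex.ofReal_log (Real.exp_pos x).le, Real.log_exp,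
      mul_comm]
  constructor
  · rw [MellinConvergent, ← himg, integrableOn_image_iff_integrableOn_abs_deriv_smul
      MeasurableSet.univ hd Real.exp_injective.injOn]
    simp_rw [hc]
    exact integrableOn_univ
  · rw [mellin, ← himg, integral_image_eq_integral_abs_deriv_smul
      MeasurableSet.univ hd Real.exp_injective.injOn]
    simp_rw [hc]
    simp

section FourierTransform

open scoped FourierTransform

lemma integrable_abs_rpow_neg_half_mul {θ : ℝ → ℂ} (hc : Continuous θ)
    (hi : MeasureTheory.Integrable θ) :
    MeasureTheory.Integrable fun w : ℝ => |w| ^ (-(1 / 2) : ℝ) * ‖θ w‖ := by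
  have hmeas : Measurable fun w : ℝ => |w| ^ (-(1 / 2) : ℝ) := by fun_prop
  have hpos : MeasureTheory.IntegrableOn (fun w : ℝ => |w| ^ (-(1 / 2) : ℝ)) (Set.Ioc 0 1) := by
    have h := intervalIntegral.intervalIntegrable_rpow' (a := 0) (b := 1)
      (r := (-(1 / 2) : ℝ)) (by norm_num)
    rw [intervalIntegrable_iff_integrableOn_Ioc_of_le zero_le_one] at h
    refine h.congr_fun (fun w hw => ?_) measurableSet_Ioc
    simp only [abs_of_pos hw.1]
  have hneg : MeasureTheory.IntegrableOn (fun w : ℝ => |w| ^ (-(1 / 2) : ℝ)) (Set.Ico (-1) 0) := by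
    have := hpos.comp_neg
    simpa [abs_neg] using this
  have hall : MeasureTheory.IntegrableOn (fun w : ℝ => |w| ^ (-(1 / 2) : ℝ)) (Set.Icc (-1) 1) := by
    rw [← Set.Ico_union_Icc_eq_Icc (b := 0) (by norm_num) (by norm_num)]
    exact hneg.union ((integrableOn_Icc_iff_integrableOn_Ioc).mpr hpos)
  have h1 : MeasureTheory.IntegrableOn (fun w : ℝ => |w| ^ (-(1 / 2) : ℝ) * ‖θ w‖)
      (Set.Icc (-1) 1) := hall.mul_continuousOn hc.norm.continuousOn isCompact_Icc
  have h2 : MeasureTheory.IntegrableOn (fun w : ℝ => |w| ^ (-(1 / 2) : ℝ) * ‖θ w‖)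
      (Set.Icc (-1) 1)ᶜ := by
    refine (hi.norm.integrableOn (s := (Set.Icc (-1) 1)ᶜ)).mono'
      (hmeas.aestronglyMeasurable.mul hc.norm.aestronglyMeasurable) ?_
    refine (MeasureTheory.ae_restrict_iff' measurableSet_Icc.compl).mpr
      (Eventually.of_forall fun w hw => ?_)
    have hw1 : 1 ≤ |w| := by
      by_contra! h
      exact hw ⟨(abs_lt.mp h).1.le, (abs_lt.mp h).2.le⟩
    rw [Real.norm_of_nonneg (by positivity)]
    exact mul_le_of_le_one_left (norm_nonneg _)
      (Real.rpow_le_one_of_one_le_of_nonpos hw1 (by norm_num))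
  have := h1.union h2
  rwa [Set.union_compl_self, MeasureTheory.integrableOn_univ] at this

/-- A nonnegative test function supported in `[0, 1]` and its inverse Fourier transform. -/
lemma exists_test_function : ∃ (φ : ℝ → ℝ) (θ : ℝ → ℂ), Continuous φ ∧ (∀ x, 0 ≤ φ x) ∧
    (∀ x, x ∉ Set.Icc (0 : ℝ) 1 → φ x = 0) ∧ 0 < ∫ x, φ x ∧ MeasureTheory.Integrable φ ∧
    Continuous θ ∧ MeasureTheory.Integrable θ ∧ 𝓕 θ = fun x => (φ x : ℂ) := by
  let b : ContDiffBump (1 / 2 : ℝ) := ⟨1 / 4, 1 / 2, by norm_num, by norm_num⟩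
  have hcd : ContDiff ℝ (⊤ : ℕ∞) fun x => ((b x : ℝ) : ℂ) :=
    Complex.ofRealCLM.contDiff.comp b.contDiff
  have hsupp : HasCompactSupport fun x => ((b x : ℝ) : ℂ) :=
    b.hasCompactSupport.comp_left Complex.ofReal_zero
  let Φ : SchwartzMap ℝ ℂ := hsupp.toSchwartzMap hcd
  refine ⟨b, (𝓕⁻ Φ : SchwartzMap ℝ ℂ), b.continuous, fun x => b.nonneg,
    fun x hx => ?_, b.integral_pos, b.integrable,
    (𝓕⁻ Φ : SchwartzMap ℝ ℂ).continuous, (𝓕⁻ Φ : SchwartzMap ℝ ℂ).integrable, ?_⟩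
  · refine b.zero_of_le_dist ?_
    simp only [Real.dist_eq]
    show 1 / 2 ≤ |x - 1 / 2|
    by_contra! h
    rw [abs_lt] at h
    exact hx ⟨by linarith, by linarith⟩
  · rw [← SchwartzMap.fourier_coe, FourierTransform.fourier_fourierInv_eq]
    rfl

open MeasureTheory in
lemma exists_abs_integral_psiErr_mul_le {φ : ℝ → ℝ} {θ : ℝ → ℂ} (hc : Continuous θ)
    (hi : Integrable θ) (hφ : 𝓕 θ = fun x => (φ x : ℂ)) :
    ∃ C : ℝ, 0 < C ∧ ∀ σ b η : ℝ, 1 < σ → σ ≤ 2 → 0 < η →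
      |∫ x, Real.exp (-σ * (b + η * x)) * ((b + η * x) ^ 2 * psiErr (Real.exp (b + η * x))) * φ x|
        ≤ C * η ^ (-(1 / 2) : ℝ) := by
  obtain ⟨C, hC, hb⟩ := exists_norm_iteratedDeriv_psiKernel_le
  have hθi := integrable_abs_rpow_neg_half_mul hc hi
  set J := ∫ w : ℝ, |w| ^ (-(1 / 2) : ℝ) * ‖θ w‖ with hJ
  have hJ0 : 0 ≤ J := integral_nonneg fun w => by positivity
  refine ⟨C * (2 * Real.pi) ^ (-(1 / 2) : ℝ) * J + 1, by positivity, fun σ b η hσ hσ2 hη => ?_⟩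
  set H : ℝ → ℂ := fun v => ((v ^ 2 * psiErr (Real.exp v) : ℝ) : ℂ) with hH
  have hHeq : ∀ v : ℝ, Real.log (Real.exp v) • Real.log (Real.exp v) • (psiErr (Real.exp v) : ℂ)
      = H v := fun v => by
    simp only [hH, Real.log_exp, Complex.real_smul]; push_cast; ring
  have hkey : ∀ s : ℂ, 1 < s.re → Integrable (fun v : ℝ => Complex.exp (-s * v) * H v) ∧
      iteratedDeriv 2 psiKernel s = ∫ v : ℝ, Complex.exp (-s * v) * H v := by
    intro s hs
    obtain ⟨h1, h2⟩ := iteratedDeriv_two_psiKernel hs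
    obtain ⟨h3, h4⟩ := mellin_neg_eq_integral_exp
      (fun x => Real.log x • Real.log x • (psiErr x : ℂ)) s
    simp only [hHeq] at h3 h4
    exact ⟨h3.mp h1, h2.trans h4⟩
  have hre : ∀ w : ℝ, ((σ : ℂ) + (2 * Real.pi * w / η : ℝ) * Complex.I).re = σ := by
    intro w; simp
  set G : ℝ → ℂ := fun x => Complex.exp (-(σ : ℂ) * ((b + η * x : ℝ) : ℂ)) * H (b + η * x) with hG
  have hGi : Integrable G := by
    have h1 := (hkey σ (by simpa using hσ)).1
    exact (h1.comp_add_left b).comp_mul_left' hη.ne'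
  have hFG : ∀ w : ℝ, w ≠ 0 → ‖𝓕 G w‖ ≤
      C * (2 * Real.pi) ^ (-(1 / 2) : ℝ) * η ^ (-(1 / 2) : ℝ) * |w| ^ (-(1 / 2) : ℝ) := by
    intro w hw
    set s : ℂ := (σ : ℂ) + (2 * Real.pi * w / η : ℝ) * Complex.I with hs
    have hsre : s.re = σ := hre w
    have hsim : s.im = 2 * Real.pi * w / η := by simp [hs]
    have h1 := (hkey s (by rwa [hsre])).2
    set k : ℝ → ℂ := fun v => Complex.exp (-s * v) * H v with hk
    have h2 : ∫ x : ℝ, k (b + η * x) = (η⁻¹ : ℝ) • ∫ v, k v := by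
      rw [Measure.integral_comp_mul_left (fun y => k (b + y)) η, integral_add_left_eq_self,
        abs_of_pos (inv_pos.mpr hη)]
    have h3 : 𝓕 G w = Complex.exp (2 * Real.pi * w * b / η * Complex.I) *
        ∫ x : ℝ, k (b + η * x) := by
      rw [Real.fourier_eq', ← integral_const_mul]
      refine integral_congr_ae (Eventually.of_forall fun x => ?_)
      simp only [hG, hk, smul_eq_mul, ← mul_assoc, ← Complex.exp_add]
      congr 2
      rw [hs]
      have : (η : ℂ) ≠ 0 := Complex.ofReal_ne_zero.mpr hη.ne'
      simp
      field_simp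
      ring
    rw [h3, norm_mul, h2, ← h1, norm_smul]
    have h4 : ‖Complex.exp (2 * Real.pi * w * b / η * Complex.I)‖ = 1 := by
      have := Complex.norm_exp_ofReal_mul_I (2 * Real.pi * w * b / η)
      push_cast at this
      exact this
    have h5 := hb s (by rwa [hsre]) (by rwa [hsre]) (by
      rw [hsim]; have := Real.pi_pos; positivity)
    rw [h4, one_mul, Real.norm_of_nonneg (inv_pos.mpr hη).le]
    have h6 : |s.im| ^ (-(1 / 2) : ℝ) = (2 * Real.pi) ^ (-(1 / 2) : ℝ) * |w| ^ (-(1 / 2) : ℝ) *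
        (η ^ (-(1 / 2) : ℝ))⁻¹ := by
      rw [hsim, abs_div, abs_mul, abs_of_pos Real.two_pi_pos, abs_of_pos hη,
        Real.div_rpow (by positivity) hη.le, Real.mul_rpow (by positivity) (abs_nonneg w),
        div_eq_mul_inv]
    have h7 : η⁻¹ * (η ^ (-(1 / 2) : ℝ))⁻¹ = η ^ (-(1 / 2) : ℝ) := by
      rw [← Real.rpow_neg hη.le, ← Real.rpow_neg_one η, ← Real.rpow_add hη]
      norm_num
    calc η⁻¹ * ‖iteratedDeriv 2 psiKernel s‖ ≤ η⁻¹ * (C * |s.im| ^ (-(1 / 2) : ℝ)) := by gcongr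
      _ = C * (2 * Real.pi) ^ (-(1 / 2) : ℝ) * (η⁻¹ * (η ^ (-(1 / 2) : ℝ))⁻¹) *
          |w| ^ (-(1 / 2) : ℝ) := by rw [h6]; ring
      _ = _ := by rw [h7]
  have hflip : ∫ w, 𝓕 G w * θ w = ∫ x, G x * (φ x : ℂ) := by
    have := VectorFourier.integral_fourierIntegral_smul_eq_flip (L := innerₗ ℝ)
      Real.continuous_fourierChar continuous_inner hGi hi
    simp only [smul_eq_mul, flip_innerₗ] at this
    rw [show (fun x : ℝ => G x * (φ x : ℂ)) = fun x => G x * 𝓕 θ x by rw [hφ]]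
    exact this
  have hreal : ∫ x, G x * (φ x : ℂ) = ((∫ x, Real.exp (-σ * (b + η * x)) *
      ((b + η * x) ^ 2 * psiErr (Real.exp (b + η * x))) * φ x : ℝ) : ℂ) := by
    rw [← integral_complex_ofReal]
    refine integral_congr_ae (Eventually.of_forall fun x => ?_)
    simp only [hG, hH]
    push_cast
    ring
  rw [← Real.norm_eq_abs, ← Complex.norm_real, ← hreal, ← hflip]
  calc ‖∫ w, 𝓕 G w * θ w‖ ≤ ∫ w, C * (2 * Real.pi) ^ (-(1 / 2) : ℝ) * η ^ (-(1 / 2) : ℝ) *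
        (|w| ^ (-(1 / 2) : ℝ) * ‖θ w‖) := by
        refine norm_integral_le_of_norm_le (hθi.const_mul _) ?_
        filter_upwards [compl_mem_ae_iff.mpr (measure_singleton (0 : ℝ))] with w hw
        rw [norm_mul, ← mul_assoc]
        exact mul_le_mul_of_nonneg_right (hFG w hw) (norm_nonneg _)
    _ = C * (2 * Real.pi) ^ (-(1 / 2) : ℝ) * J * η ^ (-(1 / 2) : ℝ) := by
        rw [integral_const_mul]; ring
    _ ≤ _ := by
        have : 0 < η ^ (-(1 / 2) : ℝ) := by positivity
        nlinarith

end FourierTransform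

open MeasureTheory in
/-- The prime number theorem with an error term saving a power of the logarithm. -/
theorem psi_sub_id_isBigO :
    (fun x : ℝ => Chebyshev.psi x - x) =O[atTop] fun x => x / Real.log x ^ (4 / 3 : ℝ) := by
  obtain ⟨φ, θ, -, hφ0, hφs, hφp, hφi, hθc, hθi, hF⟩ := exists_test_function
  obtain ⟨C, hC, hb⟩ := exists_abs_integral_psiErr_mul_le hθc hθi hF
  set I := ∫ x, φ x with hI
  set c : ℝ := Real.exp (-2) / 4 * I with hc
  have hc0 : 0 < c := by positivity
  have h40 : 0 ≤ Real.log 4 := Real.log_nonneg (by norm_num)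
  have hcore : ∀ (ε v b m : ℝ), (ε = 1 ∨ ε = -1) → 3 ≤ v → v - 1 ≤ b → b ≤ v → 0 < m →
      (∀ x ∈ Set.Icc (0 : ℝ) 1, m ≤ ε * (Chebyshev.psi (Real.exp (b + v ^ (-(4 / 3) : ℝ) * x)) *
        Real.exp (-(b + v ^ (-(4 / 3) : ℝ) * x)) - 1)) → m ≤ C / c * v ^ (-(4 / 3) : ℝ) := by
    intro ε v b m hε hv hb1 hb2 hm hE
    have hv0 : 0 < v := by linarith
    set η := v ^ (-(4 / 3) : ℝ) with hη
    have hη0 : 0 < η := by positivity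
    have hη1 : η ≤ 1 := Real.rpow_le_one_of_one_le_of_nonpos (by linarith) (by norm_num)
    have hσ1 : 1 / v ≤ 1 := by rw [div_le_one hv0]; linarith
    have hσ0 : 0 < 1 / v := by positivity
    have h1 := hb (1 + 1 / v) b η (by linarith) (by linarith) hη0
    set W : ℝ → ℝ := fun x => Real.exp (-(1 + 1 / v) * (b + η * x)) *
      ((b + η * x) ^ 2 * psiErr (Real.exp (b + η * x))) with hW
    have hrange : ∀ x ∈ Set.Icc (0 : ℝ) 1, v / 2 ≤ b + η * x ∧ b + η * x ≤ v + 1 := by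
      intro x hx
      have : 0 ≤ η * x := mul_nonneg hη0.le hx.1
      have : η * x ≤ 1 := mul_le_one₀ hη1 hx.1 hx.2
      constructor <;> linarith
    have hWi : Integrable fun x => W x * φ x := by
      refine (hφi.const_mul ((v + 1) ^ 2 * (Real.log 4 + 5))).mono' ?_
        (Eventually.of_forall fun x => ?_)
      · refine AEStronglyMeasurable.mul (Measurable.aestronglyMeasurable ?_)
          hφi.aestronglyMeasurable
        have := measurable_psiErr
        fun_prop
      · by_cases hx : x ∈ Set.Icc (0 : ℝ) 1
        · obtain ⟨h2, h3⟩ := hrange x hx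
          rw [norm_mul, Real.norm_of_nonneg (hφ0 x)]
          refine mul_le_mul_of_nonneg_right ?_ (hφ0 x)
          have h4 := abs_psiErr_le (Real.exp_pos (b + η * x)).le
          simp only [hW, norm_mul, Real.norm_eq_abs, Real.abs_exp, abs_pow]
          rw [abs_of_nonneg (by linarith : 0 ≤ b + η * x)]
          calc Real.exp (-(1 + 1 / v) * (b + η * x)) *
                ((b + η * x) ^ 2 * |psiErr (Real.exp (b + η * x))|)
              ≤ Real.exp (-(b + η * x)) *
                ((v + 1) ^ 2 * ((Real.log 4 + 5) * Real.exp (b + η * x))) := by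
                gcongr
                · have : 0 ≤ 1 / v * (b + η * x) := mul_nonneg hσ0.le (by linarith)
                  linarith
                · linarith
            _ = _ := by rw [Real.exp_neg]; field_simp
        · simp [hφs x hx]
    have hlow : ∀ x, Real.exp (-2) / 4 * (v ^ 2 * m) * φ x ≤ ε * (W x * φ x) := by
      intro x
      by_cases hx : x ∈ Set.Icc (0 : ℝ) 1
      · obtain ⟨h2, h3⟩ := hrange x hx
        rw [← mul_assoc ε]
        refine mul_le_mul_of_nonneg_right ?_ (hφ0 x)
        have h4 := hE x hx
        have h5 : 1 < Real.exp (b + η * x) := Real.one_lt_exp_iff.mpr (by linarith)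
        have h6 : W x = Real.exp (-(1 / v * (b + η * x))) * (b + η * x) ^ 2 *
            (Chebyshev.psi (Real.exp (b + η * x)) * Real.exp (-(b + η * x)) - 1) := by
          simp only [hW]
          rw [psiErr_of_lt h5, show -(1 + 1 / v) * (b + η * x)
            = -(1 / v * (b + η * x)) + -(b + η * x) by ring, Real.exp_add, Real.exp_neg (b + η * x)]
          field_simp
        have h7 : 1 / v * (b + η * x) ≤ 2 := by
          rw [one_div, inv_mul_le_iff₀ hv0]; linarith
        calc Real.exp (-2) / 4 * (v ^ 2 * m) = Real.exp (-2) * (v / 2) ^ 2 * m := by ring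
          _ ≤ Real.exp (-(1 / v * (b + η * x))) * (b + η * x) ^ 2 *
            (ε * (Chebyshev.psi (Real.exp (b + η * x)) * Real.exp (-(b + η * x)) - 1)) := by
              gcongr
          _ = ε * W x := by rw [h6]; ring
      · simp [hφs x hx]
    have h2 : Real.exp (-2) / 4 * (v ^ 2 * m) * I ≤ ε * ∫ x, W x * φ x := by
      rw [hI, ← integral_const_mul, ← integral_const_mul]
      exact integral_mono (hφi.const_mul _) (hWi.const_mul _) hlow
    have h3 : ε * ∫ x, W x * φ x ≤ C * η ^ (-(1 / 2) : ℝ) := by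
      refine le_trans ?_ h1
      rcases hε with rfl | rfl
      · rw [one_mul]; exact le_abs_self _
      · rw [neg_one_mul]; exact neg_le_abs _
    have h4 : η ^ (-(1 / 2) : ℝ) = v ^ 2 * η := by
      rw [hη, ← Real.rpow_mul hv0.le, ← Real.rpow_natCast, ← Real.rpow_add hv0]
      norm_num
    rw [h4] at h3
    have h5 : v ^ 2 * (c * m) ≤ v ^ 2 * (C * η) := by
      calc v ^ 2 * (c * m) = Real.exp (-2) / 4 * (v ^ 2 * m) * I := by rw [hc]; ring
        _ ≤ _ := h2.trans (h3.trans (by linarith))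
    have h6 : c * m ≤ C * η := le_of_mul_le_mul_left h5 (by positivity)
    rw [div_mul_eq_mul_div, le_div_iff₀ hc0]
    linarith
  set K : ℝ := Real.log 4 + 4 with hK
  have hpsi : ∀ v : ℝ, Chebyshev.psi (Real.exp v) * Real.exp (-v) ≤ K := by
    intro v
    have := Chebyshev.psi_le_const_mul_self (Real.exp_pos v).le
    rw [Real.exp_neg, ← div_eq_mul_inv, div_le_iff₀ (Real.exp_pos v)]
    exact this
  have hmain : ∀ v : ℝ, 3 ≤ v → |Chebyshev.psi (Real.exp v) * Real.exp (-v) - 1| ≤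
      (2 * K + C / c) * v ^ (-(4 / 3) : ℝ) := by
    intro v hv
    have hv0 : 0 < v := by linarith
    have hcore' := fun ε b m => hcore ε v b m
    set η := v ^ (-(4 / 3) : ℝ) with hη
    have hη0 : 0 < η := by positivity
    have hη1 : η ≤ 1 := Real.rpow_le_one_of_one_le_of_nonpos (by linarith) (by norm_num)
    set P := Chebyshev.psi (Real.exp v) * Real.exp (-v) with hP
    have hP0 : 0 ≤ P := mul_nonneg (Chebyshev.psi_nonneg _) (Real.exp_pos _).le
    have hPK : P ≤ K := hpsi v
    have hCc : 0 ≤ C / c * η := by positivity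
    have hPη : P * η ≤ K * η := by gcongr
    have hKη : 0 ≤ K * η := by positivity
    rw [abs_le]
    constructor
    · by_contra! hcon
      have hm : 0 < 1 - P - 2 * K * η := by linarith
      have := hcore' (-1) (v - η) (1 - P - 2 * K * η) (Or.inr rfl) hv (by linarith) (by linarith)
        hm (fun x hx => by
          have hx1 : 0 ≤ η * (1 - x) := mul_nonneg hη0.le (by linarith [hx.2])
          have hx2 : η * (1 - x) ≤ η := mul_le_of_le_one_right hη0.le (by linarith [hx.1])
          have e1 : Chebyshev.psi (Real.exp (v - η + η * x)) ≤ Chebyshev.psi (Real.exp v) := by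
            refine Chebyshev.psi_mono (Real.exp_le_exp.mpr ?_)
            linarith
          have e2 : Real.exp (-(v - η + η * x)) = Real.exp (-v) * Real.exp (η * (1 - x)) := by
            rw [← Real.exp_add]; ring_nf
          have e3 : Real.exp (η * (1 - x)) ≤ 1 + 2 * η := by
            have := Real.abs_exp_sub_one_le (x := η * (1 - x)) (by rw [abs_of_nonneg hx1]; linarith)
            rw [abs_of_nonneg hx1] at this
            linarith [le_abs_self (Real.exp (η * (1 - x)) - 1)]
          have e4 : Chebyshev.psi (Real.exp (v - η + η * x)) * Real.exp (-(v - η + η * x)) ≤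
              P * (1 + 2 * η) := by
            rw [e2, ← mul_assoc, hP]
            gcongr
          linarith)
      linarith
    · by_contra! hcon
      have hm : 0 < P - 1 - K * η := by linarith
      have := hcore' 1 v (P - 1 - K * η) (Or.inl rfl) hv (by linarith) le_rfl
        hm (fun x hx => by
          have hx1 : 0 ≤ η * x := mul_nonneg hη0.le hx.1
          have hx2 : η * x ≤ η := mul_le_of_le_one_right hη0.le hx.2
          have e1 : Chebyshev.psi (Real.exp v) ≤ Chebyshev.psi (Real.exp (v + η * x)) := by
            refine Chebyshev.psi_mono (Real.exp_le_exp.mpr ?_)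
            linarith
          have e2 : Real.exp (-(v + η * x)) = Real.exp (-v) * Real.exp (-(η * x)) := by
            rw [← Real.exp_add]; ring_nf
          have e3 : 1 - η ≤ Real.exp (-(η * x)) := by
            have := Real.add_one_le_exp (-(η * x))
            linarith
          have e4 : P * (1 - η) ≤
              Chebyshev.psi (Real.exp (v + η * x)) * Real.exp (-(v + η * x)) := by
            rw [e2, ← mul_assoc, hP]
            have := Chebyshev.psi_nonneg (Real.exp (v + η * x))
            gcongr
          linarith)
      linarith
  refine IsBigO.of_bound (2 * K + C / c) ?_
  filter_upwards [eventually_ge_atTop (Real.exp 3)] with x hx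
  have hx0 : 0 < x := (Real.exp_pos 3).trans_le hx
  have hl : 3 ≤ Real.log x := by rwa [Real.le_log_iff_exp_le hx0]
  have h := hmain _ hl
  rw [Real.exp_log hx0, Real.exp_neg, Real.exp_log hx0] at h
  have hl0 : 0 < Real.log x := by linarith
  rw [Real.norm_eq_abs, Real.norm_of_nonneg (by positivity)]
  have e1 : Chebyshev.psi x - x = x * (Chebyshev.psi x * x⁻¹ - 1) := by field_simp
  rw [e1, abs_mul, abs_of_pos hx0, div_eq_mul_inv x, ← Real.rpow_neg hl0.le]
  calc x * |Chebyshev.psi x * x⁻¹ - 1| ≤ x * ((2 * K + C / c) * Real.log x ^ (-(4 / 3) : ℝ)) := by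
        gcongr
    _ = _ := by ring

/-- The summatory function of `a` over the positive integers up to `x`. -/
noncomputable def partialSum (a : ℕ → ℝ) (x : ℝ) : ℝ := ∑ n ∈ Finset.Ioc 0 ⌊x⌋₊, a n

theorem mem_Ioc_floor {n : ℕ} {x : ℝ} (hn : n ∈ Finset.Ioc 0 ⌊x⌋₊) :
    (1 : ℝ) ≤ n ∧ (n : ℝ) ≤ x := by
  rw [Finset.mem_Ioc] at hn
  exact ⟨by exact_mod_cast hn.1, (Nat.le_floor_iff' (by lia)).mp hn.2⟩

theorem mem_Ioc_floor_iff {n : ℕ} {x : ℝ} :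
    n ∈ Finset.Ioc 0 ⌊x⌋₊ ↔ (1 : ℝ) ≤ n ∧ (n : ℝ) ≤ x := by
  refine ⟨mem_Ioc_floor, fun h => ?_⟩
  have : 0 < n := by
    have := h.1
    rcases Nat.eq_zero_or_pos n with rfl | hn
    · norm_num at this
    · exact hn
  exact Finset.mem_Ioc.mpr ⟨this, (Nat.le_floor_iff' this.ne').mpr h.2⟩

theorem partialSum_mono {a : ℕ → ℝ} (ha : ∀ n, 0 ≤ a n) : Monotone (partialSum a) := by
  intro x y hxy
  refine Finset.sum_le_sum_of_subset_of_nonneg ?_ fun n _ _ => ha n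
  exact Finset.Ioc_subset_Ioc_right (Nat.floor_le_floor hxy)

theorem partialSum_nonneg {a : ℕ → ℝ} (ha : ∀ n, 0 ≤ a n) (x : ℝ) : 0 ≤ partialSum a x :=
  Finset.sum_nonneg fun n _ => ha n

theorem partialSum_of_lt_one {a : ℕ → ℝ} {x : ℝ} (hx : x < 1) : partialSum a x = 0 := by
  simp [partialSum, Nat.floor_eq_zero.mpr hx]

theorem measurable_partialSum (a : ℕ → ℝ) : Measurable (partialSum a) := by
  have : Measurable fun n : ℕ => ∑ k ∈ Finset.Ioc 0 n, a k := measurable_from_nat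
  exact this.comp Nat.measurable_floor

theorem sum_sum_divisorsAntidiagonal (a b : ℕ → ℝ) {x : ℝ} :
    ∑ n ∈ Finset.Ioc 0 ⌊x⌋₊, ∑ p ∈ n.divisorsAntidiagonal, a p.1 * b p.2 =
      ∑ m ∈ Finset.Ioc 0 ⌊x⌋₊, a m * partialSum b (x / m) := by
  let F : (ℕ → ℝ) → ArithmeticFunction ℝ := fun a => ⟨fun n => if n = 0 then 0 else a n, by simp⟩
  have hF : ∀ a : ℕ → ℝ, ∀ n, n ≠ 0 → F a n = a n := fun a n hn => by simp [F, hn]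
  have h := ArithmeticFunction.sum_Ioc_mul_eq_sum_sum (F a) (F b) ⌊x⌋₊
  refine Eq.trans (Finset.sum_congr rfl fun n _ => ?_)
    (h.trans (Finset.sum_congr rfl fun m hm => ?_))
  · rw [ArithmeticFunction.mul_apply]
    refine Finset.sum_congr rfl fun p hp => ?_
    have := Nat.ne_zero_of_mem_divisorsAntidiagonal hp
    rw [hF _ _ this.1, hF _ _ this.2]
  · rw [Finset.mem_Ioc] at hm
    rw [hF _ _ (by lia), partialSum, Nat.floor_div_natCast]
    congr 1
    refine Finset.sum_congr rfl fun k hk => hF _ _ ?_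
    rw [Finset.mem_Ioc] at hk
    lia

theorem sum_mul_log_eq {F : ℕ → ℝ} (hF : ∀ m n, F (m * n) = F m * F n) (x : ℝ) :
    partialSum (fun n => F n * Real.log n) x =
      ∑ m ∈ Finset.Ioc 0 ⌊x⌋₊,
        F m * partialSum (fun n => F n * ArithmeticFunction.vonMangoldt n) (x / m) := by
  rw [← sum_sum_divisorsAntidiagonal]
  refine Finset.sum_congr rfl fun n _ => ?_
  beta_reduce
  rw [← ArithmeticFunction.vonMangoldt_sum, Finset.mul_sum,
    ← Nat.sum_divisorsAntidiagonal' fun i j => F n * ArithmeticFunction.vonMangoldt j]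
  refine Finset.sum_congr rfl fun p hp => ?_
  rw [← (Nat.mem_divisorsAntidiagonal.mp hp).1, hF]
  ring

theorem partialSum_div_eq {c : ℕ → ℝ} (hc : c 0 = 0) (y : ℝ) :
    partialSum (fun n => c n / n) y =
      partialSum c y / y + ∫ t in Set.Ioc 1 y, partialSum c t / t ^ 2 := by
  have key : ∀ (d : ℕ → ℝ) (x : ℝ), d 0 = 0 →
      partialSum d x = ∑ k ∈ Finset.Icc 0 ⌊x⌋₊, d k := by
    intro d x hd
    rw [Finset.Icc_eq_cons_Ioc (Nat.zero_le _), Finset.sum_cons, hd, zero_add]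
    rfl
  have hder : ∀ t ∈ Set.Icc 1 y, HasDerivAt (fun t : ℝ => t⁻¹) (-(t ^ 2)⁻¹) t := fun t ht =>
    hasDerivAt_inv (by linarith [ht.1])
  have h := sum_mul_eq_sub_integral_mul₀ (f := fun t : ℝ => t⁻¹) c hc y
    (fun t ht => (hder t ht).differentiableAt) (by
      refine ContinuousOn.integrableOn_Icc ?_
      refine ContinuousOn.congr (f := fun t : ℝ => -(t ^ 2)⁻¹) ?_ fun t ht => (hder t ht).deriv
      refine (ContinuousOn.inv₀ (by fun_prop) fun t ht => ?_).neg
      have : (1 : ℝ) ≤ t := ht.1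
      positivity)
  rw [key _ _ (by simp), key c y hc]
  refine Eq.trans (Finset.sum_congr rfl fun k _ => ?_) (h.trans ?_)
  · rw [div_eq_inv_mul]
  · rw [sub_eq_add_neg, ← MeasureTheory.integral_neg, div_eq_inv_mul]
    congr 1
    refine MeasureTheory.setIntegral_congr_fun measurableSet_Ioc fun t ht => ?_
    have := (hder t ⟨ht.1.le, ht.2⟩).deriv
    simp only [this, key c t hc]
    ring

theorem integrableOn_inv_mul_log_rpow {ρ : ℝ} (hρ : 0 < ρ) :
    MeasureTheory.IntegrableOn (fun t : ℝ => t⁻¹ * (1 + Real.log t) ^ (-(1 + ρ)))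
      (Set.Ioi 1) := by
  have hd : ∀ t ∈ Set.Ici (1 : ℝ), HasDerivAt (fun t => -ρ⁻¹ * (1 + Real.log t) ^ (-ρ))
      (t⁻¹ * (1 + Real.log t) ^ (-(1 + ρ))) t := by
    intro t ht
    have ht' : (1 : ℝ) ≤ t := ht
    have hl := Real.log_nonneg ht'
    have := (((Real.hasDerivAt_log (by linarith : t ≠ 0)).const_add 1).rpow_const (p := -ρ)
      (Or.inl (by positivity))).const_mul (-ρ⁻¹)
    refine this.congr_deriv ?_
    rw [show -(1 + ρ) = -ρ - 1 by ring]
    field_simp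
  refine MeasureTheory.integrableOn_Ioi_deriv_of_nonneg (l := 0) ?_
    (fun t ht => hd t (Set.Ioi_subset_Ici_self ht)) ?_ ?_
  · exact (hd 1 Set.self_mem_Ici).continuousAt.continuousWithinAt
  · intro t ht
    have ht' : (1 : ℝ) < t := ht
    have hl := Real.log_nonneg ht'.le
    positivity
  · have := (tendsto_rpow_neg_atTop hρ).comp
      (tendsto_atTop_add_const_left _ 1 Real.tendsto_log_atTop)
    simpa using this.const_mul (-ρ⁻¹)

theorem tendsto_one_add_log_rpow_neg {ρ : ℝ} (hρ : 0 < ρ) :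
    Tendsto (fun t : ℝ => (1 + Real.log t) ^ (-ρ)) atTop (nhds 0) :=
  (tendsto_rpow_neg_atTop hρ).comp (tendsto_atTop_add_const_left _ 1 Real.tendsto_log_atTop)

theorem exists_partialSum_div_asymptotic {c : ℕ → ℝ} (hc : c 0 = 0) {z K ρ : ℝ} (hρ : 0 < ρ)
    (h : ∀ y, 1 ≤ y → |partialSum c y - z * y| ≤ K * (y * (1 + Real.log y) ^ (-(1 + ρ)))) :
    ∃ B E : ℝ, (∀ y, 1 ≤ y → |partialSum (fun n => c n / n) y - z * Real.log y - B| ≤ E) ∧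
      Tendsto (fun y => partialSum (fun n => c n / n) y - z * Real.log y - B) atTop (nhds 0) := by
  set r : ℝ → ℝ := fun t => partialSum c t / t ^ 2 - z * t⁻¹ with hr
  have hmeas : Measurable r := by
    have := measurable_partialSum c
    fun_prop
  have hintg : MeasureTheory.IntegrableOn r (Set.Ioi 1) := by
    refine MeasureTheory.Integrable.mono' ((integrableOn_inv_mul_log_rpow hρ).const_mul K)
      hmeas.aestronglyMeasurable ?_
    filter_upwards [MeasureTheory.ae_restrict_mem measurableSet_Ioi] with t ht
    have ht' : (1 : ℝ) < t := ht
    have h0 : 0 < t := by linarith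
    have e : r t = (partialSum c t - z * t) / t ^ 2 := by rw [hr]; field_simp
    rw [Real.norm_eq_abs, e, abs_div, abs_of_pos (by positivity : 0 < t ^ 2), div_le_iff₀
      (by positivity)]
    refine (h t ht'.le).trans (le_of_eq ?_)
    field_simp
  have heq : ∀ y, 1 ≤ y → partialSum (fun n => c n / n) y - z * Real.log y -
      (z + ∫ t in Set.Ioi 1, r t) =
        (partialSum c y / y - z) + ((∫ t in (1 : ℝ)..y, r t) - ∫ t in Set.Ioi 1, r t) := by
    intro y hy
    have h0 : (0 : ℝ) ∉ Set.uIcc 1 y := by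
      rw [Set.uIcc_of_le hy]; intro h; linarith [h.1]
    have i1 : IntervalIntegrable r MeasureTheory.volume 1 y :=
      (intervalIntegrable_iff_integrableOn_Ioc_of_le hy).mpr
        (hintg.mono_set Set.Ioc_subset_Ioi_self)
    have i2 : IntervalIntegrable (fun t : ℝ => z * t⁻¹) MeasureTheory.volume 1 y :=
      (intervalIntegrable_inv_iff.mpr (Or.inr h0)).const_mul z
    have e : ∫ t in Set.Ioc 1 y, partialSum c t / t ^ 2 =
        (∫ t in (1 : ℝ)..y, r t) + z * Real.log y := by
      rw [← intervalIntegral.integral_of_le hy]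
      have := intervalIntegral.integral_add i1 i2
      rw [intervalIntegral.integral_const_mul, integral_inv h0, div_one] at this
      rw [← this]
      congr 1
      funext t
      simp [hr]
    rw [partialSum_div_eq hc y, e]
    ring
  have hfirst : ∀ y, 1 ≤ y → |partialSum c y / y - z| ≤ K * (1 + Real.log y) ^ (-(1 + ρ)) := by
    intro y hy
    have h0 : 0 < y := by linarith
    have e : partialSum c y / y - z = (partialSum c y - z * y) / y := by field_simp
    rw [e, abs_div, abs_of_pos h0, div_le_iff₀ h0]
    refine (h y hy).trans (le_of_eq (by ring))
  have hK : 0 ≤ K := by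
    have := (abs_nonneg _).trans (h 1 le_rfl)
    simpa using this
  refine ⟨z + ∫ t in Set.Ioi 1, r t, K + (∫ t in Set.Ioi 1, |r t|) + |∫ t in Set.Ioi 1, r t|,
    fun y hy => ?_, ?_⟩
  · rw [heq y hy]
    have h1 : |partialSum c y / y - z| ≤ K := by
      refine (hfirst y hy).trans (mul_le_of_le_one_right hK ?_)
      have := Real.log_nonneg hy
      exact Real.rpow_le_one_of_one_le_of_nonpos (by linarith) (by linarith)
    have h2 : |∫ t in (1 : ℝ)..y, r t| ≤ ∫ t in Set.Ioi 1, |r t| := by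
      rw [intervalIntegral.integral_of_le hy]
      refine (MeasureTheory.abs_integral_le_integral_abs).trans ?_
      exact MeasureTheory.setIntegral_mono_set hintg.abs
        (Eventually.of_forall fun t => abs_nonneg _)
        (Set.Ioc_subset_Ioi_self.eventuallyLE)
    calc _ ≤ |partialSum c y / y - z| + (|∫ t in (1 : ℝ)..y, r t| + |∫ t in Set.Ioi 1, r t|) :=
          (abs_add_le _ _).trans (by gcongr; exact abs_sub _ _)
      _ ≤ _ := by linarith
  · have t1 : Tendsto (fun y => partialSum c y / y - z) atTop (nhds 0) := by
      have t0 := (tendsto_one_add_log_rpow_neg (by linarith : 0 < 1 + ρ)).const_mul K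
      rw [mul_zero] at t0
      refine squeeze_zero_norm' ?_ t0
      filter_upwards [eventually_ge_atTop 1] with y hy using hfirst y hy
    have t2 := MeasureTheory.intervalIntegral_tendsto_integral_Ioi 1 hintg tendsto_id
    have t3 := t1.add (t2.sub_const (∫ t in Set.Ioi 1, r t))
    rw [sub_self, add_zero] at t3
    refine t3.congr' ?_
    filter_upwards [eventually_ge_atTop 1] with y hy using (heq y hy).symm

/-- A completely multiplicative weight with values in `[0, 1]` whose values at primes have mean
density `z`, with a power-of-logarithm saving. -/
structure IsRegularWeight (g : ℕ → ℝ) (z ρ K : ℝ) : Prop where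
  map_one : g 1 = 1
  map_mul : ∀ m n, g (m * n) = g m * g n
  nonneg : ∀ n, 0 ≤ g n
  le_one : ∀ n, g n ≤ 1
  density_pos : 0 < z
  density_lt_one : z < 1
  rho_pos : 0 < ρ
  bound : ∀ y, 1 ≤ y →
    |partialSum (fun n => g n * ArithmeticFunction.vonMangoldt n) y - z * y| ≤
      K * (y * (1 + Real.log y) ^ (-(1 + ρ)))

/-- The logarithmic mean `∑_{n ≤ exp u} a(n) (u - log n)`. -/
noncomputable def logMean (a : ℕ → ℝ) (u : ℝ) : ℝ :=
  partialSum (fun n => a n * (u - Real.log n)) (Real.exp u)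

theorem logMean_eq (a : ℕ → ℝ) (u : ℝ) :
    logMean a u = u * partialSum a (Real.exp u) -
      partialSum (fun n => a n * Real.log n) (Real.exp u) := by
  rw [logMean, partialSum, partialSum, partialSum, Finset.mul_sum, ← Finset.sum_sub_distrib]
  refine Finset.sum_congr rfl fun n _ => by ring

theorem continuousOn_logMean (a : ℕ → ℝ) (s t : ℝ) :
    ContinuousOn (logMean a) (Set.Icc s t) := by
  have : ContinuousOn
      (fun u => ∑ n ∈ Finset.Ioc 0 ⌊Real.exp t⌋₊, a n * max (u - Real.log n) 0) (Set.Icc s t) := by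
    fun_prop
  refine this.congr fun u hu => ?_
  rw [logMean, partialSum]
  have hsub : Finset.Ioc 0 ⌊Real.exp u⌋₊ ⊆ Finset.Ioc 0 ⌊Real.exp t⌋₊ :=
    Finset.Ioc_subset_Ioc_right (Nat.floor_le_floor (Real.exp_le_exp.mpr hu.2))
  beta_reduce
  rw [← Finset.sum_subset hsub]
  · refine Finset.sum_congr rfl fun n hn => ?_
    have := mem_Ioc_floor hn
    rw [max_eq_left]
    have := (Real.log_le_iff_le_exp (by linarith)).mpr this.2
    linarith
  · intro n hn hn'
    have h1 := mem_Ioc_floor hn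
    rw [mem_Ioc_floor_iff, not_and, not_le] at hn'
    have := (Real.lt_log_iff_exp_lt (by linarith)).mpr (hn' h1.1)
    rw [max_eq_right (by linarith), mul_zero]

theorem hasDerivWithinAt_logMean (a : ℕ → ℝ) (u : ℝ) :
    HasDerivWithinAt (logMean a) (partialSum a (Real.exp u)) (Set.Ici u) u := by
  have h : HasDerivWithinAt
      (fun v => ∑ n ∈ Finset.Ioc 0 ⌊Real.exp u⌋₊, a n * (v - Real.log n))
      (∑ n ∈ Finset.Ioc 0 ⌊Real.exp u⌋₊, a n * 1) (Set.Ici u) u := by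
    refine (HasDerivAt.fun_sum fun n _ => ?_).hasDerivWithinAt
    exact ((hasDerivAt_id u).sub_const _).const_mul _
  simp only [mul_one] at h
  refine h.congr_of_eventuallyEq ?_ rfl
  have hlt : u < Real.log (⌊Real.exp u⌋₊ + 1) := by
    rw [Real.lt_log_iff_exp_lt (by positivity)]
    exact Nat.lt_floor_add_one _
  filter_upwards [inter_mem_nhdsWithin (Set.Ici u) (Iio_mem_nhds hlt)] with v hv
  have hv1 : u ≤ v := hv.1
  have hv2 : v < Real.log (⌊Real.exp u⌋₊ + 1) := hv.2
  have : ⌊Real.exp v⌋₊ = ⌊Real.exp u⌋₊ := by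
    refine le_antisymm ?_ (Nat.floor_le_floor (Real.exp_le_exp.mpr hv1))
    rw [Real.lt_log_iff_exp_lt (by positivity)] at hv2
    refine Nat.lt_succ_iff.mp ((Nat.floor_lt (Real.exp_pos v).le).mpr ?_)
    exact_mod_cast hv2
  rw [logMean, partialSum, this]

theorem logMean_pos {a : ℕ → ℝ} (ha : ∀ n, 0 ≤ a n) (h1 : 0 < a 1) {u : ℝ} (hu : 0 < u) :
    0 < logMean a u := by
  rw [logMean, partialSum]
  have hmem : 1 ∈ Finset.Ioc 0 ⌊Real.exp u⌋₊ :=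
    mem_Ioc_floor_iff.mpr (by simpa using hu.le)
  refine lt_of_lt_of_le ?_ (Finset.single_le_sum (f := fun n : ℕ => a n * (u - Real.log n))
    (fun n hn => ?_) hmem)
  · simp only [Nat.cast_one, Real.log_one, sub_zero]
    positivity
  · have := mem_Ioc_floor hn
    have := (Real.log_le_iff_le_exp (by linarith)).mpr this.2
    exact mul_nonneg (ha n) (by linarith)

theorem hasDerivWithinAt_logMean_mul_rpow (a : ℕ → ℝ) (z : ℝ) {c u : ℝ} (hu : c < u) :
    HasDerivWithinAt (fun v => logMean a v * (v - c) ^ (-(1 + z)))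
      ((u - c) ^ (-(2 + z)) *
        ((u - c) * partialSum a (Real.exp u) - (1 + z) * logMean a u)) (Set.Ici u) u := by
  have h0 : 0 < u - c := by linarith
  have h1 := (((hasDerivAt_id u).sub_const c).rpow_const (p := -(1 + z))
    (Or.inl h0.ne')).hasDerivWithinAt (s := Set.Ici u)
  refine ((hasDerivWithinAt_logMean a u).mul h1).congr_deriv ?_
  simp only [id]
  rw [show -(1 + z) = -(2 + z) + 1 by ring, Real.rpow_add_one h0.ne', add_sub_cancel_right]
  ring

theorem continuousOn_logMean_mul_rpow (a : ℕ → ℝ) (z : ℝ) {c s t : ℝ} (hs : c < s) :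
    ContinuousOn (fun v => logMean a v * (v - c) ^ (-(1 + z))) (Set.Icc s t) := by
  refine (continuousOn_logMean a s t).mul (ContinuousOn.rpow_const (by fun_prop) fun v hv => ?_)
  left
  have := hv.1
  intro h
  linarith

namespace IsRegularWeight

variable {g : ℕ → ℝ} {z ρ K : ℝ}

theorem exists_logMean_identity (h : IsRegularWeight g z ρ K) :
    ∃ (B E : ℝ) (ε : ℝ → ℝ), 0 < E ∧ (∀ y, 1 ≤ y → |ε y| ≤ E) ∧ Tendsto ε atTop (nhds 0) ∧
      ∀ u, 0 ≤ u → (u - B) * partialSum (fun n => g n / n) (Real.exp u) =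
        (1 + z) * logMean (fun n => g n / n) u +
          partialSum (fun n => g n / n * ε (Real.exp u / n)) (Real.exp u) := by
  obtain ⟨B, E, hE, ht⟩ := exists_partialSum_div_asymptotic
    (c := fun n => g n * ArithmeticFunction.vonMangoldt n) (by simp) h.rho_pos h.bound
  refine ⟨B, E + 1, _, ?_, fun y hy => (hE y hy).trans (by linarith), ht, fun u _ => ?_⟩
  · have := (abs_nonneg _).trans (hE 1 le_rfl)
    linarith
  · have hmul : ∀ m n : ℕ, g (m * n) / ((m * n : ℕ) : ℝ) = g m / m * (g n / n) := by
      intro m n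
      rw [h.map_mul, Nat.cast_mul, mul_div_mul_comm]
    have e1 := sum_mul_log_eq (F := fun n => g n / n) hmul (Real.exp u)
    have e2 := logMean_eq (fun n => g n / n) u
    have e3 : (∑ m ∈ Finset.Ioc 0 ⌊Real.exp u⌋₊, g m / m * partialSum
        (fun n => g n / n * ArithmeticFunction.vonMangoldt n) (Real.exp u / m)) =
        z * logMean (fun n => g n / n) u + B * partialSum (fun n => g n / n) (Real.exp u) +
        partialSum (fun n => g n / n * (partialSum (fun n => g n * ArithmeticFunction.vonMangoldt n
          / n) (Real.exp u / n) - z * Real.log (Real.exp u / n) - B)) (Real.exp u) := by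
      simp only [logMean]
      rw [partialSum, partialSum, partialSum, Finset.mul_sum, Finset.mul_sum,
        ← Finset.sum_add_distrib, ← Finset.sum_add_distrib]
      refine Finset.sum_congr rfl fun m hm => ?_
      have := mem_Ioc_floor hm
      rw [Real.log_div (Real.exp_pos u).ne' (by linarith), Real.log_exp]
      have e : (fun n : ℕ => g n / n * ArithmeticFunction.vonMangoldt n) =
          fun n : ℕ => g n * ArithmeticFunction.vonMangoldt n / n := by
        funext n; ring
      rw [e]
      ring
    rw [e1, e3] at e2
    linarith

theorem logWeight_nonneg (h : IsRegularWeight g z ρ K) (n : ℕ) : 0 ≤ g n / n :=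
  div_nonneg (h.nonneg n) n.cast_nonneg

theorem abs_partialSum_mul_le {a : ℕ → ℝ} (ha : ∀ n, 0 ≤ a n) {ε : ℝ → ℝ} {E : ℝ}
    (hε : ∀ y, 1 ≤ y → |ε y| ≤ E) (x : ℝ) :
    |partialSum (fun n => a n * ε (x / n)) x| ≤ E * partialSum a x := by
  rw [partialSum, partialSum, Finset.mul_sum]
  refine (Finset.abs_sum_le_sum_abs _ _).trans (Finset.sum_le_sum fun n hn => ?_)
  have := mem_Ioc_floor hn
  rw [abs_mul, abs_of_nonneg (ha n), mul_comm]
  have hx := hε (x / n) ((one_le_div (by linarith)).mpr this.2)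
  exact mul_le_mul_of_nonneg_right hx (ha n)

theorem exists_partialSum_div_le (h : IsRegularWeight g z ρ K) :
    ∃ C, 0 < C ∧ ∀ x, 1 ≤ x → partialSum (fun n => g n / n) x ≤ C * (1 + Real.log x) ^ z := by
  obtain ⟨B, E, ε, hE0, hE, -, hid⟩ := h.exists_logMean_identity
  set a : ℕ → ℝ := fun n => g n / n with ha
  have ha0 : ∀ n, 0 ≤ a n := h.logWeight_nonneg
  have hz := h.density_pos
  set b := B + E with hb
  set u₁ := max b 0 + 1 with hu₁
  have hub : b < u₁ := by have := le_max_left b 0; linarith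
  have hu0 : 0 < u₁ := by have := le_max_right b 0; linarith
  have hineq : ∀ u, 0 ≤ u → (u - b) * partialSum a (Real.exp u) ≤ (1 + z) * logMean a u := by
    intro u hu
    have h1 := hid u hu
    have h2 := abs_le.mp (abs_partialSum_mul_le ha0 hE (Real.exp u))
    have h3 := h2.2
    rw [hb]
    nlinarith
  set M := logMean a u₁ * (u₁ - b) ^ (-(1 + z)) with hM
  have hM0 : 0 < M := by
    have := logMean_pos ha0 (by simp [ha, h.map_one]) hu0
    have : 0 < u₁ - b := by linarith
    positivity
  have hbound : ∀ u, u₁ ≤ u → logMean a u * (u - b) ^ (-(1 + z)) ≤ M := by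
    intro u hu
    refine image_le_of_deriv_right_le_deriv_boundary (a := u₁) (b := u) (B := fun _ => M)
      (B' := fun _ => 0) (continuousOn_logMean_mul_rpow a z hub)
      (fun v hv => hasDerivWithinAt_logMean_mul_rpow a z (hub.trans_le hv.1)) le_rfl
      continuousOn_const (fun v _ => hasDerivWithinAt_const _ _ _) ?_ ⟨hu, le_rfl⟩
    intro v hv
    have hv1 := hv.1
    have : 0 < v - b := by linarith
    refine mul_nonpos_of_nonneg_of_nonpos (by positivity) ?_
    linarith [hineq v (by linarith)]
  set C₁ := (1 + z) * M * (1 + |b|) ^ z with hC₁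
  set C₂ := partialSum a (Real.exp u₁) with hC₂
  have hC₁0 : 0 < C₁ := by positivity
  have hC₂0 : 0 ≤ C₂ := partialSum_nonneg ha0 _
  refine ⟨C₁ + C₂, by linarith, fun x hx => ?_⟩
  have hl := Real.log_nonneg hx
  have hx0 : 0 < x := by linarith
  rcases le_total (Real.log x) u₁ with hc | hc
  · have h1 : partialSum a x ≤ C₂ :=
      partialSum_mono ha0 ((Real.log_le_iff_le_exp hx0).mp hc)
    have h2 : (1 : ℝ) ≤ (1 + Real.log x) ^ z := Real.one_le_rpow (by linarith) hz.le
    nlinarith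
  · have hp : 0 < Real.log x - b := by linarith
    have h1 := hbound _ hc
    have h2 := hineq _ hl
    rw [Real.exp_log hx0] at h2
    rw [Real.rpow_neg hp.le, ← div_eq_mul_inv, div_le_iff₀ (by positivity)] at h1
    have h3 : (Real.log x - b) ^ (1 + z) = (Real.log x - b) * (Real.log x - b) ^ z := by
      rw [Real.rpow_add hp, Real.rpow_one]
    have h4 : partialSum a x ≤ (1 + z) * M * (Real.log x - b) ^ z := by
      refine le_of_mul_le_mul_left ?_ hp
      refine h2.trans ?_
      rw [h3] at h1
      calc (1 + z) * logMean a (Real.log x)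
          ≤ (1 + z) * (M * ((Real.log x - b) * (Real.log x - b) ^ z)) := by gcongr
        _ = _ := by ring
    have h5 : (Real.log x - b) ^ z ≤ (1 + |b|) ^ z * (1 + Real.log x) ^ z := by
      rw [← Real.mul_rpow (by positivity) (by positivity)]
      refine Real.rpow_le_rpow hp.le ?_ hz.le
      have := neg_le_abs b
      have := abs_nonneg b
      nlinarith
    have h6 : 0 ≤ (1 + Real.log x) ^ z := by positivity
    calc partialSum a x ≤ (1 + z) * M * ((1 + |b|) ^ z * (1 + Real.log x) ^ z) :=
          h4.trans (by gcongr)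
      _ = C₁ * (1 + Real.log x) ^ z := by rw [hC₁]; ring
      _ ≤ _ := by gcongr; linarith

theorem exists_partialSum_le (h : IsRegularWeight g z ρ K) :
    ∃ C, 0 < C ∧ ∀ x, 1 ≤ x → partialSum g x ≤ C * (x * (1 + Real.log x) ^ (z - 1)) := by
  obtain ⟨C, hC0, hC⟩ := h.exists_partialSum_div_le
  set a : ℕ → ℝ := fun n => g n / n with ha
  have ha0 : ∀ n, 0 ≤ a n := h.logWeight_nonneg
  have hz := h.density_pos
  have hK : 0 ≤ K := by simpa using (abs_nonneg _).trans (h.bound 1 le_rfl)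
  have hΨ : ∀ y, 1 ≤ y →
      partialSum (fun n => g n * ArithmeticFunction.vonMangoldt n) y ≤ (z + K) * y := by
    intro y hy
    have h1 := (abs_le.mp (h.bound y hy)).2
    have h2 : (1 + Real.log y) ^ (-(1 + ρ)) ≤ 1 := by
      have := Real.log_nonneg hy
      have := h.rho_pos
      exact Real.rpow_le_one_of_one_le_of_nonpos (by linarith) (by linarith)
    have h3 : K * (y * (1 + Real.log y) ^ (-(1 + ρ))) ≤ K * y := by
      refine mul_le_mul_of_nonneg_left ?_ hK
      exact mul_le_of_le_one_right (by linarith) h2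
    linarith
  refine ⟨(z + K + 2) * C, by positivity, fun x hx => ?_⟩
  have hl := Real.log_nonneg hx
  have hx0 : 0 < x := by linarith
  have key : (1 + Real.log x) * partialSum g x ≤ (z + K + 2) * (x * partialSum a x) := by
    have e : (1 + Real.log x) * partialSum g x =
        partialSum (fun n => g n * Real.log n) x +
          partialSum (fun n => g n * (1 + Real.log (x / n))) x := by
      rw [partialSum, partialSum, partialSum, Finset.mul_sum, ← Finset.sum_add_distrib]
      refine Finset.sum_congr rfl fun n hn => ?_
      have := mem_Ioc_floor hn
      rw [Real.log_div hx0.ne' (by linarith)]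
      ring
    rw [e, sum_mul_log_eq h.map_mul, partialSum, partialSum, Finset.mul_sum, Finset.mul_sum,
      ← Finset.sum_add_distrib]
    refine Finset.sum_le_sum fun n hn => ?_
    have hn' := mem_Ioc_floor hn
    have hn0 : (0 : ℝ) < n := by linarith
    have h1 : 1 ≤ x / n := (one_le_div hn0).mpr hn'.2
    have h2 := hΨ _ h1
    have h3 := Real.log_le_sub_one_of_pos (by linarith : 0 < x / n)
    have h4 := h.nonneg n
    calc _ ≤ g n * ((z + K) * (x / n)) + g n * (2 * (x / n)) := by
          gcongr; linarith
      _ = _ := by rw [ha]; ring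
  have h5 := hC x hx
  have hp : 0 < 1 + Real.log x := by linarith
  refine le_of_mul_le_mul_left (key.trans ?_) hp
  rw [Real.rpow_sub_one hp.ne']
  calc _ ≤ (z + K + 2) * (x * (C * (1 + Real.log x) ^ z)) := by
        have := h.density_pos
        gcongr
    _ = _ := by field_simp

end IsRegularWeight

theorem exists_tendsto_of_forall_exists_eventually_abs_sub_le {ι : Type*} {l : Filter ι} [l.NeBot]
    {D : ι → ℝ} (h : ∀ ε > 0, ∃ c, ∀ᶠ x in l, |D x - c| ≤ ε) : ∃ c, Tendsto D l (nhds c) := by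
  refine cauchy_map_iff_exists_tendsto.mp (Metric.cauchy_iff.mpr ⟨inferInstance, fun ε hε => ?_⟩)
  obtain ⟨c, hc⟩ := h (ε / 3) (by positivity)
  refine ⟨Metric.closedBall c (ε / 3), ?_, fun x hx y hy => ?_⟩
  · refine mem_map.mpr (hc.mono fun x hx => ?_)
    rwa [Metric.mem_closedBall, Real.dist_eq]
  · have := dist_triangle_right x y c
    rw [Metric.mem_closedBall] at hx hy
    linarith

theorem rpow_sub_isLittleO (b p : ℝ) :
    (fun u : ℝ => (u - b) ^ p - (u ^ p - p * b * u ^ (p - 1))) =o[atTop]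
      fun u => u ^ (p - 1) := by
  have hd : HasDerivAt (fun t : ℝ => (1 - b * t) ^ p) (-(p * b)) 0 := by
    have h1 : HasDerivAt (fun t : ℝ => 1 - b * t) (-(b * 1)) 0 :=
      ((hasDerivAt_id (0 : ℝ)).const_mul b).const_sub 1
    refine (h1.rpow_const (p := p) (Or.inl (by simp))).congr_deriv ?_
    simp
    ring
  have h2 := (hasDerivAt_iff_isLittleO.mp hd).comp_tendsto tendsto_inv_atTop_zero
  have h3 := (isBigO_refl (fun u : ℝ => u ^ p) atTop).mul_isLittleO h2
  refine h3.congr' ?_ ?_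
  · filter_upwards [eventually_gt_atTop 0, eventually_gt_atTop b] with u hu hub
    have e : (u - b) ^ p = u ^ p * (1 - b * u⁻¹) ^ p := by
      have : 0 ≤ 1 - b * u⁻¹ := by
        rw [sub_nonneg, ← div_eq_mul_inv, div_le_one hu]; exact hub.le
      rw [← Real.mul_rpow hu.le this]
      congr 1
      field_simp
    simp only [Function.comp_apply, mul_zero, sub_zero, Real.one_rpow, smul_eq_mul]
    rw [e, Real.rpow_sub_one hu.ne']
    field_simp
    ring
  · filter_upwards [eventually_gt_atTop 0] with u hu
    simp only [Function.comp_apply, sub_zero]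
    rw [Real.rpow_sub_one hu.ne', div_eq_mul_inv]

namespace IsRegularWeight

variable {g : ℕ → ℝ} {z ρ K : ℝ}

theorem partialSum_div_mul_isLittleO (h : IsRegularWeight g z ρ K) {ε : ℝ → ℝ} {E : ℝ}
    (hE0 : 0 < E) (hE : ∀ y, 1 ≤ y → |ε y| ≤ E) (hε : Tendsto ε atTop (nhds 0)) :
    (fun u => partialSum (fun n => g n / n * ε (Real.exp u / n)) (Real.exp u)) =o[atTop]
      fun u => u ^ z := by
  obtain ⟨C, hC0, hC⟩ := h.exists_partialSum_div_le
  obtain ⟨C', hC'0, hC'⟩ := h.exists_partialSum_le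
  have hz := h.density_pos
  have hz1 := h.density_lt_one
  refine IsLittleO.of_bound fun e he => ?_
  set e' := e / (4 * C) with he'
  have he'0 : 0 < e' := by positivity
  obtain ⟨T, hT⟩ := eventually_atTop.mp ((tendsto_order.mp hε.abs).2 e' (by simpa using he'0))
  set T' := max T 1 with hT'
  have hT'0 : 0 < T' := lt_of_lt_of_le one_pos (le_max_right _ _)
  filter_upwards [eventually_ge_atTop 1,
    (tendsto_rpow_atTop hz).eventually_ge_atTop (2 * (E * T' * C') / e)] with u hu hbig
  have hx1 : 1 ≤ Real.exp u := Real.one_le_exp (by linarith)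
  have hx0 := Real.exp_pos u
  have h1 : |partialSum (fun n => g n / n * ε (Real.exp u / n)) (Real.exp u)| ≤
      e' * partialSum (fun n => g n / n) (Real.exp u) +
        E * T' / Real.exp u * partialSum g (Real.exp u) := by
    rw [partialSum, partialSum, partialSum, Finset.mul_sum, Finset.mul_sum,
      ← Finset.sum_add_distrib]
    refine (Finset.abs_sum_le_sum_abs _ _).trans (Finset.sum_le_sum fun n hn => ?_)
    have hn' := mem_Ioc_floor hn
    have hn0 : (0 : ℝ) < n := by linarith
    have ha := h.logWeight_nonneg n
    have hg := h.nonneg n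
    rw [abs_mul, abs_of_nonneg ha]
    rcases le_total T' (Real.exp u / n) with hc | hc
    · have h2 := (hT _ ((le_max_left _ _).trans hc)).le
      have h3 : 0 ≤ E * T' / Real.exp u * g n := by positivity
      nlinarith
    · have h2 := hE _ ((one_le_div hn0).mpr hn'.2)
      have h3 : g n / n ≤ T' / Real.exp u * g n := by
        rw [div_le_iff₀ hn0] at hc
        rw [div_mul_eq_mul_div, div_le_div_iff₀ hn0 hx0]
        nlinarith
      have h4 : 0 ≤ e' * (g n / n) := by positivity
      calc g n / n * |ε (Real.exp u / n)| ≤ T' / Real.exp u * g n * E := by gcongr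
        _ = E * T' / Real.exp u * g n := by ring
        _ ≤ _ := by linarith
  have h2 := hC _ hx1
  have h3 := hC' _ hx1
  rw [Real.log_exp] at h2 h3
  have h4 : (1 + u) ^ z ≤ 2 * u ^ z := by
    calc (1 + u) ^ z ≤ (2 * u) ^ z := Real.rpow_le_rpow (by linarith) (by linarith) hz.le
      _ = 2 ^ z * u ^ z := Real.mul_rpow (by norm_num) (by linarith)
      _ ≤ 2 * u ^ z := by
        gcongr
        calc (2 : ℝ) ^ z ≤ 2 ^ (1 : ℝ) := Real.rpow_le_rpow_of_exponent_le (by norm_num) hz1.le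
          _ = 2 := Real.rpow_one 2
  have h5 : (1 + u) ^ (z - 1) ≤ 1 :=
    Real.rpow_le_one_of_one_le_of_nonpos (by linarith) (by linarith)
  have hu0 : 0 ≤ u ^ z := by positivity
  rw [div_le_iff₀ he] at hbig
  rw [Real.norm_eq_abs, Real.norm_of_nonneg hu0]
  refine h1.trans ?_
  calc _ ≤ e' * (C * (2 * u ^ z)) + E * T' / Real.exp u * (C' * (Real.exp u * 1)) := by
        gcongr
        · exact h2.trans (by gcongr)
        · exact h3.trans (by gcongr)
    _ = e / 2 * u ^ z + E * T' * C' := by rw [he']; field_simp; ring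
    _ ≤ e * u ^ z := by linarith

theorem exists_partialSum_div_isLittleO (h : IsRegularWeight g z ρ K) :
    ∃ A c : ℝ, 0 < A ∧ (fun u => partialSum (fun n => g n / n) (Real.exp u) -
      (A * u ^ z + c * u ^ (z - 1))) =o[atTop] fun u : ℝ => u ^ (z - 1) := by
  obtain ⟨B, E, ε, hE0, hE, hε, hid⟩ := h.exists_logMean_identity
  have hη := h.partialSum_div_mul_isLittleO hE0 hE hε
  set a : ℕ → ℝ := fun n => g n / n with ha
  have ha0 : ∀ n, 0 ≤ a n := h.logWeight_nonneg
  have hz := h.density_pos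
  have hz1 := h.density_lt_one
  set η : ℝ → ℝ := fun u => partialSum (fun n => a n * ε (Real.exp u / n)) (Real.exp u) with hηd
  set F : ℝ → ℝ := fun u => logMean a u * (u - B) ^ (-(1 + z)) with hF
  have hshift : ∀ᶠ u in atTop, u ^ z ≤ 2 * (u - B) ^ z := by
    filter_upwards [eventually_ge_atTop 1, eventually_ge_atTop (2 * B),
      eventually_ge_atTop (B + 1)] with u h1 h2 h3
    calc u ^ z ≤ (2 * (u - B)) ^ z := Real.rpow_le_rpow (by linarith) (by linarith) hz.le
      _ = 2 ^ z * (u - B) ^ z := Real.mul_rpow (by norm_num) (by linarith)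
      _ ≤ 2 * (u - B) ^ z := by
        have : 0 ≤ (u - B) ^ z := Real.rpow_nonneg (by linarith) _
        gcongr
        calc (2 : ℝ) ^ z ≤ 2 ^ (1 : ℝ) := Real.rpow_le_rpow_of_exponent_le (by norm_num) hz1.le
          _ = 2 := Real.rpow_one 2
  have hosc : ∀ e > 0, ∃ U, B + 1 ≤ U ∧ ∀ u v, U ≤ u → u ≤ v →
      |F v - F u| ≤ e * (u - B)⁻¹ := by
    intro e he
    obtain ⟨U, hU⟩ := eventually_atTop.mp ((hη.bound (half_pos he)).and
      (hshift.and (eventually_ge_atTop 0)))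
    refine ⟨max U (B + 1), le_max_right _ _, fun u v hu huv => ?_⟩
    have hu1 : U ≤ u := (le_max_left _ _).trans hu
    have hu2 : B + 1 ≤ u := (le_max_right _ _).trans hu
    have hpos : ∀ w, u ≤ w → 0 < w - B := fun w hw => by linarith
    have hbd : ∀ w, u ≤ w → HasDerivAt (fun w => e * ((u - B)⁻¹ - (w - B)⁻¹))
        (e * ((w - B) ^ 2)⁻¹) w := by
      intro w hw
      refine (((((hasDerivAt_id w).sub_const B).inv (hpos w hw).ne').const_sub
        (u - B)⁻¹).const_mul e).congr_deriv ?_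
      simp only [id]
      ring
    have hmain := image_norm_le_of_norm_deriv_right_le_deriv_boundary' (a := u) (b := v)
      (f := fun w => F w - F u) (f' := fun w => (w - B) ^ (-(2 + z)) *
        ((w - B) * partialSum a (Real.exp w) - (1 + z) * logMean a w))
      (B := fun w => e * ((u - B)⁻¹ - (w - B)⁻¹)) (B' := fun w => e * ((w - B) ^ 2)⁻¹)
      ((continuousOn_logMean_mul_rpow a z (by linarith)).sub continuousOn_const)
      (fun w hw => (hasDerivWithinAt_logMean_mul_rpow a z
        (by linarith [hw.1])).sub_const _) (by simp)
      (fun w hw => (hbd w hw.1).continuousAt.continuousWithinAt)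
      (fun w hw => (hbd w hw.1).hasDerivWithinAt) ?_ ⟨huv, le_rfl⟩
    · refine hmain.trans ?_
      gcongr
      have := inv_pos.mpr (hpos v huv)
      linarith
    · intro w hw
      have hw0 := hpos w hw.1
      obtain ⟨h1, h2, h3⟩ := hU w (hu1.trans hw.1)
      have h4 : (w - B) * partialSum a (Real.exp w) - (1 + z) * logMean a w = η w := by
        rw [hid w h3]; ring
      rw [h4, norm_mul, Real.norm_of_nonneg (by positivity)]
      rw [Real.norm_of_nonneg (by positivity : (0 : ℝ) ≤ w ^ z)] at h1
      calc _ ≤ (w - B) ^ (-(2 + z)) * (e / 2 * (2 * (w - B) ^ z)) := by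
            gcongr
            exact h1.trans (by gcongr)
        _ = e * ((w - B) ^ (-(2 + z)) * (w - B) ^ z) := by ring
        _ = _ := by
          rw [← Real.rpow_add hw0, ← Real.rpow_natCast, ← Real.rpow_neg hw0.le]
          norm_num
  obtain ⟨J, hJ⟩ : ∃ J, Tendsto F atTop (nhds J) := by
    refine exists_tendsto_of_forall_exists_eventually_abs_sub_le fun e he => ?_
    obtain ⟨U, hU1, hU⟩ := hosc e he
    refine ⟨F U, ?_⟩
    filter_upwards [eventually_ge_atTop U] with v hv
    refine (hU U v le_rfl hv).trans (mul_le_of_le_one_right he.le ?_)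
    exact inv_le_one_of_one_le₀ (by linarith)
  have hFJ : ∀ e > 0, ∃ U, B + 1 ≤ U ∧ ∀ u, U ≤ u → |J - F u| ≤ e * (u - B)⁻¹ := by
    intro e he
    obtain ⟨U, hU1, hU⟩ := hosc e he
    refine ⟨U, hU1, fun u hu => le_of_tendsto ((hJ.sub_const (F u)).abs) ?_⟩
    filter_upwards [eventually_ge_atTop u] with v hv using hU u v hu hv
  have hJpos : 0 < J := by
    set b := B - E with hb
    set u₁ := max b 0 + 1 with hu₁
    have hub : b < u₁ := by have := le_max_left b 0; linarith
    have hu0 : 0 < u₁ := by have := le_max_right b 0; linarith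
    have hM0 : 0 < logMean a u₁ * (u₁ - b) ^ (-(1 + z)) := by
      have := logMean_pos ha0 (by simp [ha, h.map_one]) hu0
      have : 0 < u₁ - b := by linarith
      positivity
    refine hM0.trans_le (ge_of_tendsto hJ ?_)
    filter_upwards [eventually_ge_atTop u₁, eventually_ge_atTop (B + 1)] with u hu huB
    have hmono := image_le_of_deriv_right_le_deriv_boundary (a := u₁) (b := u)
      (f := fun _ => logMean a u₁ * (u₁ - b) ^ (-(1 + z)))
      (f' := fun _ => 0) (B := fun v => logMean a v * (v - b) ^ (-(1 + z)))
      continuousOn_const (fun v _ => hasDerivWithinAt_const _ _ _) le_rfl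
      (continuousOn_logMean_mul_rpow a z hub)
      (fun v hv => hasDerivWithinAt_logMean_mul_rpow a z (hub.trans_le hv.1))
      (fun v hv => ?_) ⟨hu, le_rfl⟩
    · refine hmono.trans ?_
      have h1 : 0 < logMean a u := logMean_pos ha0 (by simp [ha, h.map_one]) (by linarith)
      exact mul_le_mul_of_nonneg_left
        (Real.rpow_le_rpow_of_nonpos (by linarith) (by linarith) (by linarith)) h1.le
    · have hv1 := hv.1
      have : 0 < v - b := by linarith
      refine mul_nonneg (by positivity) ?_
      have h1 := hid v (by linarith)
      have h2 := (abs_le.mp (abs_partialSum_mul_le ha0 hE (Real.exp v))).1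
      rw [hb]
      nlinarith
  refine ⟨(1 + z) * J, (1 + z) * J * (-(z * B)), by positivity, ?_⟩
  have hsplit : (fun u => partialSum a (Real.exp u) -
      ((1 + z) * J * u ^ z + (1 + z) * J * (-(z * B)) * u ^ (z - 1))) =ᶠ[atTop]
      fun u => (1 + z) * J * ((u - B) ^ z - (u ^ z - z * B * u ^ (z - 1))) +
        ((1 + z) * ((F u - J) * (u - B) ^ z) + η u * (u - B)⁻¹) := by
    filter_upwards [eventually_ge_atTop 0, eventually_gt_atTop B] with u hu huB
    have hp : 0 < u - B := by linarith
    have h1 : (1 + z) * (F u * (u - B) ^ z) = (1 + z) * logMean a u * (u - B)⁻¹ := by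
      rw [hF]
      have : (u - B) ^ (-(1 + z)) * (u - B) ^ z = (u - B)⁻¹ := by
        rw [← Real.rpow_add hp, ← Real.rpow_neg_one]
        congr 1; ring
      simp only [mul_assoc, this]
    have h2 : partialSum a (Real.exp u) = ((1 + z) * logMean a u + η u) * (u - B)⁻¹ := by
      rw [← hid u hu]
      field_simp
    rw [h2, add_mul, ← h1]
    ring
  have hinv : (fun u : ℝ => (u - B)⁻¹) =O[atTop] fun u => u⁻¹ := by
    refine IsBigO.of_bound 2 ?_
    filter_upwards [eventually_gt_atTop 0, eventually_gt_atTop (2 * B)] with u hu huB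
    have hp : 0 < u - B := by linarith
    rw [Real.norm_of_nonneg (by positivity), Real.norm_of_nonneg (by positivity),
      ← div_eq_mul_inv, ← one_div, div_le_div_iff₀ hp hu]
    linarith
  have hpow : (fun u : ℝ => u ^ z * u⁻¹) =ᶠ[atTop] fun u => u ^ (z - 1) := by
    filter_upwards [eventually_gt_atTop 0] with u hu
    rw [Real.rpow_sub_one hu.ne', div_eq_mul_inv]
  have hone : (fun u : ℝ => (u - B) ^ z) =O[atTop] fun u => u ^ z := by
    refine IsBigO.of_bound ((1 + |B|) ^ z) ?_
    filter_upwards [eventually_ge_atTop 1, eventually_gt_atTop B] with u hu huB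
    rw [Real.norm_of_nonneg (Real.rpow_nonneg (by linarith) _),
      Real.norm_of_nonneg (by positivity), ← Real.mul_rpow (by positivity) (by linarith)]
    refine Real.rpow_le_rpow (by linarith) ?_ hz.le
    have := neg_le_abs B
    have := abs_nonneg B
    nlinarith
  have hF' : (fun u => F u - J) =o[atTop] fun u => u⁻¹ := by
    have : (fun u => F u - J) =o[atTop] fun u => (u - B)⁻¹ := by
      refine IsLittleO.of_bound fun e he => ?_
      obtain ⟨U, hU1, hU⟩ := hFJ e he
      filter_upwards [eventually_ge_atTop U] with u hu
      have hp : 0 < u - B := by linarith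
      rw [Real.norm_eq_abs, abs_sub_comm, Real.norm_of_nonneg (by positivity)]
      exact hU u hu
    exact this.trans_isBigO hinv
  refine IsLittleO.congr' ?_ hsplit.symm EventuallyEq.rfl
  refine ((rpow_sub_isLittleO B z).const_mul_left _).add (IsLittleO.add ?_ ?_)
  · refine IsLittleO.const_mul_left ?_ _
    exact (hF'.mul_isBigO hone).congr' EventuallyEq.rfl
      ((EventuallyEq.of_eq (funext fun u => mul_comm _ _)).trans hpow)
  · exact (hη.mul_isBigO hinv).congr' EventuallyEq.rfl hpow

end IsRegularWeight

theorem summable_one_add_rpow_neg {ρ : ℝ} (hρ : 0 < ρ) :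
    Summable fun k : ℕ => (1 + (k : ℝ)) ^ (-(1 + ρ)) := by
  have := (summable_nat_add_iff 1).mpr (Real.summable_nat_rpow.mpr (by linarith : -(1 + ρ) < -1))
  refine this.congr fun k => ?_
  push_cast
  rw [add_comm]

theorem one_add_rpow_le_mul_exp {s v : ℝ} (hs : 1 ≤ s) (hv : 0 ≤ v) :
    (1 + v) ^ s ≤ s ^ s * Real.exp v := by
  have h1 : 1 + v ≤ s * Real.exp (v / s) := by
    have h2 := Real.add_one_le_exp (v / s)
    calc 1 + v ≤ s + v := by linarith
      _ = s * (v / s + 1) := by field_simp; ring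
      _ ≤ _ := by gcongr
  calc (1 + v) ^ s ≤ (s * Real.exp (v / s)) ^ s :=
        Real.rpow_le_rpow (by linarith) h1 (by linarith)
    _ = s ^ s * Real.exp v := by
      rw [Real.mul_rpow (by linarith) (Real.exp_pos _).le, ← Real.exp_mul]
      congr 2
      field_simp

theorem log_le_mul_rpow_neg {ρ y : ℝ} (hρ : 0 < ρ) (hy : 1 ≤ y) :
    Real.log y ≤ (2 + ρ) ^ (2 + ρ) * (y * (1 + Real.log y) ^ (-(1 + ρ))) := by
  have hl := Real.log_nonneg hy
  have h1 := one_add_rpow_le_mul_exp (s := 2 + ρ) (by linarith) hl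
  have hp : 0 < 1 + Real.log y := by linarith
  rw [Real.exp_log (by linarith)] at h1
  rw [Real.rpow_neg hp.le, ← mul_assoc, ← div_eq_mul_inv, le_div_iff₀ (by positivity)]
  refine le_trans ?_ h1
  rw [show (2 : ℝ) + ρ = 1 + (1 + ρ) by ring, Real.rpow_add hp 1 (1 + ρ),
    Real.rpow_one]
  exact mul_le_mul_of_nonneg_right (by linarith) (by positivity)

namespace IsRegularWeight

variable {g : ℕ → ℝ} {z ρ K : ℝ}

theorem exists_sum_filter_le (h : IsRegularWeight g z ρ K) {R : ℝ → ℝ} {K₁ : ℝ}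
    (hR : ∀ y, 1 ≤ y → |R y| ≤ K₁ * (y * (1 + Real.log y) ^ (-(1 + ρ)))) :
    ∃ C, 0 ≤ C ∧ ∀ (k₀ : ℕ) (x : ℝ), 0 < x → 2 ≤ Real.log x →
      ∑ n ∈ Finset.Ioc 0 ⌊x⌋₊ with k₀ ≤ ⌊Real.log (x / (n : ℕ))⌋₊, g n * |R (x / n)| ≤
        C * ((∑' k : ℕ, (1 + ((k + k₀ : ℕ) : ℝ)) ^ (-(1 + ρ))) + Real.log x ^ (-ρ)) *
          (x * Real.log x ^ (z - 1)) := by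
  obtain ⟨C₁, hC₁0, hC₁⟩ := h.exists_partialSum_div_le
  obtain ⟨C₂, hC₂0, hC₂⟩ := h.exists_partialSum_le
  have hz := h.density_pos
  have hz1 := h.density_lt_one
  have hρ := h.rho_pos
  have hK₁ : 0 ≤ K₁ := by simpa using (abs_nonneg _).trans (hR 1 le_rfl)
  set φ : ℝ → ℝ := fun v => (1 + v) ^ (-(1 + ρ)) with hφ
  have hφ0 : ∀ v, 0 ≤ v → 0 ≤ φ v := fun v hv => by rw [hφ]; positivity
  have hφanti : ∀ v w, 0 ≤ v → v ≤ w → φ w ≤ φ v := fun v w hv hw =>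
    Real.rpow_le_rpow_of_nonpos (by linarith) (by linarith) (by linarith)
  refine ⟨K₁ * (2 * Real.exp 1 * C₂) + K₁ * (C₁ * 2 ^ (2 + ρ)), by positivity,
    fun k₀ x hx0 hx => ?_⟩
  set u := Real.log x with hu
  have hx1 : 1 ≤ x := by
    by_contra! hc
    have := Real.log_neg hx0 hc
    linarith
  set κ : ℕ → ℕ := fun n => ⌊Real.log (x / n)⌋₊ with hκ
  set X := Finset.Ioc 0 ⌊x⌋₊ with hX
  set τ := ∑' k : ℕ, (1 + ((k + k₀ : ℕ) : ℝ)) ^ (-(1 + ρ)) with hτ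
  have hn : ∀ n ∈ X, (0 : ℝ) < n ∧ 1 ≤ x / n ∧ (κ n : ℝ) ≤ Real.log (x / n) := by
    intro n hn
    have h1 := mem_Ioc_floor hn
    have h2 : (0 : ℝ) < n := by linarith
    have h3 := (one_le_div h2).mpr h1.2
    exact ⟨h2, h3, Nat.floor_le (Real.log_nonneg h3)⟩
  have hterm : ∀ n ∈ X, g n * |R (x / n)| ≤ K₁ * (g n * (x / n) * φ (κ n)) := by
    intro n hnX
    obtain ⟨h1, h2, h3⟩ := hn n hnX
    have h4 := h.nonneg n
    calc g n * |R (x / n)| ≤ g n * (K₁ * (x / n * φ (κ n))) := by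
          refine mul_le_mul_of_nonneg_left ((hR _ h2).trans ?_) h4
          have := hφanti _ _ (Nat.cast_nonneg (κ n)) h3
          gcongr
      _ = _ := by ring
  have hfar : ∑ n ∈ X.filter fun n => k₀ ≤ κ n ∧ ¬ (κ n : ℝ) ≤ u / 2, g n * (x / n) * φ (κ n) ≤
      C₁ * 2 ^ (2 + ρ) * u ^ (-ρ) * (x * u ^ (z - 1)) := by
    have h1 : ∑ n ∈ X.filter fun n => k₀ ≤ κ n ∧ ¬ (κ n : ℝ) ≤ u / 2, g n * (x / n) * φ (κ n) ≤
        ∑ n ∈ X, x * φ (u / 2) * (g n / n) := by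
      refine (Finset.sum_le_sum (g := fun n => x * φ (u / 2) * (g n / n)) fun n hnX => ?_).trans
        (Finset.sum_le_sum_of_subset_of_nonneg (Finset.filter_subset _ _) fun n _ _ => ?_)
      · rw [Finset.mem_filter] at hnX
        have h2 := hφanti _ _ (by linarith) (not_le.mp hnX.2.2).le
        have h3 := (hn n hnX.1).1
        have h4 := h.nonneg n
        calc _ ≤ g n * (x / n) * φ (u / 2) := by gcongr
          _ = _ := by ring
      · have := h.logWeight_nonneg n
        have := hφ0 (u / 2) (by linarith)
        positivity
    rw [← Finset.mul_sum] at h1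
    have h2 := hC₁ x hx1
    have h3 : (1 + u) ^ z ≤ 2 * u ^ z := by
      calc (1 + u) ^ z ≤ (2 * u) ^ z := Real.rpow_le_rpow (by linarith) (by linarith) hz.le
        _ = 2 ^ z * u ^ z := Real.mul_rpow (by norm_num) (by linarith)
        _ ≤ 2 * u ^ z := by
          gcongr
          calc (2 : ℝ) ^ z ≤ 2 ^ (1 : ℝ) := Real.rpow_le_rpow_of_exponent_le (by norm_num) hz1.le
            _ = 2 := Real.rpow_one 2
    have h4 : φ (u / 2) ≤ 2 ^ (1 + ρ) * u ^ (-(1 + ρ)) := by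
      calc φ (u / 2) ≤ (u / 2) ^ (-(1 + ρ)) :=
            Real.rpow_le_rpow_of_nonpos (by linarith) (by linarith) (by linarith)
        _ = _ := by
          rw [Real.div_rpow (by linarith) (by norm_num), Real.rpow_neg (by norm_num : (0:ℝ) ≤ 2),
            div_inv_eq_mul, mul_comm]
    refine h1.trans ?_
    calc x * φ (u / 2) * partialSum (fun n => g n / n) x ≤
          x * (2 ^ (1 + ρ) * u ^ (-(1 + ρ))) * (C₁ * (2 * u ^ z)) := by
          have : 0 ≤ φ (u / 2) := hφ0 _ (by linarith)
          have : 0 ≤ partialSum (fun n => g n / n) x := partialSum_nonneg h.logWeight_nonneg _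
          gcongr
          exact h2.trans (by gcongr)
      _ = C₁ * (2 ^ (1 + ρ) * 2) * (u ^ (-(1 + ρ)) * u ^ z) * x := by ring
      _ = _ := by
        have hu0 : 0 < u := by linarith
        rw [← Real.rpow_add_one (by norm_num), ← Real.rpow_add hu0, mul_comm x, ← mul_assoc,
          mul_assoc _ (u ^ (-ρ)), ← Real.rpow_add hu0]
        congr 3 <;> ring_nf
  have hnear : ∑ n ∈ X.filter fun n => k₀ ≤ κ n ∧ (κ n : ℝ) ≤ u / 2, g n * (x / n) * φ (κ n) ≤
      2 * Real.exp 1 * C₂ * τ * (x * u ^ (z - 1)) := by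
    have hmaps : ∀ n ∈ X.filter (fun n => k₀ ≤ κ n ∧ (κ n : ℝ) ≤ u / 2),
        κ n ∈ Finset.Ico k₀ (⌊u / 2⌋₊ + 1) := by
      intro n hn
      rw [Finset.mem_filter] at hn
      rw [Finset.mem_Ico]
      exact ⟨hn.2.1, Nat.lt_succ_of_le (Nat.le_floor hn.2.2)⟩
    rw [← Finset.sum_fiberwise_of_maps_to hmaps]
    have hfib : ∀ k ∈ Finset.Ico k₀ (⌊u / 2⌋₊ + 1),
        ∑ n ∈ (X.filter fun n => k₀ ≤ κ n ∧ (κ n : ℝ) ≤ u / 2) with κ n = k,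
          g n * (x / n) * φ (κ n) ≤ φ k * (2 * Real.exp 1 * C₂ * (x * u ^ (z - 1))) := by
      intro k hk
      rw [Finset.mem_Ico] at hk
      have hk2 : (k : ℝ) ≤ u / 2 := (Nat.le_floor_iff (by linarith)).mp (by lia)
      have hS : partialSum g (x * Real.exp (-k)) ≤
          C₂ * (x * Real.exp (-k) * (2 * u ^ (z - 1))) := by
        have e : Real.log (x * Real.exp (-k)) = u - k := by
          rw [Real.log_mul hx0.ne' (Real.exp_pos _).ne', Real.log_exp]; ring
        have h1 : 1 ≤ x * Real.exp (-k) := by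
          rw [← Real.log_nonneg_iff (by positivity), e]
          linarith
        refine (hC₂ _ h1).trans ?_
        rw [e]
        gcongr
        calc (1 + (u - k)) ^ (z - 1) ≤ (u / 2) ^ (z - 1) :=
              Real.rpow_le_rpow_of_nonpos (by linarith) (by linarith) (by linarith)
          _ = 2 ^ (1 - z) * u ^ (z - 1) := by
            rw [Real.div_rpow (by linarith) (by norm_num), div_eq_mul_inv,
              ← Real.rpow_neg (by norm_num : (0:ℝ) ≤ 2), mul_comm, neg_sub]
          _ ≤ 2 * u ^ (z - 1) := by
            gcongr
            calc (2 : ℝ) ^ (1 - z) ≤ 2 ^ (1 : ℝ) :=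
                  Real.rpow_le_rpow_of_exponent_le (by norm_num) (by linarith)
              _ = 2 := Real.rpow_one 2
      have h1 : ∑ n ∈ (X.filter fun n => k₀ ≤ κ n ∧ (κ n : ℝ) ≤ u / 2) with κ n = k,
          g n * (x / n) * φ (κ n) ≤ ∑ n ∈ Finset.Ioc 0 ⌊x * Real.exp (-k)⌋₊,
            φ k * Real.exp (k + 1) * g n := by
        refine (Finset.sum_le_sum (g := fun n => φ k * Real.exp (k + 1) * g n) ?_).trans
          (Finset.sum_le_sum_of_subset_of_nonneg ?_ ?_)
        · intro n hn'
          rw [Finset.mem_filter, Finset.mem_filter] at hn'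
          obtain ⟨h2, h3, h4⟩ := hn n hn'.1.1
          have h5 : x / n ≤ Real.exp (k + 1) := by
            rw [← Real.log_le_iff_le_exp (by linarith), ← hn'.2]
            exact (Nat.lt_floor_add_one _).le
          have h6 := h.nonneg n
          have h7 := hφ0 k (Nat.cast_nonneg k)
          rw [hn'.2]
          calc _ ≤ g n * Real.exp (k + 1) * φ k := by gcongr
            _ = _ := by ring
        · intro n hn'
          rw [Finset.mem_filter, Finset.mem_filter] at hn'
          obtain ⟨h2, h3, h4⟩ := hn n hn'.1.1
          rw [hn'.2, Real.le_log_iff_exp_le (by linarith), le_div_iff₀ h2] at h4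
          rw [mem_Ioc_floor_iff]
          refine ⟨(mem_Ioc_floor hn'.1.1).1, ?_⟩
          rw [Real.exp_neg, ← div_eq_mul_inv, le_div_iff₀ (Real.exp_pos _)]
          linarith
        · intro n _ _
          have h6 := h.nonneg n
          have h7 := hφ0 k (Nat.cast_nonneg k)
          positivity
      rw [← Finset.mul_sum] at h1
      refine h1.trans ?_
      have h7 := hφ0 k (Nat.cast_nonneg k)
      calc φ k * Real.exp (k + 1) * partialSum g (x * Real.exp (-k)) ≤
            φ k * Real.exp (k + 1) * (C₂ * (x * Real.exp (-k) * (2 * u ^ (z - 1)))) := by gcongr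
        _ = φ k * (2 * (Real.exp (k + 1) * Real.exp (-k)) * C₂ * (x * u ^ (z - 1))) := by ring
        _ = _ := by rw [← Real.exp_add]; ring_nf
    refine (Finset.sum_le_sum hfib).trans ?_
    rw [← Finset.sum_mul]
    have hsum : ∑ k ∈ Finset.Ico k₀ (⌊u / 2⌋₊ + 1), φ k ≤ τ := by
      rw [Finset.sum_Ico_eq_sum_range]
      have hs := (summable_nat_add_iff k₀).mpr (summable_one_add_rpow_neg hρ)
      refine le_trans (le_of_eq ?_) (hs.sum_le_tsum (Finset.range (⌊u / 2⌋₊ + 1 - k₀))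
        fun k _ => by positivity)
      refine Finset.sum_congr rfl fun k _ => ?_
      rw [hφ, add_comm k₀ k]
    calc _ ≤ τ * (2 * Real.exp 1 * C₂ * (x * u ^ (z - 1))) := by gcongr
      _ = _ := by ring
  have hτ0 : 0 ≤ τ := tsum_nonneg fun k => by positivity
  calc ∑ n ∈ X with k₀ ≤ κ n, g n * |R (x / n)|
      ≤ ∑ n ∈ X with k₀ ≤ κ n, K₁ * (g n * (x / n) * φ (κ n)) :=
        Finset.sum_le_sum fun n hn => hterm n (Finset.mem_filter.mp hn).1
    _ = K₁ * (∑ n ∈ X.filter fun n => k₀ ≤ κ n ∧ (κ n : ℝ) ≤ u / 2, g n * (x / n) * φ (κ n)) +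
        K₁ * (∑ n ∈ X.filter fun n => k₀ ≤ κ n ∧ ¬ (κ n : ℝ) ≤ u / 2,
          g n * (x / n) * φ (κ n)) := by
      rw [← Finset.mul_sum, ← mul_add, ← Finset.filter_filter, ← Finset.filter_filter,
        Finset.sum_filter_add_sum_filter_not]
    _ ≤ K₁ * (2 * Real.exp 1 * C₂ * τ * (x * u ^ (z - 1))) +
        K₁ * (C₁ * 2 ^ (2 + ρ) * u ^ (-ρ) * (x * u ^ (z - 1))) := by gcongr
    _ ≤ _ := by
      have p1 : 0 ≤ K₁ * (2 * Real.exp 1 * C₂) * u ^ (-ρ) * (x * u ^ (z - 1)) := by positivity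
      have p2 : 0 ≤ K₁ * (C₁ * 2 ^ (2 + ρ)) * τ * (x * u ^ (z - 1)) := by positivity
      nlinarith

end IsRegularWeight

theorem tendsto_sub_rpow_div_rpow (t p : ℝ) :
    Tendsto (fun u : ℝ => (u - t) ^ p / u ^ p) atTop (nhds 1) := by
  have h1 : Tendsto (fun u : ℝ => 1 - t * u⁻¹) atTop (nhds 1) := by
    simpa using (tendsto_inv_atTop_zero.const_mul t).const_sub 1
  have h2 := h1.rpow_const (p := p) (Or.inl one_ne_zero)
  rw [Real.one_rpow] at h2
  refine h2.congr' ?_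
  filter_upwards [eventually_gt_atTop 0, eventually_ge_atTop t] with u hu ht
  rw [← Real.div_rpow (by linarith) hu.le]
  congr 1
  field_simp

theorem tendsto_div_of_tendsto_right_deriv_div {F F' W W' : ℝ → ℝ} {A U₀ : ℝ}
    (hF : ∀ s t, U₀ ≤ s → ContinuousOn F (Set.Icc s t))
    (hF' : ∀ u, U₀ ≤ u → HasDerivWithinAt F (F' u) (Set.Ici u) u)
    (hW' : ∀ u, U₀ ≤ u → HasDerivAt W (W' u) u) (hpos : ∀ᶠ u in atTop, 0 < W' u)
    (hA : Tendsto (fun u => F' u / W' u) atTop (nhds A)) (hW : Tendsto W atTop atTop) :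
    Tendsto (fun u => F u / W u) atTop (nhds A) := by
  have hWc : ∀ s t, U₀ ≤ s → ContinuousOn W (Set.Icc s t) := fun s t hs u hu =>
    (hW' u (hs.trans hu.1)).continuousAt.continuousWithinAt
  rw [Metric.tendsto_atTop]
  intro e he
  have hA' := Metric.tendsto_atTop.mp hA (e / 2) (by positivity)
  obtain ⟨U₁, hU₁⟩ := hA'
  obtain ⟨U₂, hU₂⟩ := eventually_atTop.mp hpos
  set U := max U₀ (max U₁ U₂) with hU
  have hb : ∀ u, U ≤ u → |F' u - A * W' u| ≤ e / 2 * W' u := by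
    intro u hu
    have h1 := hU₁ u (((le_max_left _ _).trans (le_max_right _ _)).trans hu)
    have h2 := hU₂ u (((le_max_right _ _).trans (le_max_right _ _)).trans hu)
    rw [Real.dist_eq] at h1
    have e1 : F' u - A * W' u = (F' u / W' u - A) * W' u := by field_simp
    rw [e1, abs_mul, abs_of_pos h2]
    gcongr
  have hintg : ∀ u, U ≤ u → |(F u - A * W u) - (F U - A * W U)| ≤ e / 2 * (W u - W U) := by
    intro u hu
    have h0 : U₀ ≤ U := le_max_left _ _
    have := image_norm_le_of_norm_deriv_right_le_deriv_boundary' (a := U) (b := u)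
      (f := fun v => (F v - A * W v) - (F U - A * W U)) (f' := fun v => F' v - A * W' v)
      (B := fun v => e / 2 * (W v - W U)) (B' := fun v => e / 2 * W' v)
      (((hF U u h0).sub ((hWc U u h0).const_smul A)).sub continuousOn_const)
      (fun v hv => ((hF' v (h0.trans hv.1)).sub
        ((hW' v (h0.trans hv.1)).hasDerivWithinAt.const_mul A)).sub_const _)
      (by simp) (((hWc U u h0).sub continuousOn_const).const_smul (e / 2))
      (fun v hv => ((hW' v (h0.trans hv.1)).hasDerivWithinAt.sub_const _).const_mul _)
      (fun v hv => hb v hv.1) ⟨hu, le_rfl⟩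
    exact this
  set M := |F U - A * W U| + e / 2 * |W U| with hM
  obtain ⟨V, hV⟩ := eventually_atTop.mp (hW.eventually_gt_atTop (2 * M / e))
  refine ⟨max U V, fun u hu => ?_⟩
  have h1 := hintg u ((le_max_left _ _).trans hu)
  have h2 := hV u ((le_max_right _ _).trans hu)
  have hM0 : 0 ≤ M := by positivity
  have hW0 : 0 < W u := lt_of_le_of_lt (by positivity) h2
  rw [div_lt_iff₀ he] at h2
  rw [Real.dist_eq]
  have e1 : F u / W u - A = (F u - A * W u) / W u := by field_simp
  rw [e1, abs_div, abs_of_pos hW0, div_lt_iff₀ hW0]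
  have h3 : |F u - A * W u| ≤ e / 2 * (W u - W U) + |F U - A * W U| := by
    have := abs_sub_abs_le_abs_sub (F u - A * W u) (F U - A * W U)
    linarith
  have h4 := neg_abs_le (W U)
  have h5 : e / 2 * (W u - W U) ≤ e / 2 * (W u + |W U|) := by
    gcongr; linarith
  have : e / 2 * (W u + |W U|) + |F U - A * W U| = e / 2 * W u + M := by rw [hM]; ring
  linarith

theorem sum_filter_lt_eq_partialSum_sub (a : ℕ → ℝ) {y y' : ℝ} (hy : y ≤ y') :
    ∑ n ∈ Finset.Ioc 0 ⌊y'⌋₊ with y < (n : ℕ), a n = partialSum a y' - partialSum a y := by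
  have h := Finset.sum_filter_add_sum_filter_not (Finset.Ioc 0 ⌊y'⌋₊) (fun n : ℕ => y < n) a
  have e : (Finset.Ioc 0 ⌊y'⌋₊).filter (fun n : ℕ => ¬ y < n) = Finset.Ioc 0 ⌊y⌋₊ := by
    ext n
    rw [Finset.mem_filter, mem_Ioc_floor_iff, mem_Ioc_floor_iff, not_lt]
    exact ⟨fun h => ⟨h.1.1, h.2⟩, fun h => ⟨⟨h.1, h.2.trans hy⟩, h.2⟩⟩
  rw [e] at h
  rw [partialSum, partialSum, ← h]
  ring

namespace IsRegularWeight

variable {g : ℕ → ℝ} {z ρ K : ℝ}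

theorem exists_tendsto_partialSum_div (h : IsRegularWeight g z ρ K) :
    ∃ A c : ℝ, 0 < A ∧
      Tendsto (fun u => partialSum (fun n => g n / n) (Real.exp u) / u ^ (z - 1) - A * u)
        atTop (nhds c) := by
  obtain ⟨A, c, hA, hO⟩ := h.exists_partialSum_div_isLittleO
  refine ⟨A, c, hA, ?_⟩
  have := hO.tendsto_div_nhds_zero.add_const c
  rw [zero_add] at this
  refine this.congr' ?_
  filter_upwards [eventually_gt_atTop 0] with u hu
  have hp : 0 < u ^ (z - 1) := by positivity
  have e : u ^ z = u ^ (z - 1) * u := by rw [← Real.rpow_add_one hu.ne', sub_add_cancel]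
  rw [e]
  field_simp
  ring

theorem tendsto_partialSum_div_sub {a : ℕ → ℝ} {A c : ℝ}
    (h : Tendsto (fun u => partialSum a (Real.exp u) / u ^ (z - 1) - A * u) atTop (nhds c))
    (t : ℝ) : Tendsto (fun u => (partialSum a (Real.exp u) - partialSum a (Real.exp (u - t))) /
      u ^ (z - 1)) atTop (nhds (A * (z * t))) := by
  have ht : Tendsto (fun u : ℝ => u - t) atTop atTop := tendsto_atTop_add_const_right _ _ tendsto_id
  have h1 := (h.comp ht).mul (tendsto_sub_rpow_div_rpow t (z - 1))
  have h2 := ((rpow_sub_isLittleO t z).tendsto_div_nhds_zero.sub_const (z * t)).const_mul A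
  have h3 := (h.sub h1).sub h2
  rw [mul_one, sub_self, zero_sub, zero_sub, mul_neg, neg_neg] at h3
  refine h3.congr' ?_
  filter_upwards [eventually_gt_atTop 0, eventually_gt_atTop t] with u hu hut
  have hp : 0 < u ^ (z - 1) := by positivity
  have hs : 0 < u - t := by linarith
  have hq : 0 < (u - t) ^ (z - 1) := by positivity
  have e : u ^ z = u ^ (z - 1) * u := by rw [← Real.rpow_add_one hu.ne', sub_add_cancel]
  have e' : (u - t) ^ z = (u - t) ^ (z - 1) * (u - t) := by
    rw [← Real.rpow_add_one hs.ne', sub_add_cancel]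
  rw [e, e']
  simp only [Function.comp_apply]
  field_simp
  ring

theorem sum_mul_log_add (h : IsRegularWeight g z ρ K) (u : ℝ) :
    u * partialSum g (Real.exp u) =
      z * (Real.exp u * partialSum (fun n => g n / n) (Real.exp u)) +
      ∑ n ∈ Finset.Ioc 0 ⌊Real.exp u⌋₊, g n * (partialSum
        (fun n => g n * ArithmeticFunction.vonMangoldt n) (Real.exp u / n) -
          z * (Real.exp u / n)) + logMean g u := by
  have e : ∑ n ∈ Finset.Ioc 0 ⌊Real.exp u⌋₊, g n * partialSum
      (fun n => g n * ArithmeticFunction.vonMangoldt n) (Real.exp u / n) =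
      z * (Real.exp u * partialSum (fun n => g n / n) (Real.exp u)) +
      ∑ n ∈ Finset.Ioc 0 ⌊Real.exp u⌋₊, g n * (partialSum
        (fun n => g n * ArithmeticFunction.vonMangoldt n) (Real.exp u / n) -
          z * (Real.exp u / n)) := by
    rw [partialSum.eq_1 fun n => g n / n, Finset.mul_sum, Finset.mul_sum,
      ← Finset.sum_add_distrib]
    refine Finset.sum_congr rfl fun n _ => ?_
    ring
  rw [logMean_eq, sum_mul_log_eq h.map_mul, e]
  ring

theorem exists_tendsto_partialSum (h : IsRegularWeight g z ρ K) {A c : ℝ}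
    (hL : Tendsto (fun u => partialSum (fun n => g n / n) (Real.exp u) / u ^ (z - 1) - A * u)
      atTop (nhds c)) :
    Tendsto (fun u => partialSum g (Real.exp u) / (Real.exp u * u ^ (z - 1)))
      atTop (nhds (z * A)) := by
  have hρ := h.rho_pos
  set Ψ := partialSum (fun n => g n * ArithmeticFunction.vonMangoldt n) with hΨ
  set R : ℝ → ℝ := fun y => Ψ y - z * y + Real.log y with hRdef
  have hR : ∀ y, 1 ≤ y → |R y| ≤
      (K + (2 + ρ) ^ (2 + ρ)) * (y * (1 + Real.log y) ^ (-(1 + ρ))) := by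
    intro y hy
    refine (abs_add_le _ _).trans ?_
    rw [abs_of_nonneg (Real.log_nonneg hy), add_mul]
    exact add_le_add (h.bound y hy) (log_le_mul_rpow_neg hρ hy)
  obtain ⟨C, hC0, hC⟩ := h.exists_sum_filter_le hR
  set τ := ∑' k : ℕ, (1 + ((k + 0 : ℕ) : ℝ)) ^ (-(1 + ρ)) with hτ
  set Y : ℝ → ℝ := fun u => ∑ n ∈ Finset.Ioc 0 ⌊Real.exp u⌋₊, g n * R (Real.exp u / n) with hY
  have hYb : ∀ᶠ u in atTop, ‖Y u / (Real.exp u * u ^ (z - 1)) * u⁻¹‖ ≤ C * (τ + 1) * u⁻¹ := by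
    filter_upwards [eventually_ge_atTop 2] with u hu
    have h1 := hC 0 (Real.exp u) (Real.exp_pos u) (by rwa [Real.log_exp])
    simp only [Nat.zero_le, Finset.filter_true, Real.log_exp] at h1
    have h2 : |Y u| ≤ C * (τ + u ^ (-ρ)) * (Real.exp u * u ^ (z - 1)) := by
      refine (Finset.abs_sum_le_sum_abs _ _).trans (le_trans (le_of_eq ?_) h1)
      refine Finset.sum_congr rfl fun n _ => ?_
      rw [abs_mul, abs_of_nonneg (h.nonneg n)]
    have h3 : u ^ (-ρ) ≤ 1 := Real.rpow_le_one_of_one_le_of_nonpos (by linarith) (by linarith)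
    have hp : 0 < Real.exp u * u ^ (z - 1) := by positivity
    rw [norm_mul, Real.norm_of_nonneg (by positivity : 0 ≤ u⁻¹), norm_div,
      Real.norm_of_nonneg hp.le, Real.norm_eq_abs]
    gcongr
    rw [div_le_iff₀ hp]
    refine h2.trans ?_
    gcongr
  have hY0 : Tendsto (fun u => Y u / (Real.exp u * u ^ (z - 1)) * u⁻¹) atTop (nhds 0) := by
    refine squeeze_zero_norm' hYb ?_
    simpa using tendsto_inv_atTop_zero.const_mul (C * (τ + 1))
  have hL' := ((hL.mul tendsto_inv_atTop_zero).add_const A).const_mul z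
  have hsum := hL'.add hY0
  rw [mul_zero, zero_add, add_zero] at hsum
  refine hsum.congr' ?_
  filter_upwards [eventually_gt_atTop 0] with u hu
  have e1 := h.sum_mul_log_add u
  have e2 : ∑ n ∈ Finset.Ioc 0 ⌊Real.exp u⌋₊, g n * (Ψ (Real.exp u / n) -
          z * (Real.exp u / n)) + logMean g u = Y u := by
    rw [logMean, partialSum, hY, ← Finset.sum_add_distrib]
    refine Finset.sum_congr rfl fun n hn => ?_
    have := mem_Ioc_floor hn
    rw [hRdef]
    beta_reduce
    rw [Real.log_div (Real.exp_pos u).ne' (by linarith), Real.log_exp]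
    ring
  rw [add_assoc, e2] at e1
  have hp : 0 < u ^ (z - 1) := by positivity
  have hex := Real.exp_pos u
  have e3 : partialSum g (Real.exp u) =
      (z * (Real.exp u * partialSum (fun n => g n / n) (Real.exp u)) + Y u) / u := by
    rw [← e1]; field_simp
  rw [e3]
  field_simp
  ring

theorem tendsto_partialSum_exp_sub {A : ℝ} {a : ℕ → ℝ}
    (h : Tendsto (fun u => partialSum a (Real.exp u) / (Real.exp u * u ^ (z - 1))) atTop (nhds A))
    (t : ℝ) :
    Tendsto (fun u => partialSum a (Real.exp (u - t)) / (Real.exp u * u ^ (z - 1)))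
      atTop (nhds (A * Real.exp (-t))) := by
  have ht : Tendsto (fun u : ℝ => u - t) atTop atTop := tendsto_atTop_add_const_right _ _ tendsto_id
  have h1 := ((h.comp ht).mul (tendsto_sub_rpow_div_rpow t (z - 1))).mul_const (Real.exp (-t))
  rw [mul_one] at h1
  refine h1.congr' ?_
  filter_upwards [eventually_gt_atTop 0, eventually_gt_atTop t] with u hu hut
  have hp : 0 < u ^ (z - 1) := by positivity
  have hs : 0 < u - t := by linarith
  have hq : 0 < (u - t) ^ (z - 1) := by positivity
  have hex := Real.exp_pos u
  have het := Real.exp_pos (-t)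
  simp only [Function.comp_apply]
  rw [sub_eq_add_neg u t, Real.exp_add, ← sub_eq_add_neg]
  field_simp

theorem tendsto_logMean_div {A : ℝ} {a : ℕ → ℝ}
    (h : Tendsto (fun u => partialSum a (Real.exp u) / (Real.exp u * u ^ (z - 1)))
      atTop (nhds A)) :
    Tendsto (fun u => logMean a u / (Real.exp u * u ^ (z - 1))) atTop (nhds A) := by
  have hone : Tendsto (fun u : ℝ => 1 + (z - 1) * u⁻¹) atTop (nhds 1) := by
    simpa using (tendsto_inv_atTop_zero.const_mul (z - 1)).const_add 1
  refine tendsto_div_of_tendsto_right_deriv_div (U₀ := 1)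
    (F' := fun u => partialSum a (Real.exp u))
    (W' := fun u => Real.exp u * u ^ (z - 1) * (1 + (z - 1) * u⁻¹))
    (fun s t _ => continuousOn_logMean a s t) (fun u _ => hasDerivWithinAt_logMean a u)
    (fun u hu => ?_) ?_ ?_ ?_
  · have hu0 : 0 < u := by linarith
    refine ((Real.hasDerivAt_exp u).mul
      ((hasDerivAt_id u).rpow_const (p := z - 1) (Or.inl hu0.ne'))).congr_deriv ?_
    simp only [id]
    rw [Real.rpow_sub_one hu0.ne' (z - 1)]
    field_simp
  · filter_upwards [(tendsto_order.mp hone).1 0 one_pos, eventually_gt_atTop 0] with u h1 h2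
    have := Real.exp_pos u
    positivity
  · have := h.div hone one_ne_zero
    rw [div_one] at this
    refine this.congr fun u => ?_
    simp only [Pi.div_apply]
    rw [div_div]
  · have := tendsto_exp_div_rpow_atTop (1 - z)
    refine this.congr' ?_
    filter_upwards [eventually_gt_atTop 0] with u hu
    rw [div_eq_mul_inv, ← Real.rpow_neg hu.le, neg_sub]

end IsRegularWeight

/-- Swapping the order of summation over the pairs `(n, j)` with `n * j ≤ x` and `x / T < n`. -/
theorem sum_filter_lt_mul_partialSum (a b : ℕ → ℝ) {x T : ℝ} (hx : 0 < x) (hT : 0 < T) :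
    ∑ n ∈ Finset.Ioc 0 ⌊x⌋₊ with x / T < (n : ℕ), a n * partialSum b (x / n) =
      ∑ j ∈ Finset.Ioc 0 ⌊T⌋₊, b j * (partialSum a (x / j) - partialSum a (x / T)) := by
  have h : ∀ j ∈ Finset.Ioc 0 ⌊T⌋₊, b j * (partialSum a (x / j) - partialSum a (x / T)) =
      ∑ n ∈ Finset.Ioc 0 ⌊x / j⌋₊ with x / T < (n : ℕ), a n * b j := by
    intro j hj
    have hj := mem_Ioc_floor hj
    have : x / T ≤ x / j := by
      have := hj.1
      gcongr
      exact hj.2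
    rw [← sum_filter_lt_eq_partialSum_sub a this, Finset.mul_sum]
    exact Finset.sum_congr rfl fun n _ => mul_comm _ _
  rw [Finset.sum_congr rfl h]
  simp only [partialSum, Finset.mul_sum]
  refine Finset.sum_comm' fun n j => ?_
  simp only [Finset.mem_filter, mem_Ioc_floor_iff]
  constructor
  · rintro ⟨⟨⟨h1, h2⟩, h3⟩, h4, h5⟩
    rw [le_div_iff₀ (by linarith)] at h5
    rw [div_lt_iff₀ hT] at h3
    refine ⟨⟨⟨h1, ?_⟩, ?_⟩, h4, ?_⟩
    · rw [le_div_iff₀ (by linarith)]; linarith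
    · rwa [div_lt_iff₀ hT]
    · by_contra hlt
      nlinarith
  · rintro ⟨⟨⟨h1, h2⟩, h3⟩, h4, h5⟩
    rw [le_div_iff₀ (by linarith)] at h2
    refine ⟨⟨⟨h1, ?_⟩, h3⟩, h4, ?_⟩
    · nlinarith
    · rw [le_div_iff₀ (by linarith)]; linarith

namespace IsRegularWeight

variable {g : ℕ → ℝ} {z ρ K : ℝ}

theorem exists_tendsto_truncated_sum (h : IsRegularWeight g z ρ K) (t : ℝ) :
    ∃ c, Tendsto (fun u => (∑ n ∈ Finset.Ioc 0 ⌊Real.exp u⌋₊ with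
      Real.exp u / Real.exp t < (n : ℕ), g n * (partialSum
        (fun n => g n * ArithmeticFunction.vonMangoldt n) (Real.exp u / n) -
          z * (Real.exp u / n))) / (Real.exp u * u ^ (z - 1))) atTop (nhds c) := by
  obtain ⟨A, c, hA, hL⟩ := h.exists_tendsto_partialSum_div
  have hS := h.exists_tendsto_partialSum hL
  set b : ℕ → ℝ := fun n => g n * ArithmeticFunction.vonMangoldt n with hb
  have h1 : Tendsto (fun u => ∑ j ∈ Finset.Ioc 0 ⌊Real.exp t⌋₊, b j *
      (partialSum g (Real.exp (u - Real.log j)) / (Real.exp u * u ^ (z - 1)) -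
        partialSum g (Real.exp (u - t)) / (Real.exp u * u ^ (z - 1)))) atTop
      (nhds (∑ j ∈ Finset.Ioc 0 ⌊Real.exp t⌋₊, b j *
        (z * A * Real.exp (-Real.log j) - z * A * Real.exp (-t)))) :=
    tendsto_finsetSum _ fun j _ =>
      ((tendsto_partialSum_exp_sub hS _).sub (tendsto_partialSum_exp_sub hS _)).const_mul _
  have h2 := (tendsto_partialSum_div_sub hL t).const_mul z
  by_cases ht : 0 ≤ t
  swap
  · refine ⟨0, tendsto_const_nhds.congr fun u => ?_⟩
    rw [Finset.sum_eq_zero, zero_div]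
    intro n hn
    rw [Finset.mem_filter, mem_Ioc_floor_iff] at hn
    exfalso
    have : Real.exp u ≤ Real.exp u / Real.exp t := by
      rw [← Real.exp_sub, Real.exp_le_exp]
      linarith
    linarith [hn.2, hn.1.2]
  refine ⟨_, (h1.sub h2).congr' ?_⟩
  filter_upwards [eventually_gt_atTop 0] with u hu
  have hp : 0 < u ^ (z - 1) := by positivity
  have hex := Real.exp_pos u
  have e0 : ∀ s : Finset ℕ, ∑ n ∈ s, g n * (partialSum b (Real.exp u / n) - z * (Real.exp u / n)) =
      ∑ n ∈ s, g n * partialSum b (Real.exp u / n) - ∑ n ∈ s, g n * (z * (Real.exp u / n)) :=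
    fun s => by simp only [mul_sub, Finset.sum_sub_distrib]
  rw [e0, sum_filter_lt_mul_partialSum _ _ hex (Real.exp_pos t)]
  have e1 : ∑ n ∈ Finset.Ioc 0 ⌊Real.exp u⌋₊ with Real.exp u / Real.exp t < (n : ℕ),
      g n * (z * (Real.exp u / n)) = z * Real.exp u *
      (partialSum (fun n => g n / n) (Real.exp u) -
        partialSum (fun n => g n / n) (Real.exp (u - t))) := by
    rw [Real.exp_sub, ← sum_filter_lt_eq_partialSum_sub, Finset.mul_sum]
    · exact Finset.sum_congr rfl fun n _ => by ring
    · rw [← Real.exp_sub, Real.exp_le_exp]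
      linarith
  rw [e1]
  refine Eq.trans ?_ (sub_div _ _ _).symm
  congr 1
  · rw [Finset.sum_div]
    refine Finset.sum_congr rfl fun j hj => ?_
    have hj := mem_Ioc_floor hj
    rw [Real.exp_sub, Real.exp_sub, Real.exp_log (by linarith)]
    ring
  · field_simp

theorem exists_tendsto_error_sum (h : IsRegularWeight g z ρ K) :
    ∃ d, Tendsto (fun u => (∑ n ∈ Finset.Ioc 0 ⌊Real.exp u⌋₊, g n * (partialSum
        (fun n => g n * ArithmeticFunction.vonMangoldt n) (Real.exp u / n) -
          z * (Real.exp u / n))) / (Real.exp u * u ^ (z - 1))) atTop (nhds d) := by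
  have hρ := h.rho_pos
  set R : ℝ → ℝ := fun y =>
    partialSum (fun n => g n * ArithmeticFunction.vonMangoldt n) y - z * y with hR
  obtain ⟨C, hC0, hC⟩ := h.exists_sum_filter_le (R := R) h.bound
  refine exists_tendsto_of_forall_exists_eventually_abs_sub_le fun ε hε => ?_
  have hτ : Tendsto (fun k₀ : ℕ => C * ∑' k : ℕ, (1 + ((k + k₀ : ℕ) : ℝ)) ^ (-(1 + ρ)))
      atTop (nhds 0) := by
    simpa using (tendsto_sum_nat_add fun k : ℕ => (1 + (k : ℝ)) ^ (-(1 + ρ))).const_mul C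
  have hu0 : Tendsto (fun u : ℝ => C * u ^ (-ρ)) atTop (nhds 0) := by
    simpa using (tendsto_rpow_neg_atTop hρ).const_mul C
  obtain ⟨k₀, hk₀, hk1⟩ :=
    (((tendsto_order.mp hτ).2 (ε / 3) (by positivity)).and (eventually_ge_atTop 1)).exists
  obtain ⟨c, hc⟩ := h.exists_tendsto_truncated_sum k₀
  refine ⟨c, ?_⟩
  filter_upwards [(tendsto_order.mp hu0).2 (ε / 3) (by positivity), eventually_ge_atTop 2,
    Metric.tendsto_nhds.mp hc (ε / 3) (by positivity)] with u h1 h2 h3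
  have hp : 0 < Real.exp u * u ^ (z - 1) := by positivity
  have h4 := hC k₀ (Real.exp u) (Real.exp_pos u) (by rwa [Real.log_exp])
  rw [Real.log_exp] at h4
  rw [Real.dist_eq] at h3
  have hfil : (Finset.Ioc 0 ⌊Real.exp u⌋₊).filter
      (fun n : ℕ => Real.exp u / Real.exp k₀ < n) =
      (Finset.Ioc 0 ⌊Real.exp u⌋₊).filter (fun n : ℕ => ¬ k₀ ≤ ⌊Real.log (Real.exp u / n)⌋₊) := by
    refine Finset.filter_congr fun n hn => ?_
    have hn := mem_Ioc_floor hn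
    have hn0 : (0 : ℝ) < n := by linarith
    rw [not_le, Nat.floor_lt' (by lia), Real.log_lt_iff_lt_exp (by positivity),
      div_lt_iff₀ (Real.exp_pos _), div_lt_iff₀ hn0, mul_comm]
  rw [hfil] at h3
  have hsplit := Finset.sum_filter_add_sum_filter_not (Finset.Ioc 0 ⌊Real.exp u⌋₊)
    (fun n : ℕ => k₀ ≤ ⌊Real.log (Real.exp u / n)⌋₊) (fun n => g n * R (Real.exp u / n))
  have h5 : |∑ n ∈ Finset.Ioc 0 ⌊Real.exp u⌋₊ with k₀ ≤ ⌊Real.log (Real.exp u / (n : ℕ))⌋₊,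
      g n * R (Real.exp u / n)| ≤ 2 * ε / 3 * (Real.exp u * u ^ (z - 1)) := by
    refine (Finset.abs_sum_le_sum_abs _ _).trans (le_trans (le_of_eq ?_) (h4.trans ?_))
    · refine Finset.sum_congr rfl fun n _ => ?_
      rw [abs_mul, abs_of_nonneg (h.nonneg n)]
    · gcongr
      rw [mul_add]
      linarith
  rw [← hsplit, add_div, add_sub_assoc]
  refine (abs_add_le _ _).trans ?_
  have h6 := (div_le_iff₀ hp).mpr h5
  rw [abs_div, abs_of_pos hp]
  linarith

theorem exists_tendsto_partialSum_sub_mul (h : IsRegularWeight g z ρ K) :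
    ∃ A c : ℝ, 0 < A ∧ Tendsto
      (fun u => (partialSum g (Real.exp u) / (Real.exp u * u ^ (z - 1)) - A) * u)
      atTop (nhds c) := by
  obtain ⟨A, c, hA, hL⟩ := h.exists_tendsto_partialSum_div
  have hS := h.exists_tendsto_partialSum hL
  have hM := tendsto_logMean_div hS
  obtain ⟨d, hd⟩ := h.exists_tendsto_error_sum
  have hz := h.density_pos
  refine ⟨z * A, _, by positivity, (((hL.const_mul z).add hd).add hM).congr' ?_⟩
  filter_upwards [eventually_gt_atTop 0] with u hu
  have hp : 0 < u ^ (z - 1) := by positivity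
  have hex := Real.exp_pos u
  have e : partialSum g (Real.exp u) = (u * partialSum g (Real.exp u)) / u := by field_simp
  rw [e, h.sum_mul_log_add]
  field_simp
  ring

end IsRegularWeight

open scoped Classical in
/-- The real-valued characteristic function of a predicate. -/
noncomputable def charFn (P : ℕ → Prop) (n : ℕ) : ℝ := if P n then 1 else 0

theorem charFn_of_pos {P : ℕ → Prop} {n : ℕ} (h : P n) : charFn P n = 1 := if_pos h

theorem charFn_of_neg {P : ℕ → Prop} {n : ℕ} (h : ¬ P n) : charFn P n = 0 := if_neg h

theorem charFn_nonneg (P : ℕ → Prop) (n : ℕ) : 0 ≤ charFn P n := by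
  unfold charFn; split_ifs <;> norm_num

theorem charFn_le_one (P : ℕ → Prop) (n : ℕ) : charFn P n ≤ 1 := by
  unfold charFn; split_ifs <;> norm_num

/-- The characteristic function of the integers all of whose prime factors satisfy `P`. -/
noncomputable def primeWeight (P : ℕ → Prop) : ℕ → ℝ :=
  charFn fun n => ∀ p, p.Prime → p ∣ n → P p

theorem primeWeight_one (P : ℕ → Prop) : primeWeight P 1 = 1 :=
  charFn_of_pos fun _ hp h => absurd (Nat.dvd_one.mp h) hp.ne_one

theorem primeWeight_mul (P : ℕ → Prop) (m n : ℕ) :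
    primeWeight P (m * n) = primeWeight P m * primeWeight P n := by
  have key : (∀ p, p.Prime → p ∣ m * n → P p) ↔
      (∀ p, p.Prime → p ∣ m → P p) ∧ ∀ p, p.Prime → p ∣ n → P p := by
    constructor
    · exact fun h => ⟨fun p hp hd => h p hp (hd.mul_right n), fun p hp hd => h p hp (hd.mul_left m)⟩
    · exact fun h p hp hd => (hp.dvd_mul.mp hd).elim (h.1 p hp) (h.2 p hp)
  unfold primeWeight charFn
  simp only [key]
  split_ifs <;> simp_all

theorem primeWeight_prime {P : ℕ → Prop} {p : ℕ} (hp : p.Prime) :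
    primeWeight P p = charFn P p := by
  by_cases h : P p
  · rw [charFn_of_pos h]
    refine charFn_of_pos fun q hq hd => ?_
    rwa [(Nat.prime_dvd_prime_iff_eq hq hp).mp hd]
  · rw [charFn_of_neg h]
    exact charFn_of_neg fun h' => h (h' p hp dvd_rfl)

theorem partialSum_mul_log_eq (b : ℕ → ℝ) {x : ℝ} (hx : 0 < x) :
    partialSum (fun n => b n * Real.log n) x =
      Real.log x * partialSum b x - logMean b (Real.log x) := by
  rw [logMean_eq, Real.exp_log hx]
  ring

theorem partialSum_mul_log_isBigO {b : ℕ → ℝ} {ρ : ℝ}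
    (h : partialSum b =O[atTop] fun x => x / Real.log x ^ (2 + ρ)) :
    (partialSum fun n => b n * Real.log n) =O[atTop] fun x => x / Real.log x ^ (1 + ρ) := by
  have h1 : (fun u => partialSum b (Real.exp u)) =O[atTop]
      fun u => Real.exp u * u ^ (-ρ - 1) * u⁻¹ := by
    refine (h.comp_tendsto Real.tendsto_exp_atTop).congr' (Eventually.of_forall fun u => rfl) ?_
    filter_upwards [eventually_gt_atTop 0] with u hu
    simp only [Function.comp_apply, Real.log_exp]
    rw [mul_assoc, ← Real.rpow_neg_one, ← Real.rpow_add hu, div_eq_mul_inv, ← Real.rpow_neg hu.le]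
    congr 2
    ring
  have h2 : (fun u => partialSum b (Real.exp u)) =o[atTop]
      fun u => Real.exp u * u ^ (-ρ - 1) := by
    refine h1.trans_isLittleO ?_
    have : (fun u : ℝ => u⁻¹) =o[atTop] fun _ => (1 : ℝ) :=
      (isLittleO_one_iff ℝ).mpr tendsto_inv_atTop_zero
    simpa using (isBigO_refl (fun u : ℝ => Real.exp u * u ^ (-ρ - 1)) atTop).mul_isLittleO this
  have h3 := IsRegularWeight.tendsto_logMean_div h2.tendsto_div_nhds_zero
  have h4 : logMean b =o[atTop] fun u => Real.exp u * u ^ (-ρ - 1) := by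
    refine (isLittleO_iff_tendsto' ?_).mpr h3
    filter_upwards [eventually_gt_atTop 0] with u hu h0
    have : 0 < Real.exp u * u ^ (-ρ - 1) := by positivity
    exact absurd h0 this.ne'
  have e : (fun x => x / Real.log x ^ (1 + ρ)) =ᶠ[atTop]
      (fun u => Real.exp u * u ^ (-ρ - 1)) ∘ Real.log := by
    filter_upwards [eventually_gt_atTop 1] with x hx
    have hl := Real.log_pos hx
    simp only [Function.comp_apply]
    rw [Real.exp_log (by linarith), div_eq_mul_inv, ← Real.rpow_neg hl.le]
    congr 2
    ring
  have h5 : (fun x => logMean b (Real.log x)) =O[atTop] fun x => x / Real.log x ^ (1 + ρ) :=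
    ((h4.isBigO.comp_tendsto Real.tendsto_log_atTop).trans_eventuallyEq e.symm)
  have h6 : (fun x => Real.log x * partialSum b x) =O[atTop] fun x => x / Real.log x ^ (1 + ρ) := by
    refine ((isBigO_refl Real.log atTop).mul h).congr' EventuallyEq.rfl ?_
    filter_upwards [eventually_gt_atTop 1] with x hx
    have hl := Real.log_pos hx
    rw [show 2 + ρ = (1 + ρ) + 1 by ring, Real.rpow_add_one hl.ne']
    field_simp
  refine (h6.sub h5).congr' ?_ EventuallyEq.rfl
  filter_upwards [eventually_gt_atTop 0] with x hx
  rw [partialSum_mul_log_eq b hx]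

theorem div_log_rpow_isBigO {p q : ℝ} (h : p ≤ q) :
    (fun x : ℝ => x / Real.log x ^ q) =O[atTop] fun x => x / Real.log x ^ p := by
  refine IsBigO.of_bound 1 ?_
  filter_upwards [eventually_ge_atTop (Real.exp 1)] with x hx
  have hx0 : 0 < x := (Real.exp_pos 1).trans_le hx
  have hl : 1 ≤ Real.log x := (Real.le_log_iff_exp_le hx0).mpr hx
  have hl0 : 0 < Real.log x := by linarith
  rw [Real.norm_of_nonneg (by positivity), Real.norm_of_nonneg (by positivity), one_mul]
  gcongr

theorem sqrt_mul_log_isBigO (p : ℝ) :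
    (fun x : ℝ => √x * Real.log x) =O[atTop] fun x => x / Real.log x ^ p := by
  have h := (isBigO_refl (fun x : ℝ => √x / Real.log x ^ p) atTop).mul
    (isLittleO_log_rpow_rpow_atTop (s := 1 / 2) (p + 1) (by norm_num)).isBigO
  refine h.congr' ?_ ?_
  · filter_upwards [eventually_gt_atTop 1] with x hx
    have hl := Real.log_pos hx
    rw [Real.rpow_add_one hl.ne']
    field_simp
  · filter_upwards [eventually_gt_atTop 1] with x hx
    rw [← Real.sqrt_eq_rpow, div_mul_eq_mul_div, Real.mul_self_sqrt (by linarith)]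

theorem exists_forall_abs_le_of_isBigO {f F : ℝ → ℝ} {p : ℝ} (hp : 0 ≤ p)
    (h : f =O[atTop] fun x => x / Real.log x ^ p) (hF : Monotone F)
    (hfF : ∀ y, 1 ≤ y → |f y| ≤ F y) :
    ∃ K, ∀ y, 1 ≤ y → |f y| ≤ K * (y * (1 + Real.log y) ^ (-p)) := by
  obtain ⟨C, hC0, hC⟩ := h.exists_pos
  obtain ⟨X, hX⟩ := eventually_atTop.mp hC.bound
  set Y := max X (Real.exp 1) with hY
  have hY0 : 0 < Y := (Real.exp_pos 1).trans_le (le_max_right _ _)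
  have hY1 : 1 ≤ Real.log Y := (Real.le_log_iff_exp_le hY0).mpr (le_max_right _ _)
  refine ⟨C * 2 ^ p + |F Y| * (1 + Real.log Y) ^ p, fun y hy => ?_⟩
  have hly := Real.log_nonneg hy
  have hw : 0 < y * (1 + Real.log y) ^ (-p) := by positivity
  rw [add_mul]
  rcases le_total Y y with hYy | hyY
  · have h1 := hX y ((le_max_left _ _).trans hYy)
    have hl : 1 ≤ Real.log y := hY1.trans (Real.log_le_log hY0 hYy)
    have hl0 : 0 < Real.log y := by linarith
    rw [Real.norm_eq_abs, Real.norm_of_nonneg (by positivity)] at h1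
    refine le_add_of_le_of_nonneg (h1.trans ?_) (by positivity)
    have h2 : Real.log y ^ (-p) ≤ ((1 + Real.log y) / 2) ^ (-p) :=
      Real.rpow_le_rpow_of_nonpos (by positivity) (by linarith) (by linarith)
    rw [Real.div_rpow (by positivity) (by norm_num), Real.rpow_neg (by norm_num : (0:ℝ) ≤ 2),
      div_inv_eq_mul] at h2
    rw [div_eq_mul_inv, ← Real.rpow_neg hl0.le]
    calc C * (y * Real.log y ^ (-p)) ≤ C * (y * ((1 + Real.log y) ^ (-p) * 2 ^ p)) := by gcongr
      _ = _ := by ring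
  · refine le_add_of_nonneg_of_le (by positivity) ?_
    have h1 : |f y| ≤ |F Y| := (hfF y hy).trans ((hF hyY).trans (le_abs_self _))
    refine h1.trans ?_
    have h2 : 1 ≤ (1 + Real.log Y) ^ p * (1 + Real.log y) ^ (-p) := by
      rw [Real.rpow_neg (by positivity), ← div_eq_mul_inv, one_le_div (by positivity)]
      gcongr
    calc |F Y| = |F Y| * (1 * 1) := by ring
      _ ≤ |F Y| * (y * ((1 + Real.log Y) ^ p * (1 + Real.log y) ^ (-p))) := by gcongr
      _ = _ := by ring

theorem partialSum_vonMangoldt (x : ℝ) :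
    partialSum (fun n => ArithmeticFunction.vonMangoldt n) x = Chebyshev.psi x := rfl

theorem theta_eq_partialSum (x : ℝ) :
    Chebyshev.theta x = partialSum (fun n => charFn Nat.Prime n * Real.log n) x := by
  rw [Chebyshev.theta, partialSum, Finset.sum_filter]
  refine Finset.sum_congr rfl fun n _ => ?_
  split_ifs with h
  · rw [charFn_of_pos h, one_mul]
  · rw [charFn_of_neg h, zero_mul]

theorem exists_isRegularWeight {P : ℕ → Prop} {ρ δ : ℝ} (hρ : 0 < ρ) (hδ : 0 < δ) (hδ1 : δ < 1)
    (hO : (fun x => partialSum (charFn fun q => q.Prime ∧ ¬ P q) x -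
      δ * partialSum (charFn Nat.Prime) x) =O[atTop] fun x => x / Real.log x ^ (2 + ρ)) :
    ∃ ρ' K, IsRegularWeight (primeWeight P) (1 - δ) ρ' K := by
  set b : ℕ → ℝ := fun n => charFn (fun q => q.Prime ∧ ¬ P q) n - δ * charFn Nat.Prime n with hb
  have hb1 : partialSum b =O[atTop] fun x => x / Real.log x ^ (2 + ρ) := by
    refine hO.congr_left fun x => ?_
    rw [hb, partialSum, partialSum, partialSum, Finset.mul_sum, Finset.sum_sub_distrib]
  have hb2 := partialSum_mul_log_isBigO hb1
  set Λ : ℕ → ℝ := fun n => ArithmeticFunction.vonMangoldt n with hΛ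
  set e : ℕ → ℝ := fun n => primeWeight P n * Λ n - (1 - δ) * Λ n + b n * Real.log n with he
  have hen : ∀ n, |e n| ≤ Λ n - charFn Nat.Prime n * Real.log n := by
    intro n
    by_cases hn : n.Prime
    · have h1 : Λ n = Real.log n := ArithmeticFunction.vonMangoldt_apply_prime hn
      have h2 : b n = 1 - charFn P n - δ := by
        rw [hb]
        beta_reduce
        rw [charFn_of_pos hn]
        by_cases hPn : P n
        · rw [charFn_of_pos hPn, charFn_of_neg (by tauto)]; ring
        · rw [charFn_of_neg hPn, charFn_of_pos ⟨hn, hPn⟩]; ring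
      rw [he]
      beta_reduce
      rw [primeWeight_prime hn, h1, h2, charFn_of_pos hn]
      ring_nf
      simp
    · have h2 : b n = 0 := by
        rw [hb]
        beta_reduce
        rw [charFn_of_neg hn, charFn_of_neg (by tauto)]
        ring
      have h3 : 0 ≤ Λ n := ArithmeticFunction.vonMangoldt_nonneg
      have h4 := charFn_nonneg (fun n => ∀ p, p.Prime → p ∣ n → P p) n
      have h5 := charFn_le_one (fun n => ∀ p, p.Prime → p ∣ n → P p) n
      rw [he]
      beta_reduce
      rw [h2, charFn_of_neg hn, zero_mul, add_zero, sub_zero, ← sub_mul, abs_mul,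
        abs_of_nonneg h3]
      refine mul_le_of_le_one_left h3 (abs_le.mpr ?_)
      rw [primeWeight]
      constructor <;> linarith
  have he1 : partialSum e =O[atTop] fun x => √x * Real.log x := by
    refine IsBigO.of_bound 2 ?_
    filter_upwards [eventually_ge_atTop 1] with x hx
    have hl := Real.log_nonneg hx
    have h1 : |partialSum e x| ≤ Chebyshev.psi x - Chebyshev.theta x := by
      rw [theta_eq_partialSum, ← partialSum_vonMangoldt, partialSum, partialSum, partialSum,
        ← Finset.sum_sub_distrib]
      exact (Finset.abs_sum_le_sum_abs _ _).trans (Finset.sum_le_sum fun n _ => hen n)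
    rw [Real.norm_eq_abs, Real.norm_of_nonneg (by positivity), ← mul_assoc]
    exact h1.trans ((le_abs_self _).trans (Chebyshev.abs_psi_sub_theta_le_sqrt_mul_log hx))
  set ρ' := min ρ (1 / 3) with hρ'
  have hρ0 : 0 < ρ' := lt_min hρ (by norm_num)
  have hr1 : ρ' ≤ ρ := min_le_left _ _
  have hr2 : ρ' ≤ 1 / 3 := min_le_right _ _
  have hf : (fun y => partialSum (fun n => primeWeight P n * Λ n) y - (1 - δ) * y) =O[atTop]
      fun x => x / Real.log x ^ (1 + ρ') := by
    have t1 := (psi_sub_id_isBigO.trans (div_log_rpow_isBigO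
      (by linarith : 1 + ρ' ≤ 4 / 3))).const_mul_left (1 - δ)
    have t2 := hb2.trans (div_log_rpow_isBigO (by linarith : 1 + ρ' ≤ 1 + ρ))
    have t3 := he1.trans (sqrt_mul_log_isBigO (1 + ρ'))
    refine ((t1.sub t2).add t3).congr_left fun x => ?_
    rw [← partialSum_vonMangoldt, he]
    simp only [partialSum, Finset.sum_add_distrib, Finset.sum_sub_distrib, ← Finset.mul_sum]
    ring
  have hg0 : ∀ n, 0 ≤ primeWeight P n := charFn_nonneg _
  have hg1 : ∀ n, primeWeight P n ≤ 1 := charFn_le_one _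
  obtain ⟨K, hK⟩ := exists_forall_abs_le_of_isBigO (F := fun y => Chebyshev.psi y + (1 - δ) * y)
    (by linarith) hf (fun x y hxy => by
      have := Chebyshev.psi_mono hxy
      have : (1 - δ) * x ≤ (1 - δ) * y := by gcongr
      simp only
      linarith) (fun y hy => by
      refine (abs_sub _ _).trans (add_le_add ?_ ?_)
      · rw [abs_of_nonneg (partialSum_nonneg (fun n => mul_nonneg (hg0 n)
          ArithmeticFunction.vonMangoldt_nonneg) _)]
        refine Finset.sum_le_sum fun n _ => ?_
        exact mul_le_of_le_one_left ArithmeticFunction.vonMangoldt_nonneg (hg1 n)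
      · rw [abs_of_nonneg]
        exact mul_nonneg (by linarith) (by linarith))
  exact ⟨ρ', K, primeWeight_one P, primeWeight_mul P, hg0, hg1, by linarith, by linarith, hρ0, hK⟩

theorem rpow_ratio_bounds {u t p : ℝ} (hp0 : -1 ≤ p) (hp1 : p ≤ 0) (hu : 0 < u) (ht : 0 ≤ t)
    (htu : t ≤ u / 2) : 1 ≤ ((u - t) / u) ^ p ∧ ((u - t) / u) ^ p ≤ 2 ∧
      (((u - t) / u) ^ p - 1) * u ≤ 2 * t := by
  have hv : 0 < u - t := by linarith
  have hr1 : (u - t) / u ≤ 1 := by rw [div_le_one hu]; linarith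
  have hr0 : 0 < (u - t) / u := by positivity
  have h1 : ((u - t) / u) ^ p ≤ u / (u - t) := by
    have := Real.rpow_le_rpow_of_exponent_ge hr0 hr1 hp0
    rwa [Real.rpow_neg_one, inv_div] at this
  have h2 : u / (u - t) ≤ 2 := by rw [div_le_iff₀ hv]; linarith
  refine ⟨Real.one_le_rpow_of_pos_of_le_one_of_nonpos hr0 hr1 hp1, h1.trans h2, ?_⟩
  calc (((u - t) / u) ^ p - 1) * u ≤ (u / (u - t) - 1) * u := by gcongr
    _ = t * (u / (u - t)) := by field_simp; ring
    _ ≤ t * 2 := by gcongr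
    _ = 2 * t := mul_comm _ _

theorem exists_eventually_forall_abs_shift_le {S : ℝ → ℝ} {p A c : ℝ} (hp0 : -1 ≤ p) (hp1 : p ≤ 0)
    (hS0 : ∀ y, 0 ≤ y → |S y| ≤ y)
    (hS : Tendsto (fun u => (S (Real.exp u) / (Real.exp u * u ^ p) - A) * u) atTop (nhds c)) :
    ∃ C, 0 ≤ C ∧ ∀ᶠ u in atTop, ∀ d : ℕ, 1 ≤ d →
      |(S (Real.exp u / d) / (Real.exp u * u ^ p) - A / d) * u| ≤
        C * ((1 + Real.log d) ^ 2 / d) := by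
  have hB : ∀ᶠ v in atTop, |(S (Real.exp v) / (Real.exp v * v ^ p) - A) * v| < |c| + 1 :=
    (tendsto_order.mp hS.abs).2 _ (by linarith)
  obtain ⟨V, hV⟩ := eventually_atTop.mp hB
  set B := |c| + 1 with hBdef
  have hB0 : 0 < B := by positivity
  refine ⟨4 * B + 2 * |A| + 4, by positivity, ?_⟩
  filter_upwards [eventually_ge_atTop 1, eventually_ge_atTop (2 * V)] with u hu1 huV d hd
  have hu : 0 < u := by linarith
  have hd0 : (1 : ℝ) ≤ d := by exact_mod_cast hd
  have hd0' : (0 : ℝ) < d := by linarith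
  set t := Real.log d with ht
  have ht0 : 0 ≤ t := Real.log_nonneg hd0
  have hex := Real.exp_pos u
  have hA := abs_nonneg A
  rw [← mul_div_assoc, le_div_iff₀ hd0']
  rcases le_or_gt t (u / 2) with h | h
  · obtain ⟨h1, h2, h3⟩ := rpow_ratio_bounds hp0 hp1 hu ht0 h
    have hv : 0 < u - t := by linarith
    have e1 : Real.exp u / d = Real.exp (u - t) := by rw [Real.exp_sub, Real.exp_log hd0']
    have e2 : Real.exp u = Real.exp (u - t) * d := by rw [← e1]; field_simp
    set r := ((u - t) / u) ^ p with hr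
    have e3 : (u - t) ^ p = r * u ^ p := by
      rw [hr, Real.div_rpow hv.le hu.le]; field_simp
    have hup : 0 < u ^ p := by positivity
    have hX := (hV (u - t) (by linarith)).le
    rw [e3] at hX
    rw [e1, e2]
    set X := S (Real.exp (u - t)) / (Real.exp (u - t) * (r * u ^ p)) - A with hXdef
    have hex' := Real.exp_pos (u - t)
    have hr0 : 0 < r := by linarith
    have e4 : (S (Real.exp (u - t)) / (Real.exp (u - t) * d * u ^ p) - A / d) * u =
        (X * u * r + A * ((r - 1) * u)) / d := by
      rw [hXdef]
      field_simp
      ring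
    rw [e4, abs_div, abs_of_pos hd0', div_mul_cancel₀ _ hd0'.ne']
    rw [abs_mul, abs_of_pos hv] at hX
    have h4 : |X| * u ≤ 2 * B := by
      have : |X| * (u / 2) ≤ |X| * (u - t) := by gcongr; linarith
      linarith
    refine (abs_add_le _ _).trans ?_
    rw [abs_mul (X * u), abs_mul X, abs_mul A, abs_of_pos hu, abs_of_pos hr0,
      abs_of_nonneg (mul_nonneg (by linarith) hu.le)]
    have h5 : |X| * u * r ≤ 2 * B * 2 := by gcongr
    have h6 : |A| * ((r - 1) * u) ≤ |A| * (2 * t) := by gcongr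
    have h7 : 0 ≤ B * t := by positivity
    have h8 : 0 ≤ B * t ^ 2 := by positivity
    have h9 : 0 ≤ |A| * t := by positivity
    have h10 : 0 ≤ |A| * t ^ 2 := by positivity
    nlinarith
  · have h1 := hS0 (Real.exp u / d) (by positivity)
    have h2 : |S (Real.exp u / d) / (Real.exp u * u ^ p)| ≤ u / d := by
      rw [abs_div, abs_of_pos (by positivity : 0 < Real.exp u * u ^ p),
        div_le_div_iff₀ (by positivity) hd0']
      have h3 : 1 ≤ u * u ^ p := by
        have := Real.rpow_le_rpow_of_exponent_le hu1 hp0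
        calc 1 = u * u ^ (-1 : ℝ) := by rw [Real.rpow_neg_one]; field_simp
          _ ≤ u * u ^ p := by gcongr
      calc |S (Real.exp u / d)| * d ≤ Real.exp u / d * d := by gcongr
        _ = Real.exp u * 1 := by field_simp
        _ ≤ Real.exp u * (u * u ^ p) := by gcongr
        _ = _ := by ring
    have h4 :
        |(S (Real.exp u / d) / (Real.exp u * u ^ p) - A / d) * u| ≤ (u / d + |A| / d) * u := by
      rw [abs_mul, abs_of_pos hu]
      gcongr
      refine (abs_sub _ _).trans (add_le_add h2 (le_of_eq ?_))
      rw [abs_div, abs_of_pos hd0']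
    calc _ ≤ (u / d + |A| / d) * u * d := by gcongr
      _ = u * u + |A| * u := by field_simp
      _ ≤ (2 * t) * (2 * t) + |A| * (2 * t) := by gcongr <;> linarith
      _ ≤ _ := by
        have h7 : 0 ≤ B * (1 + t) ^ 2 := by positivity
        have h9 : 0 ≤ |A| * t := by positivity
        have h10 : 0 ≤ |A| * t ^ 2 := by positivity
        nlinarith

theorem tendsto_shift {S : ℝ → ℝ} {p A c : ℝ}
    (hS : Tendsto (fun u => (S (Real.exp u) / (Real.exp u * u ^ p) - A) * u) atTop (nhds c))
    {d : ℕ} (hd : 1 ≤ d) :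
    Tendsto (fun u => (S (Real.exp u / d) / (Real.exp u * u ^ p) - A / d) * u) atTop
      (nhds ((c - A * (p * Real.log d)) / d)) := by
  have hd0 : (1 : ℝ) ≤ d := by exact_mod_cast hd
  have hd0' : (0 : ℝ) < d := by linarith
  set t := Real.log d with ht
  have htend : Tendsto (fun u : ℝ => u - t) atTop atTop :=
    tendsto_atTop_add_const_right _ _ tendsto_id
  have h1 := (hS.comp htend).mul (tendsto_sub_rpow_div_rpow t (p - 1))
  have h2 := ((rpow_sub_isLittleO t p).tendsto_div_nhds_zero.sub_const (p * t)).const_mul A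
  have h3 := (h1.add h2).div_const (d : ℝ)
  rw [mul_one, zero_sub, mul_neg, ← sub_eq_add_neg] at h3
  refine h3.congr' ?_
  filter_upwards [eventually_gt_atTop 0, eventually_gt_atTop t] with u hu hut
  have hv : 0 < u - t := by linarith
  have e1 : Real.exp u / d = Real.exp (u - t) := by rw [Real.exp_sub, Real.exp_log hd0']
  have e2 : Real.exp u = Real.exp (u - t) * d := by rw [← e1]; field_simp
  rw [e1, e2]
  have hex := Real.exp_pos (u - t)
  have hq : 0 < u ^ (p - 1) := by positivity
  have hr : 0 < (u - t) ^ (p - 1) := by positivity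
  have e3 : u ^ p = u ^ (p - 1) * u := by rw [← Real.rpow_add_one hu.ne', sub_add_cancel]
  have e4 : (u - t) ^ p = (u - t) ^ (p - 1) * (u - t) := by
    rw [← Real.rpow_add_one hv.ne', sub_add_cancel]
  simp only [Function.comp_apply]
  rw [e3, e4]
  field_simp
  ring

/-- Dirichlet convolution with a sufficiently small function preserves two-term asymptotics. -/
theorem exists_tendsto_tsum_mul {S : ℝ → ℝ} {h : ℕ → ℝ} {p A c : ℝ} (hp0 : -1 ≤ p) (hp1 : p ≤ 0)
    (hS0 : ∀ y, 0 ≤ y → |S y| ≤ y)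
    (hS : Tendsto (fun u => (S (Real.exp u) / (Real.exp u * u ^ p) - A) * u) atTop (nhds c))
    (hS1 : ∀ y, y < 1 → S y = 0) (h0 : h 0 = 0)
    (hsum : Summable fun d : ℕ => |h d| * ((1 + Real.log d) ^ 2 / d)) :
    ∃ c', Tendsto (fun u => ((∑ d ∈ Finset.Ioc 0 ⌊Real.exp u⌋₊, h d * S (Real.exp u / d)) /
      (Real.exp u * u ^ p) - A * ∑' d : ℕ, h d / d) * u) atTop (nhds c') := by
  obtain ⟨C, hC0, hC⟩ := exists_eventually_forall_abs_shift_le hp0 hp1 hS0 hS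
  have hdiv : Summable fun d : ℕ => h d / d := by
    refine Summable.of_norm_bounded hsum fun d => ?_
    rcases Nat.eq_zero_or_pos d with rfl | hd
    · simp
    have hd0 : (1 : ℝ) ≤ d := by exact_mod_cast hd
    have := Real.log_nonneg hd0
    rw [norm_div, Real.norm_eq_abs, Real.norm_of_nonneg (by linarith), div_eq_mul_one_div]
    gcongr
    nlinarith
  have hlim := tendsto_tsum_of_dominated_convergence (𝓕 := atTop)
    (f := fun u d => h d * ((S (Real.exp u / d) / (Real.exp u * u ^ p) - A / d) * u))
    (g := fun d : ℕ => h d * ((c - A * (p * Real.log d)) / d))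
    (hsum.mul_left C) (fun d => by
      rcases Nat.eq_zero_or_pos d with rfl | hd
      · simp [h0]
      · exact (tendsto_shift hS hd).const_mul _)
    (by
      filter_upwards [hC] with u hu d
      rcases Nat.eq_zero_or_pos d with rfl | hd
      · simp [h0]
      · rw [norm_mul, Real.norm_eq_abs, Real.norm_eq_abs, mul_left_comm]
        gcongr
        exact hu d hd)
  refine ⟨_, hlim.congr' ?_⟩
  filter_upwards [eventually_gt_atTop 0] with u hu
  have hs : HasSum (fun d : ℕ => h d * S (Real.exp u / d))
      (∑ d ∈ Finset.Ioc 0 ⌊Real.exp u⌋₊, h d * S (Real.exp u / d)) := by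
    refine hasSum_sum_of_ne_finset_zero fun d hd => ?_
    rcases Nat.eq_zero_or_pos d with rfl | hd1
    · rw [h0, zero_mul]
    · have hd0 : (1 : ℝ) ≤ d := by exact_mod_cast hd1
      rw [mem_Ioc_floor_iff, not_and, not_le] at hd
      rw [hS1 _ ((div_lt_one (by linarith)).mpr (hd hd0)), mul_zero]
  have h1 := ((hs.div_const (Real.exp u * u ^ p)).sub (hdiv.hasSum.mul_left A)).mul_right u
  rw [← h1.tsum_eq]
  refine tsum_congr fun d => ?_
  ring

open ArithmeticFunction in
/-- The Dirichlet quotient of `a` by the completely multiplicative function `G`. -/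
noncomputable def mulQuotient (a G : ArithmeticFunction ℝ) : ArithmeticFunction ℝ :=
  (((ArithmeticFunction.moebius : ArithmeticFunction ℤ) : ArithmeticFunction ℝ).pmul G) * a

section Quotient

open ArithmeticFunction

variable {a G : ArithmeticFunction ℝ}

theorem pmul_moebius_mul_self (hG : ∀ m n, G (m * n) = G m * G n) (hG1 : G 1 = 1) :
    ((moebius : ArithmeticFunction ℤ) : ArithmeticFunction ℝ).pmul G * G = 1 := by
  ext n
  have h := congrArg (fun f : ArithmeticFunction ℝ => G n * f n)
    (coe_moebius_mul_coe_zeta (R := ℝ))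
  simp only [mul_apply, Finset.mul_sum] at h
  rw [mul_apply]
  refine Eq.trans (Finset.sum_congr rfl fun x hx => ?_) (h.trans ?_)
  · have hx' := Nat.mem_divisorsAntidiagonal.mp hx
    have hx2 : x.2 ≠ 0 := (Nat.ne_zero_of_mem_divisorsAntidiagonal hx).2
    rw [← hx'.1, hG, pmul_apply, natCoe_apply, zeta_apply_ne hx2]
    simp
    ring
  · rcases eq_or_ne n 1 with rfl | hn
    · simp [hG1]
    · simp [one_apply_ne hn]

theorem mulQuotient_mul (hG : ∀ m n, G (m * n) = G m * G n) (hG1 : G 1 = 1) :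
    mulQuotient a G * G = a := by
  rw [mulQuotient, mul_assoc, mul_comm a, ← mul_assoc, pmul_moebius_mul_self hG hG1, one_mul]

theorem isMultiplicative_mulQuotient (ha : a.IsMultiplicative)
    (hG : ∀ m n, G (m * n) = G m * G n) (hG1 : G 1 = 1) : (mulQuotient a G).IsMultiplicative :=
  (isMultiplicative_moebius.intCast.pmul ⟨hG1, fun _ => hG _ _⟩).mul ha

theorem mulQuotient_prime_pow_succ (hG1 : G 1 = 1) {p : ℕ} (hp : p.Prime) (k : ℕ) :
    mulQuotient a G (p ^ (k + 1)) = a (p ^ (k + 1)) - G p * a (p ^ k) := by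
  rw [mulQuotient, mul_apply, Nat.sum_divisorsAntidiagonal fun i j => (((moebius :
    ArithmeticFunction ℤ) : ArithmeticFunction ℝ).pmul G) i * a j,
    Nat.sum_divisors_prime_pow hp, Finset.sum_range_succ', Finset.sum_range_succ',
    Finset.sum_eq_zero]
  · have e : p ^ (k + 1) / p = p ^ k := by rw [pow_succ, Nat.mul_div_cancel _ hp.pos]
    simp [hG1, moebius_apply_prime hp, e]
    ring
  · intro i _
    rw [pmul_apply, intCoe_apply, moebius_apply_prime_pow hp (by lia), if_neg (by lia)]
    simp

/-- The hypotheses on a multiplicative function `a` and a completely multiplicative function `G`,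
both with values in `[0, 1]` and agreeing on primes. -/
structure AgreeOnPrimes (a G : ArithmeticFunction ℝ) : Prop where
  isMultiplicative : a.IsMultiplicative
  map_mul : ∀ m n, G (m * n) = G m * G n
  map_one : G 1 = 1
  nonneg : ∀ n, 0 ≤ a n
  le_one : ∀ n, a n ≤ 1
  nonneg' : ∀ n, 0 ≤ G n
  le_one' : ∀ n, G n ≤ 1
  eq_prime : ∀ p, p.Prime → a p = G p

namespace AgreeOnPrimes

theorem isMultiplicative_mulQuotient (h : AgreeOnPrimes a G) : (mulQuotient a G).IsMultiplicative :=
  LandauCount.isMultiplicative_mulQuotient h.isMultiplicative h.map_mul h.map_one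

theorem mulQuotient_prime (h : AgreeOnPrimes a G) {p : ℕ} (hp : p.Prime) :
    mulQuotient a G p = 0 := by
  have := mulQuotient_prime_pow_succ (a := a) h.map_one hp 0
  simpa [h.isMultiplicative.1, h.eq_prime p hp] using this

theorem abs_mulQuotient_prime_pow_le (h : AgreeOnPrimes a G) {p : ℕ} (hp : p.Prime) (k : ℕ) :
    |mulQuotient a G (p ^ k)| ≤ 1 := by
  cases k with
  | zero => rw [pow_zero, h.isMultiplicative_mulQuotient.1, abs_one]
  | succ k =>
    rw [mulQuotient_prime_pow_succ h.map_one hp]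
    have h1 := h.nonneg (p ^ (k + 1))
    have h2 := h.le_one (p ^ (k + 1))
    have h3 : 0 ≤ G p * a (p ^ k) := mul_nonneg (h.nonneg' p) (h.nonneg _)
    have h4 : G p * a (p ^ k) ≤ 1 := mul_le_one₀ (h.le_one' p) (h.nonneg _) (h.le_one _)
    rw [abs_le]
    constructor <;> linarith

theorem abs_mulQuotient_le (h : AgreeOnPrimes a G) (n : ℕ) : |mulQuotient a G n| ≤ 1 := by
  rcases eq_or_ne n 0 with rfl | hn
  · simp
  rw [h.isMultiplicative_mulQuotient.multiplicative_factorization _ hn, Finsupp.prod,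
    Finset.abs_prod]
  exact Finset.prod_le_one (fun _ _ => abs_nonneg _) fun p hp =>
    h.abs_mulQuotient_prime_pow_le (Nat.prime_of_mem_primeFactors hp) _

theorem sq_dvd_of_mulQuotient_ne_zero (h : AgreeOnPrimes a G) {n p : ℕ}
    (hn : mulQuotient a G n ≠ 0) (hp : p.Prime) (hpn : p ∣ n) : p ^ 2 ∣ n := by
  by_contra hsq
  obtain ⟨m, rfl⟩ := hpn
  have hcop : p.Coprime m := by
    rw [hp.coprime_iff_not_dvd]
    intro hd
    exact hsq (by rw [sq]; exact Nat.mul_dvd_mul_left p hd)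
  rw [h.isMultiplicative_mulQuotient.map_mul_of_coprime hcop, h.mulQuotient_prime hp,
    zero_mul] at hn
  exact hn rfl

end AgreeOnPrimes

end Quotient

theorem exists_eq_pow_three_mul_sq {n : ℕ} (hn : n ≠ 0)
    (h : ∀ p, p.Prime → p ∣ n → p ^ 2 ∣ n) : ∃ x : ℕ × ℕ, x.1 ^ 3 * x.2 ^ 2 = n := by
  obtain ⟨b, c, rfl, hb⟩ := Nat.sq_mul_squarefree n
  have hp : ∀ p ∈ b.primeFactors, p ∣ c := by
    intro p hp
    have hpp := Nat.prime_of_mem_primeFactors hp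
    obtain ⟨m, rfl⟩ := Nat.dvd_of_mem_primeFactors hp
    have h1 := h p hpp (by rw [mul_left_comm]; exact dvd_mul_right _ _)
    rw [sq, mul_left_comm] at h1
    rcases hpp.dvd_mul.mp (Nat.dvd_of_mul_dvd_mul_left hpp.pos h1) with h2 | h2
    · exact hpp.dvd_of_dvd_pow h2
    · exact absurd (hb p (Nat.mul_dvd_mul_left p h2)) (by rw [Nat.isUnit_iff]; exact hpp.ne_one)
  have hbc : b ∣ c := by
    rw [← Nat.prod_primeFactors_of_squarefree hb]
    exact Finset.prod_primes_dvd c (fun p hp => (Nat.prime_of_mem_primeFactors hp).prime) hp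
  obtain ⟨d, rfl⟩ := hbc
  exact ⟨(b, d), by ring⟩

theorem summable_mul_rpow_of_squarefull {f : ℕ → ℝ} (hf0 : f 0 = 0) (hf : ∀ n, |f n| ≤ 1)
    (hsq : ∀ n p, f n ≠ 0 → p.Prime → p ∣ n → p ^ 2 ∣ n) {s : ℝ} (hs : 1 / 2 < s) :
    Summable fun n : ℕ => |f n| * (n : ℝ) ^ (-s) := by
  have h1 : Summable fun x : ℕ × ℕ => (x.1 : ℝ) ^ (-(3 * s)) * (x.2 : ℝ) ^ (-(2 * s)) :=
    (Real.summable_nat_rpow.mpr (by linarith)).mul_of_nonneg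
      (Real.summable_nat_rpow.mpr (by linarith)) (fun n => by positivity) fun n => by positivity
  have h2 : ∀ n : {n : ℕ // f n ≠ 0}, ∃ x : ℕ × ℕ, x.1 ^ 3 * x.2 ^ 2 = (n : ℕ) := fun n =>
    exists_eq_pow_three_mul_sq (fun h0 => n.2 (by rw [h0, hf0])) fun p => hsq n p n.2
  choose φ hφ using h2
  have hinj : Function.Injective φ := fun m n hmn => Subtype.ext (by rw [← hφ m, ← hφ n, hmn])
  have h3 : Summable fun n : {n : ℕ // f n ≠ 0} => |f n| * ((n : ℕ) : ℝ) ^ (-s) := by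
    refine Summable.of_nonneg_of_le (fun n => by positivity) (fun n => ?_)
      (h1.comp_injective hinj)
    have e : ((n : ℕ) : ℝ) ^ (-s) =
        ((φ n).1 : ℝ) ^ (-(3 * s)) * ((φ n).2 : ℝ) ^ (-(2 * s)) := by
      rw [← hφ n]
      push_cast
      rw [Real.mul_rpow (by positivity) (by positivity), ← Real.rpow_natCast,
        ← Real.rpow_natCast, ← Real.rpow_mul (by positivity), ← Real.rpow_mul (by positivity)]
      congr 2 <;> push_cast <;> ring
    simp only [Function.comp_apply]
    rw [e]
    exact mul_le_of_le_one_left (by positivity) (hf n)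
  have h4 := (summable_subtype_iff_indicator (s := {n | f n ≠ 0})
    (f := fun n : ℕ => |f n| * (n : ℝ) ^ (-s))).mp h3
  refine h4.congr fun n => ?_
  by_cases hn : f n = 0
  · simp [hn]
  · rw [Set.indicator_of_mem (show n ∈ {n | f n ≠ 0} from hn)]

section Quotient

open ArithmeticFunction

variable {a G : ArithmeticFunction ℝ}

namespace AgreeOnPrimes

theorem summable_abs_mulQuotient_mul_rpow (h : AgreeOnPrimes a G) {s : ℝ} (hs : 1 / 2 < s) :
    Summable fun n : ℕ => |mulQuotient a G n| * (n : ℝ) ^ (-s) :=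
  summable_mul_rpow_of_squarefull (ArithmeticFunction.map_zero) h.abs_mulQuotient_le
    (fun _ _ => h.sq_dvd_of_mulQuotient_ne_zero) hs

theorem summable_abs_mulQuotient_mul_log_sq (h : AgreeOnPrimes a G) :
    Summable fun d : ℕ => |mulQuotient a G d| * ((1 + Real.log d) ^ 2 / d) := by
  refine Summable.of_nonneg_of_le (fun d => by positivity) (fun d => ?_)
    ((h.summable_abs_mulQuotient_mul_rpow (s := 3 / 4) (by norm_num)).mul_left 81)
  rcases Nat.eq_zero_or_pos d with rfl | hd
  · simp
  have hd0 : (1 : ℝ) ≤ d := by exact_mod_cast hd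
  have hd0' : (0 : ℝ) < d := by linarith
  have hl := Real.log_nonneg hd0
  have h1 : 1 + Real.log d ≤ 9 * (d : ℝ) ^ (1 / 8 : ℝ) := by
    have h2 := Real.log_le_rpow_div hd0'.le (by norm_num : (0 : ℝ) < 1 / 8)
    have h3 := Real.one_le_rpow hd0 (by norm_num : (0 : ℝ) ≤ 1 / 8)
    linarith
  have h4 : (1 + Real.log d) ^ 2 / d ≤ 81 * (d : ℝ) ^ (-(3 / 4) : ℝ) := by
    rw [div_le_iff₀ hd0']
    calc (1 + Real.log d) ^ 2 ≤ (9 * (d : ℝ) ^ (1 / 8 : ℝ)) ^ 2 := by gcongr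
      _ = 81 * (d : ℝ) ^ (-(3 / 4) + 1 : ℝ) := by
        rw [mul_pow, ← Real.rpow_natCast, ← Real.rpow_natCast, ← Real.rpow_mul hd0'.le]
        norm_num
      _ = _ := by rw [Real.rpow_add_one hd0'.ne', mul_assoc]
  calc _ ≤ |mulQuotient a G d| * (81 * (d : ℝ) ^ (-(3 / 4) : ℝ)) := by gcongr
    _ = _ := by ring

theorem summable_norm_mulQuotient_div (h : AgreeOnPrimes a G) :
    Summable fun n : ℕ => ‖mulQuotient a G n / n‖ := by
  refine (h.summable_abs_mulQuotient_mul_rpow (s := 1) (by norm_num)).congr fun n => ?_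
  rw [norm_div, Real.rpow_neg_one, Real.norm_eq_abs, Real.norm_of_nonneg (Nat.cast_nonneg n),
    div_eq_mul_inv]

theorem tsum_mulQuotient_prime_pow_pos (h : AgreeOnPrimes a G) {p : ℕ} (hp : p.Prime) :
    0 < ∑' e : ℕ, mulQuotient a G (p ^ e) / ((p ^ e : ℕ) : ℝ) := by
  have hp2 : (2 : ℝ) ≤ p := by exact_mod_cast hp.two_le
  have hp0 : (0 : ℝ) < p := by linarith
  have hA : Summable fun e : ℕ => a (p ^ e) / (p : ℝ) ^ e := by
    refine Summable.of_nonneg_of_le (fun e => div_nonneg (h.nonneg _) (by positivity))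
      (fun e => ?_) (summable_geometric_of_lt_one (r := (p : ℝ)⁻¹) (by positivity)
        (inv_lt_one_of_one_lt₀ (by linarith)))
    rw [inv_pow, ← one_div]
    gcongr
    exact h.le_one _
  have hsum : Summable fun e : ℕ => mulQuotient a G (p ^ e) / ((p ^ e : ℕ) : ℝ) :=
    h.summable_norm_mulQuotient_div.of_norm.comp_injective (Nat.pow_right_injective hp.two_le)
  have hA0 := hA.tsum_eq_zero_add
  rw [pow_zero, pow_zero, h.isMultiplicative.1, div_one] at hA0
  have hA1 : 0 ≤ ∑' e : ℕ, a (p ^ (e + 1)) / (p : ℝ) ^ (e + 1) :=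
    tsum_nonneg fun e => div_nonneg (h.nonneg _) (by positivity)
  have hstep : ∀ e : ℕ, mulQuotient a G (p ^ (e + 1)) / ((p ^ (e + 1) : ℕ) : ℝ) =
      a (p ^ (e + 1)) / (p : ℝ) ^ (e + 1) - G p / p * (a (p ^ e) / (p : ℝ) ^ e) := by
    intro e
    rw [mulQuotient_prime_pow_succ h.map_one hp]
    push_cast
    rw [pow_succ (p : ℝ) e]
    field_simp
  rw [hsum.tsum_eq_zero_add, pow_zero, h.isMultiplicative_mulQuotient.1, tsum_congr hstep,
    ((summable_nat_add_iff 1).mpr hA).tsum_sub (hA.mul_left _), tsum_mul_left, Nat.cast_one,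
    div_one]
  have e : ∀ T U c : ℝ, T = 1 + U → 1 + (U - c * T) = (1 - c) * T := fun T U c hT => by
    rw [hT]; ring
  rw [e _ _ _ hA0]
  refine mul_pos ?_ (by linarith)
  have : G p / p ≤ 1 / 2 := div_le_div₀ zero_le_one (h.le_one' p) (by norm_num) hp2
  linarith

theorem abs_tsum_mulQuotient_prime_pow_sub_one_le (h : AgreeOnPrimes a G) {p : ℕ} (hp : p.Prime) :
    |∑' e : ℕ, mulQuotient a G (p ^ e) / ((p ^ e : ℕ) : ℝ) - 1| ≤ 2 * (p : ℝ) ^ (-2 : ℝ) := by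
  have hp2 : (2 : ℝ) ≤ p := by exact_mod_cast hp.two_le
  have hp0 : (0 : ℝ) < p := by linarith
  have hsum : Summable fun e : ℕ => mulQuotient a G (p ^ e) / ((p ^ e : ℕ) : ℝ) :=
    h.summable_norm_mulQuotient_div.of_norm.comp_injective (Nat.pow_right_injective hp.two_le)
  rw [← hsum.sum_add_tsum_nat_add 2, Finset.sum_range_succ, Finset.sum_range_one, pow_zero,
    pow_one, h.mulQuotient_prime hp, h.isMultiplicative_mulQuotient.1, Nat.cast_one, div_one,
    zero_div, add_zero, add_sub_cancel_left]
  have hg : HasSum (fun e : ℕ => (p : ℝ) ^ (-2 : ℝ) * (1 / 2) ^ e) ((p : ℝ) ^ (-2 : ℝ) * 2) :=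
    hasSum_geometric_two.mul_left _
  rw [← Real.norm_eq_abs, mul_comm]
  refine tsum_of_norm_bounded hg fun e => ?_
  rw [norm_div, Real.norm_eq_abs, Real.norm_of_nonneg (Nat.cast_nonneg _)]
  have e1 : (p : ℝ) ^ (-2 : ℝ) = 1 / (p : ℝ) ^ 2 := by
    rw [Real.rpow_neg hp0.le, Real.rpow_two, one_div]
  rw [e1, div_pow, one_pow, ← mul_div_mul_comm, one_mul]
  push_cast
  rw [pow_add (p : ℝ), mul_comm ((p : ℝ) ^ e)]
  have h1 := h.abs_mulQuotient_prime_pow_le hp (e + 2)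
  gcongr

theorem tsum_mulQuotient_div_pos (h : AgreeOnPrimes a G) :
    0 < ∑' n : ℕ, mulQuotient a G n / n := by
  have hprod := EulerProduct.eulerProduct_hasProd (f := fun n : ℕ => mulQuotient a G n / (n : ℝ))
    (by simp [h.isMultiplicative_mulQuotient.1]) (fun {m n} hmn => by
      rw [h.isMultiplicative_mulQuotient.map_mul_of_coprime hmn, Nat.cast_mul, mul_div_mul_comm])
    h.summable_norm_mulQuotient_div (by simp)
  have hpos : ∀ p : Nat.Primes, 0 < ∑' e : ℕ, mulQuotient a G (p ^ e) / ((p ^ e : ℕ) : ℝ) :=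
    fun p => h.tsum_mulQuotient_prime_pow_pos p.2
  have hnn : 0 ≤ ∑' n : ℕ, mulQuotient a G n / n :=
    ge_of_tendsto' hprod fun s => Finset.prod_nonneg fun p _ => (hpos p).le
  have hs2 : Summable fun p : Nat.Primes => 2 * (p : ℝ) ^ (-2 : ℝ) :=
    ((Real.summable_nat_rpow.mpr (by norm_num : (-2 : ℝ) < -1)).comp_injective
      Subtype.val_injective).mul_left 2
  have hne := tprod_one_add_ne_zero_of_summable (f := fun p : Nat.Primes =>
    ∑' e : ℕ, mulQuotient a G (p ^ e) / ((p ^ e : ℕ) : ℝ) - 1)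
    (fun p => by rw [add_sub_cancel]; exact (hpos p).ne')
    (Summable.of_nonneg_of_le (fun _ => norm_nonneg _)
      (fun p => h.abs_tsum_mulQuotient_prime_pow_sub_one_le p.2) hs2)
  simp only [add_sub_cancel] at hne
  rw [hprod.tprod_eq] at hne
  exact lt_of_le_of_ne hnn hne.symm

end AgreeOnPrimes

end Quotient

/-- The arithmetic function with the same values as `f` at the positive integers. -/
noncomputable def toArithmeticFunction (f : ℕ → ℝ) : ArithmeticFunction ℝ :=
  ⟨fun n => if n = 0 then 0 else f n, if_pos rfl⟩

theorem toArithmeticFunction_apply (f : ℕ → ℝ) {n : ℕ} (hn : n ≠ 0) :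
    toArithmeticFunction f n = f n := if_neg hn

theorem partialSum_toArithmeticFunction (f : ℕ → ℝ) (x : ℝ) :
    partialSum (toArithmeticFunction f) x = partialSum f x := by
  refine Finset.sum_congr rfl fun n hn => toArithmeticFunction_apply f ?_
  rw [Finset.mem_Ioc] at hn
  lia

theorem toArithmeticFunction_mem_Icc {f : ℕ → ℝ} (h0 : ∀ n, 0 ≤ f n) (h1 : ∀ n, f n ≤ 1) (n : ℕ) :
    0 ≤ toArithmeticFunction f n ∧ toArithmeticFunction f n ≤ 1 := by
  rcases eq_or_ne n 0 with rfl | hn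
  · simp
  · rw [toArithmeticFunction_apply f hn]
    exact ⟨h0 n, h1 n⟩

theorem agreeOnPrimes_charFn {Q : ℕ → Prop} (hQ1 : Q 1)
    (hQ : ∀ m n, Nat.Coprime m n → (Q (m * n) ↔ Q m ∧ Q n)) :
    AgreeOnPrimes (toArithmeticFunction (charFn Q)) (toArithmeticFunction (primeWeight Q)) := by
  have ha := toArithmeticFunction_mem_Icc (charFn_nonneg Q) (charFn_le_one Q)
  have hg := toArithmeticFunction_mem_Icc (f := primeWeight Q) (charFn_nonneg _) (charFn_le_one _)
  refine ⟨?_, fun m n => ?_, ?_, fun n => (ha n).1, fun n => (ha n).2, fun n => (hg n).1,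
    fun n => (hg n).2, fun p hp => ?_⟩
  · rw [ArithmeticFunction.IsMultiplicative.iff_ne_zero]
    refine ⟨?_, fun {m n} hm hn hmn => ?_⟩
    · rw [toArithmeticFunction_apply _ one_ne_zero, charFn_of_pos hQ1]
    · rw [toArithmeticFunction_apply _ hm, toArithmeticFunction_apply _ hn,
        toArithmeticFunction_apply _ (mul_ne_zero hm hn)]
      by_cases h1 : Q m
      · by_cases h2 : Q n
        · rw [charFn_of_pos h1, charFn_of_pos h2, charFn_of_pos ((hQ m n hmn).mpr ⟨h1, h2⟩),
            one_mul]
        · rw [charFn_of_neg h2, charFn_of_neg fun h3 => h2 ((hQ m n hmn).mp h3).2, mul_zero]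
      · rw [charFn_of_neg h1, charFn_of_neg fun h3 => h1 ((hQ m n hmn).mp h3).1, zero_mul]
  · rcases eq_or_ne m 0 with rfl | hm
    · simp
    rcases eq_or_ne n 0 with rfl | hn
    · simp
    rw [toArithmeticFunction_apply _ hm, toArithmeticFunction_apply _ hn,
      toArithmeticFunction_apply _ (mul_ne_zero hm hn), primeWeight_mul]
  · rw [toArithmeticFunction_apply _ one_ne_zero, primeWeight_one]
  · rw [toArithmeticFunction_apply _ hp.ne_zero, toArithmeticFunction_apply _ hp.ne_zero,
      primeWeight_prime hp]

theorem partialSum_charFn_le (Q : ℕ → Prop) {y : ℝ} (hy : 0 ≤ y) : partialSum (charFn Q) y ≤ y := by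
  refine (Finset.sum_le_sum fun n _ => charFn_le_one Q n).trans ?_
  simpa using Nat.floor_le hy

theorem exists_tendsto_partialSum_charFn {Q : ℕ → Prop} (hQ1 : Q 1)
    (hQ : ∀ m n, Nat.Coprime m n → (Q (m * n) ↔ Q m ∧ Q n)) {ρ δ : ℝ} (hρ : 0 < ρ) (hδ : 0 < δ)
    (hδ1 : δ < 1)
    (hO : (fun x => partialSum (charFn fun q => q.Prime ∧ ¬ Q q) x -
      δ * partialSum (charFn Nat.Prime) x) =O[atTop] fun x => x / Real.log x ^ (2 + ρ)) :
    ∃ A c : ℝ, 0 < A ∧ Tendsto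
      (fun u => (partialSum (charFn Q) (Real.exp u) / (Real.exp u * u ^ (-δ)) - A) * u)
      atTop (nhds c) := by
  obtain ⟨ρ', K, hreg⟩ := exists_isRegularWeight hρ hδ hδ1 hO
  obtain ⟨A, c, hA, hS⟩ := hreg.exists_tendsto_partialSum_sub_mul
  rw [sub_sub_cancel_left] at hS
  have hag := agreeOnPrimes_charFn hQ1 hQ
  set h := mulQuotient (toArithmeticFunction (charFn Q)) (toArithmeticFunction (primeWeight Q))
    with hh
  obtain ⟨c', hc'⟩ := exists_tendsto_tsum_mul (h := h) (by linarith) (by linarith)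
    (fun y hy => by
      rw [abs_of_nonneg (partialSum_nonneg hreg.nonneg y)]
      exact partialSum_charFn_le _ hy) hS
    (fun y hy => partialSum_of_lt_one hy) ArithmeticFunction.map_zero
    hag.summable_abs_mulQuotient_mul_log_sq
  refine ⟨_, c', mul_pos hA hag.tsum_mulQuotient_div_pos, hc'.congr fun u => ?_⟩
  congr 3
  rw [← partialSum_toArithmeticFunction, ← mulQuotient_mul (a := toArithmeticFunction (charFn Q))
    hag.map_mul hag.map_one]
  simp only [← partialSum_toArithmeticFunction (primeWeight Q)]
  rw [← sum_sum_divisorsAntidiagonal]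
  rfl

theorem natCast_countBelow (P : ℕ → Prop) (x : ℝ) :
    (countBelow P x : ℝ) = partialSum (charFn P) x := by
  classical
  unfold countBelow partialSum
  rw [Finset.card_filter, Nat.cast_sum]
  refine Finset.sum_congr (Finset.ext fun n => ?_) fun n _ => ?_
  · simp only [Finset.mem_Icc, Finset.mem_Ioc]
    lia
  · by_cases h : P n
    · rw [if_pos h, charFn_of_pos h, Nat.cast_one]
    · rw [if_neg h, charFn_of_neg h, Nat.cast_zero]

/-- A two-term expansion in the variable `log x`, written as an asymptotic formula in `x`. -/
theorem isLittleO_of_tendsto_comp_exp {N : ℝ → ℝ} {δ A c : ℝ} (hδ : δ ≠ 0) (hA : A ≠ 0)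
    (h : Tendsto (fun u => (N (Real.exp u) / (Real.exp u * u ^ (-δ)) - A) * u) atTop (nhds c)) :
    (fun x => N x - A * x / Real.log x ^ δ *
      (1 + (1 - (1 - c / (δ * A))) / (1 / δ * Real.log x))) =o[atTop]
      fun x => x / (Real.log x ^ δ * Real.log x) := by
  have h1 := (h.comp Real.tendsto_log_atTop).sub_const c
  rw [sub_self] at h1
  rw [isLittleO_iff_tendsto']
  · refine h1.congr' ?_
    filter_upwards [eventually_gt_atTop 1] with x hx
    have hx0 : 0 < x := by linarith
    have hl := Real.log_pos hx
    have hp := Real.rpow_pos_of_pos hl δ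
    simp only [Function.comp_apply, Real.exp_log hx0, Real.rpow_neg hl.le]
    field_simp
    ring
  · filter_upwards [eventually_gt_atTop 1] with x hx h0
    have hl := Real.log_pos hx
    have hp := Real.rpow_pos_of_pos hl δ
    exact absurd h0 (by positivity)

end LandauCount

theorem stmt0 (ℓ : ℕ) (hℓ : ℓ.Prime) (hodd : Odd ℓ)
    (𝔣 : ℕ → ℤ) (hf1 : 𝔣 1 = 1)
    (hfmul : ∀ m n : ℕ, Nat.Coprime m n → 𝔣 (m * n) = 𝔣 m * 𝔣 n)
    (ρ δ : ℝ) (hρ : 0 < ρ) (hδ : 0 < δ) (hδ1 : δ < 1)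
    (h₁ : ℝ) (hh₁ : h₁ = 1 / δ)
    (hprimes : (fun x : ℝ =>
        (countBelow (fun q => q.Prime ∧ (ℓ : ℤ) ∣ 𝔣 q) x : ℝ)
          - δ * (countBelow Nat.Prime x : ℝ))
      =O[atTop] fun x : ℝ => x / Real.log x ^ (2 + ρ)) :
    ∃ C γ : ℝ, 0 < C ∧
      (fun x : ℝ =>
        (countBelow (fun n => ¬ (ℓ : ℤ) ∣ 𝔣 n) x : ℝ)
          - C * x / Real.log x ^ (1 / h₁) * (1 + (1 - γ) / (h₁ * Real.log x)))
        =o[atTop] fun x : ℝ => x / (Real.log x ^ (1 / h₁) * Real.log x) := by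
  have hℓ' := Nat.prime_iff_prime_int.mp hℓ
  simp only [LandauCount.natCast_countBelow] at hprimes ⊢
  obtain ⟨A, c, hA, hT⟩ := LandauCount.exists_tendsto_partialSum_charFn
    (Q := fun n => ¬ (ℓ : ℤ) ∣ 𝔣 n) (by rw [hf1]; exact hℓ'.not_dvd_one)
    (fun m n hmn => by rw [hfmul m n hmn, hℓ'.dvd_mul, not_or]) hρ hδ hδ1
    (by simpa only [not_not] using hprimes)
  refine ⟨A, 1 - c / (δ * A), hA, ?_⟩
  subst hh₁
  rw [one_div_one_div]
  exact LandauCount.isLittleO_of_tendsto_comp_exp hδ.ne' hA.ne' hT
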